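/- arXiv:1512.02600 — 2 statements merged into one kernel-verified Lean document; each statement's English description precedes it below -/
import Mathlib

section
/- There is a constant C ≥ 1 depending only on the doubling constant C_d and the Poincaré constants C_P, λ such that for any set G ⊂ X, cap₁(G ∪ I_G ∪ ∂*G) ≤ C cap₁(G), where I_G is the measure-theoretic interior of G and ∂*G is the measure-theoretic boundary of G. -/
open MeasureTheory Metric Set Filter Topology ENNReal NNReal

noncomputable section

namespace FineBV

variable {X : Type*} [MetricSpace X] [MeasurableSpace X]

/-- `g` is an upper gradient of `u` on `Ω`: for every `1`-Lipschitz
(arclength-parametrized) curve `γ : [0, ℓ] → X` with image in `Ω`,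
`|u (γ ℓ) - u (γ 0)| ≤ ∫_0^ℓ g (γ t) dt`. -/
def IsUpperGradientOn (g : X → ℝ≥0∞) (u : X → ℝ) (Ω : Set X) : Prop :=
  Measurable g ∧
    ∀ (ℓ : ℝ), 0 ≤ ℓ → ∀ γ : ℝ → X, LipschitzOnWith 1 γ (Icc 0 ℓ) →
      (∀ t ∈ Icc (0:ℝ) ℓ, γ t ∈ Ω) →
      ENNReal.ofReal |u (γ ℓ) - u (γ 0)| ≤ ∫⁻ t in Icc (0:ℝ) ℓ, g (γ t)

/-- `g` is an upper gradient of `u` on all of `X`. -/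
def IsUpperGradient (g : X → ℝ≥0∞) (u : X → ℝ) : Prop :=
  IsUpperGradientOn g u univ

/-- The (extended) `L¹` norm. -/
def eL1Norm (μ : Measure X) (u : X → ℝ) : ℝ≥0∞ :=
  ∫⁻ x, ENNReal.ofReal |u x| ∂μ

/-- The (extended) Newtonian `N^{1,1}` norm. -/
def eN11Norm (μ : Measure X) (u : X → ℝ) : ℝ≥0∞ :=
  eL1Norm μ u + ⨅ (g : X → ℝ≥0∞) (_ : IsUpperGradient g u), ∫⁻ x, g x ∂μ

/-- Membership in the Newtonian space `N^{1,1}(X)`. -/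
def MemN11 (μ : Measure X) (u : X → ℝ) : Prop :=
  Measurable u ∧ eN11Norm μ u < ⊤

/-- The `1`-capacity of a set. -/
def capacity1 (μ : Measure X) (A : Set X) : ℝ≥0∞ :=
  ⨅ (u : X → ℝ) (_ : MemN11 μ u) (_ : ∀ x ∈ A, 1 ≤ u x), eN11Norm μ u

/-- The relative (variational) `1`-capacity of `A` with respect to `Ω`. -/
def relCapacity1 (μ : Measure X) (A Ω : Set X) : ℝ≥0∞ :=
  ⨅ (u : X → ℝ) (_ : MemN11 μ u) (g : X → ℝ≥0∞) (_ : IsUpperGradient g u)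
    (_ : ∀ x ∈ A, 1 ≤ u x) (_ : ∀ x, x ∉ Ω → u x = 0),
    ∫⁻ x in Ω, g x ∂μ

/-- `A` is `1`-thin at `x`. -/
def OneThinAt (μ : Measure X) (A : Set X) (x : X) : Prop :=
  Tendsto (fun r : ℝ =>
      ENNReal.ofReal r * relCapacity1 μ (A ∩ ball x r) (ball x (2 * r)) / μ (ball x r))
    (𝓝[>] 0) (𝓝 0)

/-- `U` is `1`-finely open. -/
def OneFinelyOpen (μ : Measure X) (U : Set X) : Prop :=
  ∀ x ∈ U, OneThinAt μ Uᶜ x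

/-- `F` is `1`-finely closed. -/
def OneFinelyClosed (μ : Measure X) (F : Set X) : Prop :=
  OneFinelyOpen μ Fᶜ

/-- The `1`-fine closure: the smallest `1`-finely closed set containing `G`. -/
def oneFineClosure (μ : Measure X) (G : Set X) : Set X :=
  ⋂₀ {F : Set X | G ⊆ F ∧ OneFinelyClosed μ F}

/-- `μ` is doubling with constant `Cd`: balls have positive finite measure and
`μ(B(x,2r)) ≤ Cd · μ(B(x,r))`. -/
def DoublingWith (μ : Measure X) (Cd : ℝ≥0) : Prop :=
  ∀ (x : X) (r : ℝ), 0 < r →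
    0 < μ (ball x r) ∧ μ (ball x (2 * r)) ≤ (Cd : ℝ≥0∞) * μ (ball x r) ∧ μ (ball x r) < ⊤

/-- `u` is Lipschitz on compact subsets of `Ω` (locally Lipschitz in `Ω`). -/
def LocLipschitzOn (u : X → ℝ) (Ω : Set X) : Prop :=
  ∀ K : Set X, K ⊆ Ω → IsCompact K → ∃ L : ℝ≥0, LipschitzOnWith L u K

/-- The total variation `‖Du‖(Ω)`. -/
def totalVariation (μ : Measure X) (u : X → ℝ) (Ω : Set X) : ℝ≥0∞ :=
  ⨅ (v : ℕ → X → ℝ) (g : ℕ → X → ℝ≥0∞)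
    (_ : ∀ i, LocLipschitzOn (v i) Ω)
    (_ : ∀ i, IsUpperGradientOn (g i) (v i) Ω)
    (_ : ∀ K : Set X, K ⊆ Ω → IsCompact K →
        Tendsto (fun i => ∫⁻ x in K, ENNReal.ofReal |v i x - u x| ∂μ) atTop (𝓝 0)),
    Filter.atTop.liminf fun i => ∫⁻ x in Ω, g i x ∂μ

/-- The perimeter `P(E,Ω) = ‖Dχ_E‖(Ω)`. -/
def perimeter (μ : Measure X) (E Ω : Set X) : ℝ≥0∞ :=
  totalVariation μ (Set.indicator E fun _ => (1 : ℝ)) Ω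

/-- `u ∈ BV(X)`. -/
def MemBV (μ : Measure X) (u : X → ℝ) : Prop :=
  Integrable u μ ∧ totalVariation μ u univ < ⊤

/-- The (extended) `BV` norm. -/
def eBVNorm (μ : Measure X) (u : X → ℝ) : ℝ≥0∞ :=
  eL1Norm μ u + totalVariation μ u univ

/-- The `(1,1)`-Poincaré inequality with constants `CP`, `lam`. -/
def PoincareIneq (μ : Measure X) (CP lam : ℝ) : Prop :=
  ∀ (x : X) (r : ℝ), 0 < r → ∀ (u : X → ℝ) (g : X → ℝ≥0∞),
    LocallyIntegrable u μ → IsUpperGradient g u →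
    (∫⁻ y in ball x r, ENNReal.ofReal |u y - ⨍ z in ball x r, u z ∂μ| ∂μ) / μ (ball x r)
      ≤ ENNReal.ofReal (CP * r) * ((∫⁻ y in ball x (lam * r), g y ∂μ) / μ (ball x (lam * r)))

/-- The restricted spherical Hausdorff content of codimension 1, at scale `R`. -/
def codimHContent (μ : Measure X) (R : ℝ) (A : Set X) : ℝ≥0∞ :=
  ⨅ (c : ℕ → X) (r : ℕ → ℝ) (_ : ∀ i, 0 < r i ∧ r i ≤ R)
    (_ : A ⊆ ⋃ i, ball (c i) (r i)),
    ∑' i, μ (ball (c i) (r i)) / ENNReal.ofReal (r i)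

/-- The codimension 1 Hausdorff measure `H(A) = lim_{R→0⁺} H_R(A)`. -/
def codimH (μ : Measure X) (A : Set X) : ℝ≥0∞ :=
  ⨆ (R : ℝ) (_ : 0 < R), codimHContent μ R A

/-- The measure-theoretic interior `I_E`. -/
def measInterior (μ : Measure X) (E : Set X) : Set X :=
  {x | Tendsto (fun r : ℝ => μ (ball x r \ E) / μ (ball x r)) (𝓝[>] 0) (𝓝 0)}

/-- The measure-theoretic boundary `∂*E`. -/
def measBoundary (μ : Measure X) (E : Set X) : Set X :=
  {x | 0 < limsup (fun r : ℝ => μ (ball x r ∩ E) / μ (ball x r)) (𝓝[>] 0) ∧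
       0 < limsup (fun r : ℝ => μ (ball x r \ E) / μ (ball x r)) (𝓝[>] 0)}

/-- The lower approximate limit `u^∧`. -/
def lowerApprox (μ : Measure X) (u : X → ℝ) (x : X) : EReal :=
  sSup {t : EReal |
    Tendsto (fun r : ℝ => μ (ball x r ∩ {y | (u y : EReal) < t}) / μ (ball x r))
      (𝓝[>] 0) (𝓝 0)}

/-- The upper approximate limit `u^∨`. -/
def upperApprox (μ : Measure X) (u : X → ℝ) (x : X) : EReal :=
  sInf {t : EReal |
    Tendsto (fun r : ℝ => μ (ball x r ∩ {y | t < (u y : EReal)}) / μ (ball x r))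
      (𝓝[>] 0) (𝓝 0)}

/-- The next jump value after the value `p` at `x`. -/
def jumpNext (μ : Measure X) (u : X → ℝ) (p : EReal) (x : X) : EReal :=
  sSup {t : EReal | ∀ δ : ℝ, 0 < δ →
    Tendsto (fun r : ℝ =>
        μ (ball x r ∩ {y | p + (δ : EReal) < (u y : EReal) ∧ (u y : EReal) < t}) /
          μ (ball x r))
      (𝓝[>] 0) (𝓝 0)}

/-- Auxiliary jump values: `jumpAux μ u (l-1)` is the `l`-th jump value for `l < n`. -/
def jumpAux (μ : Measure X) (u : X → ℝ) : ℕ → X → EReal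
  | 0 => lowerApprox μ u
  | (l + 1) => fun x =>
      if jumpAux μ u l x < upperApprox μ u x then jumpNext μ u (jumpAux μ u l x) x
      else upperApprox μ u x

/-- The jump values `u^l`, `l = 1, …, n`, with `u^1 = u^∧` and `u^n = u^∨`. -/
def jumpVal (μ : Measure X) (u : X → ℝ) (n l : ℕ) : X → EReal :=
  if l = n then upperApprox μ u else jumpAux μ u (l - 1)

/-- The extended absolute difference `|a - b|` of two extended reals, with the
convention that it is `∞` whenever exactly one of them is infinite or they are
distinct infinities, and `0` when `a = b`. -/
def eAbsDiff (a b : EReal) : ℝ≥0∞ :=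
  if a = b then 0
  else if a = ⊤ ∨ a = ⊥ ∨ b = ⊤ ∨ b = ⊥ then ⊤
  else ENNReal.ofReal |a.toReal - b.toReal|

/-- `γ` satisfies the density-bound property: for every set of finite perimeter `E`,
`H`-a.e. point of `∂*E` has lower density `≥ γ` and upper density `≤ 1 - γ`. -/
def GammaDensityProperty (μ : Measure X) (γ : ℝ) : Prop :=
  ∀ E : Set X, MeasurableSet E → perimeter μ E univ < ⊤ →
    codimH μ {x ∈ measBoundary μ E |
      ¬ (ENNReal.ofReal γ ≤
            Filter.liminf (fun r : ℝ => μ (ball x r ∩ E) / μ (ball x r)) (𝓝[>] 0) ∧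
          Filter.limsup (fun r : ℝ => μ (ball x r ∩ E) / μ (ball x r)) (𝓝[>] 0) ≤
            ENNReal.ofReal (1 - γ))} = 0

/-- `v` is a discrete convolution of `u` at scale `R` (with dilation parameter `lam`). -/
def IsDiscreteConvolution (μ : Measure X) (lam R : ℝ) (u v : X → ℝ) : Prop :=
  ∃ (c : ℕ → X) (φ : ℕ → X → ℝ),
    (∀ z : X, ∃ j, z ∈ ball (c j) R) ∧
    (∃ C₀ : ℕ, ∀ k : ℕ,
      {j : ℕ | (ball (c j) (10 * lam * R) ∩ ball (c k) (10 * lam * R)).Nonempty}.Finite ∧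
      {j : ℕ | (ball (c j) (10 * lam * R) ∩ ball (c k) (10 * lam * R)).Nonempty}.ncard ≤ C₀) ∧
    (∀ j z, 0 ≤ φ j z ∧ φ j z ≤ 1) ∧
    (∃ L : ℝ≥0, ∀ j, LipschitzWith (L * (Real.toNNReal R)⁻¹) (φ j)) ∧
    (∀ j, tsupport (φ j) ⊆ ball (c j) (2 * R)) ∧
    (∀ z : X, HasSum (fun j => φ j z) 1) ∧
    (∀ z : X, v z = ∑' j, (⨍ y in ball (c j) (5 * R), u y ∂μ) * φ j z)


lemma IsUpperGradient.ofReal_abs_sub_le {g : X → ℝ≥0∞} {u : X → ℝ} (h : IsUpperGradient g u)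
    {ℓ s t : ℝ} {γ : ℝ → X} (hγ : LipschitzOnWith 1 γ (Icc 0 ℓ)) (hs : 0 ≤ s) (hst : s ≤ t)
    (ht : t ≤ ℓ) :
    ENNReal.ofReal |u (γ t) - u (γ s)| ≤ ∫⁻ τ in Icc s t, g (γ τ) := by
  have hL : LipschitzOnWith 1 (fun τ => γ (s + τ)) (Icc 0 (t - s)) := by
    intro a ha b hb
    have := hγ (x := s + a) ⟨by linarith [ha.1], by linarith [ha.2]⟩
      (y := s + b) ⟨by linarith [hb.1], by linarith [hb.2]⟩
    simpa using this
  have h1 := h.2 (t - s) (by linarith) (fun τ => γ (s + τ)) hL (fun _ _ => mem_univ _)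
  have h2 := (measurePreserving_add_left volume s).setLIntegral_comp_preimage_emb
    (measurableEmbedding_addLeft s) (fun τ => g (γ τ)) (Icc s t)
  simp only [preimage_const_add_Icc, sub_self] at h2
  simp only [add_zero, add_sub_cancel] at h1
  rwa [h2] at h1

lemma isUpperGradient_of_forall_le {g : X → ℝ≥0∞} {u : X → ℝ} (hg : Measurable g)
    (h : ∀ ℓ : ℝ, 0 ≤ ℓ → ∀ γ : ℝ → X, LipschitzOnWith 1 γ (Icc 0 ℓ) → u (γ 0) ≤ u (γ ℓ) →
      ENNReal.ofReal (u (γ ℓ) - u (γ 0)) ≤ ∫⁻ t in Icc (0:ℝ) ℓ, g (γ t)) :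
    IsUpperGradient g u := by
  refine ⟨hg, fun ℓ hℓ γ hγ _ => ?_⟩
  rcases le_total (u (γ 0)) (u (γ ℓ)) with hle | hle
  · rw [abs_of_nonneg (sub_nonneg.2 hle)]
    exact h ℓ hℓ γ hγ hle
  · have hL : LipschitzOnWith 1 (fun τ => γ (ℓ - τ)) (Icc 0 ℓ) := by
      intro a ha b hb
      have := hγ (x := ℓ - a) ⟨by linarith [ha.2], by linarith [ha.1]⟩
        (y := ℓ - b) ⟨by linarith [hb.2], by linarith [hb.1]⟩
      simpa using this
    have h1 := h ℓ hℓ (fun τ => γ (ℓ - τ)) hL (by simpa using hle)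
    have h2 := (Measure.measurePreserving_sub_left volume ℓ).setLIntegral_comp_preimage_emb
      (measurableEmbedding_subLeft ℓ) (fun τ => g (γ τ)) (Icc 0 ℓ)
    simp only [preimage_const_sub_Icc, sub_self, sub_zero] at h2 h1
    rw [abs_sub_comm, abs_of_nonneg (sub_nonneg.2 hle)]
    rwa [h2] at h1

lemma IsUpperGradient.continuousOn_comp {g : X → ℝ≥0∞} {u : X → ℝ} (h : IsUpperGradient g u)
    {ℓ : ℝ} {γ : ℝ → X} (hγ : LipschitzOnWith 1 γ (Icc 0 ℓ))
    (hfin : ∫⁻ t in Icc (0:ℝ) ℓ, g (γ t) ≠ ⊤) :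
    ContinuousOn (fun t => u (γ t)) (Icc 0 ℓ) := by
  have key : ∀ ε : ℝ, 0 < ε → ∃ δ : ℝ, 0 < δ ∧ ∀ s t : ℝ, 0 ≤ s → s ≤ t → t ≤ ℓ → t - s < δ →
      |u (γ t) - u (γ s)| < ε := by
    intro ε hε
    obtain ⟨δ, hδ, H⟩ := exists_pos_setLIntegral_lt_of_measure_lt hfin
      (ENNReal.ofReal_pos.2 hε).ne'
    obtain ⟨d, -, hd0, hd⟩ := ENNReal.lt_iff_exists_real_btwn.1 hδ
    refine ⟨d, ENNReal.ofReal_pos.1 hd0, fun s t hs hst ht hlt => ?_⟩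
    have h1 := H (Icc s t) <| by
      refine (Measure.restrict_apply_le _ _).trans_lt (lt_of_le_of_lt ?_ hd)
      rw [Real.volume_Icc]
      exact ENNReal.ofReal_le_ofReal hlt.le
    rw [Measure.restrict_restrict measurableSet_Icc,
      inter_eq_left.2 (Icc_subset_Icc hs ht)] at h1
    exact (ENNReal.ofReal_lt_ofReal_iff hε).1 ((h.ofReal_abs_sub_le hγ hs hst ht).trans_lt h1)
  rw [Metric.continuousOn_iff]
  intro b hb ε hε
  obtain ⟨δ, hδ, H⟩ := key ε hε
  refine ⟨δ, hδ, fun a ha hab => ?_⟩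
  rw [Real.dist_eq] at hab ⊢
  rcases le_total a b with hle | hle
  · rw [abs_sub_comm] at hab ⊢
    exact H a b ha.1 hle hb.2 ((le_abs_self _).trans_lt hab)
  · exact H b a hb.1 hle ha.2 ((le_abs_self _).trans_lt hab)

/-- The truncation of `u` at levels `a` and `b` has an upper gradient that is concentrated on
`{a ≤ u ≤ b}`, up to a correction that only has to be infinite along those curves along which
`u` may fail to be continuous. -/
lemma IsUpperGradient.clamp {g g' : X → ℝ≥0∞} {u : X → ℝ} (h : IsUpperGradient g u)
    (hg' : Measurable g') (a b : ℝ) (hle : ∀ x, a ≤ u x → u x ≤ b → g x ≤ g' x)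
    (htop : ∀ (ℓ : ℝ) (γ : ℝ → X), LipschitzOnWith 1 γ (Icc 0 ℓ) →
      ∫⁻ t in Icc (0:ℝ) ℓ, g (γ t) = ⊤ → ∫⁻ t in Icc (0:ℝ) ℓ, g' (γ t) = ⊤) :
    IsUpperGradient g' (fun x => max a (min b (u x))) := by
  refine isUpperGradient_of_forall_le hg' fun ℓ hℓ γ hγ hmono => ?_
  by_cases hfin : ∫⁻ t in Icc (0:ℝ) ℓ, g (γ t) = ⊤
  · rw [htop ℓ γ hγ hfin]; exact le_top
  have hc := h.continuousOn_comp hγ hfin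
  set a' := max a (min b (u (γ 0))) with ha'
  set b' := max a (min b (u (γ ℓ))) with hb'
  rcases hmono.eq_or_lt with heq | hlt
  · simp [heq]
  have haa' : a ≤ a' := le_max_left _ _
  have hb'u : b' ≤ u (γ ℓ) ∧ b' ≤ b := by
    have : a < min b (u (γ ℓ)) := by
      by_contra hcon
      rw [hb', max_eq_left (not_lt.1 hcon)] at hlt
      exact absurd hlt (not_lt.2 haa')
    rw [hb', max_eq_right this.le]
    exact ⟨min_le_right _ _, min_le_left _ _⟩
  have hua' : u (γ 0) ≤ a' := by
    have : u (γ 0) ≤ b := by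
      by_contra hcon
      have h1 : b ≤ a' := by
        rw [ha', min_eq_left (not_le.1 hcon).le]; exact le_max_right _ _
      linarith [hb'u.2]
    rw [ha', min_eq_right this]; exact le_max_right _ _
  obtain ⟨t, ⟨ht, htb⟩, htmin⟩ : ∃ t, IsLeast (Icc 0 ℓ ∩ (fun t => u (γ t)) ⁻¹' Ici b') t :=
    (isCompact_Icc.of_isClosed_subset (hc.preimage_isClosed_of_isClosed isClosed_Icc isClosed_Ici)
      inter_subset_left).exists_isLeast ⟨ℓ, ⟨hℓ, le_rfl⟩, hb'u.1⟩
  have hc' : ContinuousOn (fun t => u (γ t)) (Icc 0 t) := hc.mono (Icc_subset_Icc_right ht.2)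
  obtain ⟨s, ⟨hs, hsa⟩, hsmax⟩ : ∃ s, IsGreatest (Icc 0 t ∩ (fun t => u (γ t)) ⁻¹' Iic a') s :=
    (isCompact_Icc.of_isClosed_subset (hc'.preimage_isClosed_of_isClosed isClosed_Icc isClosed_Iic)
      inter_subset_left).exists_isGreatest ⟨0, ⟨le_rfl, ht.1⟩, hua'⟩
  simp only [mem_preimage, mem_Ici, mem_Iic] at htb hsa
  calc ENNReal.ofReal (b' - a') ≤ ENNReal.ofReal |u (γ t) - u (γ s)| :=
        ENNReal.ofReal_le_ofReal ((by linarith : b' - a' ≤ _).trans (le_abs_self _))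
    _ ≤ ∫⁻ τ in Icc s t, g (γ τ) := h.ofReal_abs_sub_le hγ hs.1 hs.2 ht.2
    _ = ∫⁻ τ in Ioo s t, g (γ τ) := setLIntegral_congr Ioo_ae_eq_Icc.symm
    _ ≤ ∫⁻ τ in Ioo s t, g' (γ τ) := by
        refine setLIntegral_mono' measurableSet_Ioo fun τ hτ => hle _ ?_ ?_
        · refine haa'.trans (not_lt.1 fun hcon => ?_)
          exact absurd (hsmax ⟨⟨hs.1.trans hτ.1.le, hτ.2.le⟩, hcon.le⟩) (not_le.2 hτ.1)
        · refine le_trans (not_lt.1 fun hcon => ?_) hb'u.2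
          exact absurd (htmin ⟨⟨hs.1.trans hτ.1.le, hτ.2.le.trans ht.2⟩, hcon.le⟩)
            (not_le.2 hτ.2)
    _ ≤ ∫⁻ τ in Icc 0 ℓ, g' (γ τ) :=
        lintegral_mono_set (Ioo_subset_Icc_self.trans (Icc_subset_Icc hs.1 ht.2))

lemma capacity1_mono (μ : Measure X) {A B : Set X} (h : A ⊆ B) :
    capacity1 μ A ≤ capacity1 μ B := by
  unfold capacity1
  exact le_iInf fun u => le_iInf fun hu => le_iInf fun hB =>
    iInf_le_of_le u (iInf_le_of_le hu (iInf_le_of_le (fun x hx => hB x (h hx)) le_rfl))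

lemma capacity1_le {μ : Measure X} {A : Set X} {u : X → ℝ} {g : X → ℝ≥0∞} (hu : Measurable u)
    (hg : IsUpperGradient g u) (hA : ∀ x ∈ A, 1 ≤ u x) :
    capacity1 μ A ≤ eL1Norm μ u + ∫⁻ x, g x ∂μ := by
  have h1 : eN11Norm μ u ≤ eL1Norm μ u + ∫⁻ x, g x ∂μ :=
    add_le_add le_rfl (iInf_le_of_le g (iInf_le_of_le hg le_rfl))
  by_cases htop : eL1Norm μ u + ∫⁻ x, g x ∂μ = ⊤
  · rw [htop]; exact le_top
  · unfold capacity1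
    exact iInf_le_of_le u (iInf_le_of_le ⟨hu, h1.trans_lt (lt_top_iff_ne_top.2 htop)⟩
      (iInf_le_of_le hA h1))

lemma exists_of_capacity1_lt {μ : Measure X} {A : Set X} {K : ℝ≥0∞} (h : capacity1 μ A < K) :
    ∃ (u : X → ℝ) (g : X → ℝ≥0∞), Measurable u ∧ IsUpperGradient g u ∧ (∀ x ∈ A, 1 ≤ u x) ∧
      eL1Norm μ u + ∫⁻ x, g x ∂μ < K := by
  simp only [capacity1, iInf_lt_iff] at h
  obtain ⟨u, hu, hA, hlt⟩ := h
  rw [eN11Norm, ENNReal.add_iInf] at hlt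
  obtain ⟨g, hlt⟩ := iInf_lt_iff.1 hlt
  by_cases hg : IsUpperGradient g u
  · exact ⟨u, g, hu.1, hg, hA, by simpa [hg] using hlt⟩
  · simp [hg] at hlt

lemma capacity1_iUnion_le {ι : Type*} [Countable ι] (μ : Measure X) (A : ι → Set X) :
    capacity1 μ (⋃ i, A i) ≤ ∑' i, capacity1 μ (A i) := by
  by_cases htop : ∑' i, capacity1 μ (A i) = ⊤
  · rw [htop]; exact le_top
  refine ENNReal.le_of_forall_pos_le_add fun ε hε _ => ?_
  obtain ⟨ε', hε', hsum⟩ := ENNReal.exists_pos_sum_of_countable'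
    (ENNReal.coe_ne_zero.2 hε.ne') ι
  have hlt : ∀ i, capacity1 μ (A i) < capacity1 μ (A i) + ε' i := fun i =>
    ENNReal.lt_add_right (ENNReal.ne_top_of_tsum_ne_top htop i) (hε' i).ne'
  choose u g hu hg hA hK using fun i => exists_of_capacity1_lt (hlt i)
  set W : X → ℝ≥0∞ := fun x => ⨆ i, min 1 (ENNReal.ofReal (u i x)) with hW
  have hW1 : ∀ x, W x ≤ 1 := fun x => iSup_le fun i => min_le_left _ _
  have hWtop : ∀ x, W x ≠ ⊤ := fun x => ((hW1 x).trans_lt ENNReal.one_lt_top).ne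
  have hWm : Measurable W := .iSup fun i => measurable_const.min (hu i).ennreal_ofReal
  have hgm : Measurable fun x => ∑' i, g i x := .tsum fun i => (hg i).1
  have hUG : IsUpperGradient (fun x => ∑' i, g i x) fun x => (W x).toReal := by
    refine isUpperGradient_of_forall_le hgm fun ℓ hℓ γ hγ _ => ?_
    rw [ENNReal.ofReal_sub _ ENNReal.toReal_nonneg, ENNReal.ofReal_toReal (hWtop _),
      ENNReal.ofReal_toReal (hWtop _), tsub_le_iff_left]
    refine iSup_le fun i => ?_
    have h1 : ENNReal.ofReal (u i (γ ℓ)) ≤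
        ENNReal.ofReal (u i (γ 0)) + ENNReal.ofReal |u i (γ ℓ) - u i (γ 0)| := by
      refine le_trans (ENNReal.ofReal_le_ofReal ?_) ENNReal.ofReal_add_le
      linarith [le_abs_self (u i (γ ℓ) - u i (γ 0))]
    have h2 : ENNReal.ofReal |u i (γ ℓ) - u i (γ 0)| ≤
        ∫⁻ t in Icc (0:ℝ) ℓ, ∑' i, g i (γ t) :=
      ((hg i).2 ℓ hℓ γ hγ fun _ _ => mem_univ _).trans
        (lintegral_mono fun t => ENNReal.le_tsum i)
    calc min 1 (ENNReal.ofReal (u i (γ ℓ)))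
        ≤ min 1 (ENNReal.ofReal (u i (γ 0))) + ENNReal.ofReal |u i (γ ℓ) - u i (γ 0)| := by
          rw [min_add]
          exact le_min ((min_le_left _ _).trans le_self_add) ((min_le_right _ _).trans h1)
      _ ≤ W (γ 0) + ∫⁻ t in Icc (0:ℝ) ℓ, ∑' i, g i (γ t) :=
          add_le_add (le_iSup (fun i => min 1 (ENNReal.ofReal (u i (γ 0)))) i) h2
  refine (capacity1_le hWm.ennreal_toReal hUG ?_).trans ?_
  · intro x hx
    obtain ⟨i, hi⟩ := mem_iUnion.1 hx
    have : W x = 1 := le_antisymm (hW1 x) <| by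
      refine le_iSup_of_le i (le_min le_rfl ?_)
      simpa using ENNReal.ofReal_le_ofReal (hA i x hi)
    simp [this]
  · have hL : eL1Norm μ (fun x => (W x).toReal) ≤ ∑' i, eL1Norm μ (u i) := by
      unfold eL1Norm
      rw [← lintegral_tsum fun i => by fun_prop]
      refine lintegral_mono fun x => ?_
      simp only [abs_of_nonneg ENNReal.toReal_nonneg, ENNReal.ofReal_toReal (hWtop x)]
      exact iSup_le fun i => (min_le_right _ _).trans
        ((ENNReal.ofReal_le_ofReal (le_abs_self _)).trans
          (ENNReal.le_tsum (f := fun i => ENNReal.ofReal |u i x|) i))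
    calc _ ≤ ∑' i, eL1Norm μ (u i) + ∑' i, ∫⁻ x, g i x ∂μ := by
          rw [← lintegral_tsum fun i => (hg i).1.aemeasurable]
          exact add_le_add hL le_rfl
      _ = ∑' i, (eL1Norm μ (u i) + ∫⁻ x, g i x ∂μ) := ENNReal.tsum_add.symm
      _ ≤ ∑' i, (capacity1 μ (A i) + ε' i) := ENNReal.tsum_le_tsum fun i => (hK i).le
      _ = ∑' i, capacity1 μ (A i) + ∑' i, ε' i := ENNReal.tsum_add
      _ ≤ _ := add_le_add le_rfl hsum.le

lemma capacity1_union_le (μ : Measure X) (A B : Set X) :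
    capacity1 μ (A ∪ B) ≤ capacity1 μ A + capacity1 μ B := by
  rw [union_eq_iUnion]
  refine (capacity1_iUnion_le μ _).trans ?_
  rw [tsum_fintype]
  simp

lemma capacity1_ball_le [BorelSpace X] {μ : Measure X} {Cd : ℝ≥0} (hμ : DoublingWith μ Cd)
    (x : X) {r R : ℝ} (hr : 0 < r) (hrR : r ≤ R) :
    capacity1 μ (ball x r) ≤
      ENNReal.ofReal (R + 1) * Cd ^ 2 * (μ (ball x r) / ENNReal.ofReal r) := by
  have hUG0 : IsUpperGradient (fun _ : X => ENNReal.ofReal r⁻¹) (fun y => 2 - dist y x / r) := by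
    refine ⟨measurable_const, fun ℓ hℓ γ hγ _ => ?_⟩
    rw [setLIntegral_const, Real.volume_Icc, sub_zero, ← ENNReal.ofReal_mul (by positivity)]
    refine ENNReal.ofReal_le_ofReal ?_
    have h1 : dist (γ 0) (γ ℓ) ≤ ℓ := by
      have := hγ.dist_le_mul 0 ⟨le_rfl, hℓ⟩ ℓ ⟨hℓ, le_rfl⟩
      simpa [abs_of_nonneg hℓ] using this
    have h2 : 2 - dist (γ ℓ) x / r - (2 - dist (γ 0) x / r) =
        r⁻¹ * (dist (γ 0) x - dist (γ ℓ) x) := by field_simp; ring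
    rw [h2, abs_mul, abs_of_pos (inv_pos.2 hr)]
    exact mul_le_mul_of_nonneg_left ((abs_dist_sub_le _ _ _).trans h1) (inv_pos.2 hr).le
  have hUG := hUG0.clamp (g' := (ball x (4 * r)).indicator fun _ => ENNReal.ofReal r⁻¹)
    (measurable_const.indicator measurableSet_ball) 0 1 (fun y hy0 _ => by
      rw [indicator_of_mem]
      have : dist y x / r ≤ 2 := by linarith
      rw [div_le_iff₀ hr] at this
      rw [mem_ball]; linarith) (fun ℓ γ _ h => by
      rw [setLIntegral_const, Real.volume_Icc] at h
      exact absurd h (ENNReal.mul_ne_top ENNReal.ofReal_ne_top ENNReal.ofReal_ne_top))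
  refine (capacity1_le (by fun_prop) hUG fun y hy => ?_).trans ?_
  · have : dist y x / r ≤ 1 := (div_le_one hr).2 (mem_ball.1 hy).le
    exact le_max_of_le_right (le_min le_rfl (by linarith))
  have hL : eL1Norm μ (fun y => max 0 (min 1 (2 - dist y x / r))) ≤ μ (ball x (4 * r)) := by
    rw [← lintegral_indicator_one measurableSet_ball]
    refine lintegral_mono fun y => ?_
    by_cases hy : y ∈ ball x (4 * r)
    · rw [indicator_of_mem hy, abs_of_nonneg (le_max_left _ _)]
      simp
    · have h1 : 4 * r ≤ dist y x := not_lt.1 hy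
      have h2 : 2 ≤ dist y x / r := by rw [le_div_iff₀ hr]; linarith
      have h3 : max 0 (min 1 (2 - dist y x / r)) = 0 :=
        max_eq_left ((min_le_right _ _).trans (by linarith))
      simp [h3]
  have h4 : μ (ball x (4 * r)) ≤ Cd ^ 2 * μ (ball x r) := by
    have h1 := (hμ x (2 * r) (by linarith)).2.1
    rw [← mul_assoc, show (2 : ℝ) * 2 = 4 by norm_num] at h1
    refine h1.trans ?_
    rw [pow_two, mul_assoc]
    exact mul_le_mul_right (hμ x r hr).2.1 _
  calc _ ≤ μ (ball x (4 * r)) + ENNReal.ofReal r⁻¹ * μ (ball x (4 * r)) := by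
        rw [lintegral_indicator measurableSet_ball, setLIntegral_const]
        exact add_le_add hL le_rfl
    _ = ENNReal.ofReal (1 + r⁻¹) * μ (ball x (4 * r)) := by
        rw [ENNReal.ofReal_add zero_le_one (by positivity), ENNReal.ofReal_one, add_mul, one_mul]
    _ ≤ ENNReal.ofReal ((R + 1) * r⁻¹) * (Cd ^ 2 * μ (ball x r)) := by
        refine mul_le_mul' (ENNReal.ofReal_le_ofReal ?_) h4
        have : 1 = r * r⁻¹ := (mul_inv_cancel₀ hr.ne').symm
        nlinarith [inv_pos.2 hr]
    _ = _ := by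
        rw [ENNReal.ofReal_mul (by linarith), ENNReal.ofReal_inv_of_pos hr, div_eq_mul_inv]
        ring

lemma DoublingWith.sigmaFinite {μ : Measure X} {Cd : ℝ≥0} (hμ : DoublingWith μ Cd) :
    SigmaFinite μ := by
  rcases isEmpty_or_nonempty X with h | ⟨⟨x⟩⟩
  · rw [Measure.eq_zero_of_isEmpty μ]; infer_instance
  · exact ⟨⟨{ set := fun n : ℕ => ball x (n + 1)
              set_mem := fun _ => mem_univ _
              finite := fun n => (hμ x (n + 1) (by positivity)).2.2
              spanning := iUnion_eq_univ_iff.2 fun y =>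
                (exists_nat_gt (dist y x)).imp fun n hn => mem_ball.2 (by linarith) }⟩⟩

lemma DoublingWith.measure_ball_two_pow_le {μ : Measure X} {Cd : ℝ≥0} (hμ : DoublingWith μ Cd)
    (x : X) {r : ℝ} (hr : 0 < r) (k : ℕ) :
    μ (ball x (2 ^ k * r)) ≤ Cd ^ k * μ (ball x r) := by
  induction k with
  | zero => simp
  | succ k ih =>
    calc μ (ball x (2 ^ (k + 1) * r)) = μ (ball x (2 * (2 ^ k * r))) := by ring_nf
      _ ≤ Cd * μ (ball x (2 ^ k * r)) := (hμ x _ (by positivity)).2.1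
      _ ≤ Cd * (Cd ^ k * μ (ball x r)) := mul_le_mul_right ih _
      _ = Cd ^ (k + 1) * μ (ball x r) := by ring

lemma capacity1_le_of_forall_disjoint [BorelSpace X] {μ : Measure X} {Cd : ℝ≥0}
    (hμ : DoublingWith μ Cd) {S : Set X} {ρ : X → ℝ} {R : ℝ}
    (hρ : ∀ x ∈ S, 0 < ρ x ∧ ρ x ≤ R) {K : ℝ≥0∞}
    (hK : ∀ T ⊆ S, T.Countable → T.PairwiseDisjoint (fun x => ball x (ρ x)) →
      ∑' x : T, μ (ball (x : X) (ρ x)) / ENNReal.ofReal (ρ x) ≤ K) :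
    capacity1 μ S ≤ ENNReal.ofReal (8 * R + 1) * Cd ^ 5 * K := by
  have := hμ.sigmaFinite
  obtain ⟨T, hTS, hdisj, hcov⟩ := Vitali.exists_disjoint_subfamily_covering_enlargement_closedBall
    S id ρ R (fun x hx => (hρ x hx).2) 5 (by norm_num)
  have hdisj' : T.PairwiseDisjoint fun x => ball x (ρ x) :=
    hdisj.mono fun x => ball_subset_closedBall
  have hT : T.Countable := by
    have h1 := Measure.countable_meas_pos_of_disjoint_iUnion (μ := μ)
      (As := fun x : T => ball (x : X) (ρ x)) (fun _ => measurableSet_ball)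
      (hdisj'.subtype _ _)
    have h2 : {x : T | 0 < μ (ball (x : X) (ρ x))} = univ :=
      eq_univ_of_forall fun x => (hμ x _ (hρ x (hTS x.2)).1).1
    rw [h2, countable_univ_iff] at h1
    exact countable_coe_iff.1 h1
  have := hT.to_subtype
  have hsub : S ⊆ ⋃ y : T, ball (y : X) (8 * ρ y) := by
    intro x hx
    obtain ⟨y, hy, hxy⟩ := hcov x hx
    have h1 := hxy (mem_closedBall_self (hρ x hx).1.le)
    refine mem_iUnion.2 ⟨⟨y, hy⟩, mem_ball.2 ((mem_closedBall.1 h1).trans_lt ?_)⟩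
    have := (hρ y (hTS hy)).1
    dsimp only
    linarith
  calc capacity1 μ S ≤ capacity1 μ (⋃ y : T, ball (y : X) (8 * ρ y)) := capacity1_mono μ hsub
    _ ≤ ∑' y : T, capacity1 μ (ball (y : X) (8 * ρ y)) := capacity1_iUnion_le μ _
    _ ≤ ∑' y : T, ENNReal.ofReal (8 * R + 1) * Cd ^ 5 *
          (μ (ball (y : X) (ρ y)) / ENNReal.ofReal (ρ y)) := by
        refine ENNReal.tsum_le_tsum fun y => ?_
        obtain ⟨h0, h1⟩ := hρ y (hTS y.2)
        refine (capacity1_ball_le hμ y (by linarith : 0 < 8 * ρ y)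
          (by linarith : 8 * ρ y ≤ 8 * R)).trans ?_
        have h2 := hμ.measure_ball_two_pow_le (y : X) h0 3
        norm_num at h2
        calc _ ≤ ENNReal.ofReal (8 * R + 1) * Cd ^ 2 *
              ((Cd ^ 3 * μ (ball (y : X) (ρ y))) / ENNReal.ofReal (ρ y)) :=
              mul_le_mul_right (ENNReal.div_le_div h2
                (ENNReal.ofReal_le_ofReal (by linarith))) _
          _ = _ := by rw [mul_div_assoc]; ring
    _ = ENNReal.ofReal (8 * R + 1) * Cd ^ 5 *
          ∑' y : T, μ (ball (y : X) (ρ y)) / ENNReal.ofReal (ρ y) := ENNReal.tsum_mul_left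
    _ ≤ _ := mul_le_mul_right (hK T hTS hT hdisj') _

lemma ofReal_sub_mul_le_setLIntegral {Y : Type*} [MeasurableSpace Y] {μ : Measure Y}
    {B P Q : Set Y} (hP : MeasurableSet P)
    (hQ : MeasurableSet Q) (hPB : P ⊆ B) (hQB : Q ⊆ B) {u : Y → ℝ} {a b : ℝ} (hab : a < b)
    (huP : ∀ x ∈ P, b ≤ u x) (huQ : ∀ x ∈ Q, u x ≤ a) {α : ℝ≥0∞} (hαP : α ≤ μ P)
    (hαQ : α ≤ μ Q) (m : ℝ) :
    ENNReal.ofReal (b - a) * α ≤ ∫⁻ x in B, ENNReal.ofReal |u x - m| ∂μ := by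
  have hdisj : Disjoint P Q := Set.disjoint_left.2 fun x h1 h2 => by
    linarith [huP x h1, huQ x h2]
  calc ENNReal.ofReal (b - a) * α
      ≤ (ENNReal.ofReal (b - m) + ENNReal.ofReal (m - a)) * α := by
        refine mul_le_mul_left ((ENNReal.ofReal_le_ofReal ?_).trans ENNReal.ofReal_add_le) _
        linarith
    _ ≤ ENNReal.ofReal (b - m) * μ P + ENNReal.ofReal (m - a) * μ Q := by
        rw [add_mul]; gcongr
    _ ≤ ∫⁻ x in P, ENNReal.ofReal |u x - m| ∂μ + ∫⁻ x in Q, ENNReal.ofReal |u x - m| ∂μ := by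
        rw [← setLIntegral_const, ← setLIntegral_const]
        refine add_le_add (setLIntegral_mono' hP fun x hx => ENNReal.ofReal_le_ofReal ?_)
          (setLIntegral_mono' hQ fun x hx => ENNReal.ofReal_le_ofReal ?_)
        · linarith [huP x hx, le_abs_self (u x - m)]
        · linarith [huQ x hx, neg_abs_le (u x - m)]
    _ = ∫⁻ x in P ∪ Q, ENNReal.ofReal |u x - m| ∂μ := (lintegral_union hQ hdisj).symm
    _ ≤ _ := lintegral_mono_set (union_subset hPB hQB)

lemma PoincareIneq.ofReal_sub_mul_le {μ : Measure X} {Cd : ℝ≥0} {CP lam : ℝ}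
    (hμ : DoublingWith μ Cd) (hPI : PoincareIneq μ CP lam) {u : X → ℝ} {g : X → ℝ≥0∞}
    (hu : Integrable u μ) (hg : IsUpperGradient g u) {x : X} {r : ℝ} (hr : 0 < r)
    {P Q : Set X} (hP : MeasurableSet P) (hQ : MeasurableSet Q) (hPB : P ⊆ ball x r)
    (hQB : Q ⊆ ball x r) {a b : ℝ} (hab : a < b) (huP : ∀ x ∈ P, b ≤ u x)
    (huQ : ∀ x ∈ Q, u x ≤ a) {α : ℝ≥0∞} (hαP : α * μ (ball x r) ≤ μ P)
    (hαQ : α * μ (ball x r) ≤ μ Q) :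
    ENNReal.ofReal (b - a) * α ≤ ENNReal.ofReal (CP * r) *
      ((∫⁻ y in ball x (lam * r), g y ∂μ) / μ (ball x (lam * r))) := by
  refine le_trans ?_ (hPI x r hr u g hu.locallyIntegrable hg)
  rw [ENNReal.le_div_iff_mul_le (Or.inl (hμ x r hr).1.ne') (Or.inl (hμ x r hr).2.2.ne), mul_assoc]
  exact ofReal_sub_mul_le_setLIntegral hP hQ hPB hQB hab huP huQ hαP hαQ _

lemma tsum_setLIntegral_le {Y : Type*} [MeasurableSpace Y] {μ : Measure Y} {T : Set Y}
    {B : Y → Set Y} (hT : T.Countable)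
    (hB : ∀ x ∈ T, MeasurableSet (B x)) (hdisj : T.PairwiseDisjoint B) (f : Y → ℝ≥0∞) :
    ∑' x : T, ∫⁻ y in B x, f y ∂μ ≤ ∫⁻ y, f y ∂μ := by
  rw [← lintegral_biUnion hT hB hdisj]
  exact setLIntegral_le_lintegral _ _

/-- An integrable density charges small balls by at most `o(μ(B(x,r))/r)` outside a set of zero
capacity. -/
lemma capacity1_setOf_frequently_le_eq_zero [BorelSpace X] {μ : Measure X} {Cd : ℝ≥0}
    (hμ : DoublingWith μ Cd) {g : X → ℝ≥0∞} (hg : ∫⁻ x, g x ∂μ ≠ ⊤) (c : ℝ≥0) :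
    capacity1 μ {x | ∃ᶠ r : ℝ in 𝓝[>] 0,
      μ (ball x r) ≤ c * (ENNReal.ofReal r * ∫⁻ y in ball x r, g y ∂μ)} = 0 := by
  set S := {x | ∃ᶠ r : ℝ in 𝓝[>] 0,
      μ (ball x r) ≤ c * (ENNReal.ofReal r * ∫⁻ y in ball x r, g y ∂μ)}
  have key : ∀ ε : ℝ≥0∞, ε ≠ 0 →
      capacity1 μ S ≤ ENNReal.ofReal (8 * 1 + 1) * Cd ^ 5 * c * ε := by
    intro ε hε
    obtain ⟨δ, hδ, H⟩ := exists_pos_setLIntegral_lt_of_measure_lt hg hε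
    obtain ⟨η, hη, hηδ⟩ := ENNReal.exists_nnreal_pos_mul_lt
      (ENNReal.mul_ne_top (ENNReal.coe_ne_top (r := c)) hg) hδ.ne'
    have hex : ∀ x ∈ S, ∃ r : ℝ, (0 < r ∧ r ≤ 1 ∧ r ≤ η) ∧
        μ (ball x r) ≤ c * (ENNReal.ofReal r * ∫⁻ y in ball x r, g y ∂μ) := by
      intro x hx
      have h1 : ∀ᶠ r : ℝ in 𝓝[>] 0, r ∈ Ioo (0:ℝ) (min 1 η) :=
        Ioo_mem_nhdsGT (lt_min one_pos (by exact_mod_cast hη))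
      obtain ⟨r, hr, h2⟩ := (Frequently.and_eventually hx h1).exists
      exact ⟨r, ⟨h2.1, (h2.2.trans_le (min_le_left _ _)).le,
        (h2.2.trans_le (min_le_right _ _)).le⟩, hr⟩
    choose! ρ hρ hρc using hex
    rw [mul_assoc]
    refine capacity1_le_of_forall_disjoint hμ (fun x hx => ⟨(hρ x hx).1, (hρ x hx).2.1⟩) ?_
    intro T hTS hT hdisj
    have hmeas : μ (⋃ x ∈ T, ball x (ρ x)) < δ := by
      rw [measure_biUnion hT hdisj fun _ _ => measurableSet_ball]
      calc ∑' x : T, μ (ball (x : X) (ρ x))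
          ≤ ∑' x : T, c * η * ∫⁻ y in ball (x : X) (ρ x), g y ∂μ := by
            refine ENNReal.tsum_le_tsum fun x => (hρc x (hTS x.2)).trans ?_
            rw [mul_assoc]
            gcongr
            rw [← ENNReal.ofReal_coe_nnreal]
            exact ENNReal.ofReal_le_ofReal (hρ x (hTS x.2)).2.2
        _ ≤ c * η * ∫⁻ y, g y ∂μ := by
            rw [ENNReal.tsum_mul_left]
            gcongr
            exact tsum_setLIntegral_le hT (fun _ _ => measurableSet_ball) hdisj g
        _ = η * (c * ∫⁻ y, g y ∂μ) := by ring
        _ < δ := hηδ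
    calc ∑' x : T, μ (ball (x : X) (ρ x)) / ENNReal.ofReal (ρ x)
        ≤ ∑' x : T, c * ∫⁻ y in ball (x : X) (ρ x), g y ∂μ := by
          refine ENNReal.tsum_le_tsum fun x => ENNReal.div_le_of_le_mul ?_
          refine (hρc x (hTS x.2)).trans_eq (by ring)
      _ = c * ∫⁻ y in ⋃ x ∈ T, ball x (ρ x), g y ∂μ := by
          rw [ENNReal.tsum_mul_left, lintegral_biUnion hT (fun _ _ => measurableSet_ball) hdisj]
      _ ≤ c * ε := mul_le_mul_right (H _ hmeas).le _
  have hC : ENNReal.ofReal (8 * 1 + 1) * (Cd : ℝ≥0∞) ^ 5 * c ≠ ⊤ := by finiteness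
  have hlim := ENNReal.Tendsto.const_mul ENNReal.tendsto_inv_nat_nhds_zero (Or.inr hC)
  rw [mul_zero] at hlim
  exact nonpos_iff_eq_zero.1 (ge_of_tendsto' hlim fun n => key _ (by simp))

lemma capacity1_setOf_large_density_le [BorelSpace X] {μ : Measure X} {Cd : ℝ≥0}
    (hμ : DoublingWith μ Cd) {u : X → ℝ} (hu : Measurable u) {t : ℝ} (ht : 1 / 2 ≤ t) :
    capacity1 μ {x | ∃ r : ℝ, 1 / 2 ≤ r ∧ r ≤ 1 ∧
      μ (ball x r) ≤ 2 * μ (ball x r ∩ {y | t < u y})} ≤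
      ENNReal.ofReal (8 * 1 + 1) * Cd ^ 5 * (8 * eL1Norm μ u) := by
  have hex : ∀ x ∈ {x | ∃ r : ℝ, 1 / 2 ≤ r ∧ r ≤ 1 ∧
      μ (ball x r) ≤ 2 * μ (ball x r ∩ {y | t < u y})}, ∃ r : ℝ, 1 / 2 ≤ r ∧ r ≤ 1 ∧
      μ (ball x r) ≤ 2 * μ (ball x r ∩ {y | t < u y}) := fun x hx => hx
  choose! ρ hρ hρ1 hρc using hex
  refine capacity1_le_of_forall_disjoint hμ
    (fun x hx => ⟨by linarith [hρ x hx], hρ1 x hx⟩) ?_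
  intro T hTS hT hdisj
  calc ∑' x : T, μ (ball (x : X) (ρ x)) / ENNReal.ofReal (ρ x)
      ≤ ∑' x : T, 8 * ∫⁻ y in ball (x : X) (ρ x), ENNReal.ofReal |u y| ∂μ := by
        refine ENNReal.tsum_le_tsum fun x => ?_
        have h1 : ENNReal.ofReal (1 / 2) * μ (ball (x : X) (ρ x) ∩ {y | t < u y}) ≤
            ∫⁻ y in ball (x : X) (ρ x), ENNReal.ofReal |u y| ∂μ := by
          rw [← setLIntegral_const]
          refine (setLIntegral_mono' (measurableSet_ball.inter (hu measurableSet_Ioi))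
            fun y hy => ENNReal.ofReal_le_ofReal ?_).trans (lintegral_mono_set inter_subset_left)
          have : t < u y := hy.2
          linarith [le_abs_self (u y)]
        have h2 : (2 : ℝ≥0∞) * ENNReal.ofReal (1 / 2) = 1 := by
          rw [← ENNReal.ofReal_ofNat, ← ENNReal.ofReal_mul (by norm_num)]; norm_num
        refine ENNReal.div_le_of_le_mul ((hρc x (hTS x.2)).trans ?_)
        calc 2 * μ (ball (x : X) (ρ x) ∩ {y | t < u y})
            = 4 * (ENNReal.ofReal (1 / 2) * μ (ball (x : X) (ρ x) ∩ {y | t < u y})) := by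
              rw [← mul_assoc, show (4 : ℝ≥0∞) = 2 * 2 by norm_num, mul_assoc 2 2, h2, mul_one]
          _ ≤ 4 * ∫⁻ y in ball (x : X) (ρ x), ENNReal.ofReal |u y| ∂μ := mul_le_mul_right h1 _
          _ = 8 * (∫⁻ y in ball (x : X) (ρ x), ENNReal.ofReal |u y| ∂μ) *
                ENNReal.ofReal (1 / 2) := by
              rw [mul_right_comm, show (8 : ℝ≥0∞) = 4 * 2 by norm_num, mul_assoc 4 2, h2, mul_one]
          _ ≤ _ := mul_le_mul_right (ENNReal.ofReal_le_ofReal (hρ x (hTS x.2))) _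
    _ ≤ 8 * eL1Norm μ u := by
        rw [ENNReal.tsum_mul_left]
        exact mul_le_mul_right
          (tsum_setLIntegral_le hT (fun _ _ => measurableSet_ball) hdisj _) _

/-- Up to a small multiple of `g`, the natural upper gradient of the function
`min 1 ((n + 1) (u - t)₊)`, which truncates `u` between the levels `t` and `t + 1 / (n + 1)`. -/
def truncGradient {Y : Type*} (u : Y → ℝ) (g : Y → ℝ≥0∞) (t : ℝ) (n : ℕ) (x : Y) : ℝ≥0∞ :=
  ((n + 1 : ℕ) : ℝ≥0∞) * {p : ℝ × Y | p.1 ≤ u p.2 ∧ u p.2 ≤ p.1 + 1 / (n + 1 : ℕ)}.indicator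
    (fun p => g p.2) (t, x) + ((n + 1 : ℕ) : ℝ≥0∞)⁻¹ * g x

lemma measurable_truncGradient {Y : Type*} [MeasurableSpace Y] {u : Y → ℝ} {g : Y → ℝ≥0∞}
    (hu : Measurable u) (hg : Measurable g) (n : ℕ) :
    Measurable fun p : ℝ × Y => truncGradient u g p.1 n p.2 := by
  have hset : MeasurableSet {p : ℝ × Y | p.1 ≤ u p.2 ∧ u p.2 ≤ p.1 + 1 / (n + 1 : ℕ)} :=
    (measurableSet_le measurable_fst (hu.comp measurable_snd)).inter
      (measurableSet_le (hu.comp measurable_snd) (measurable_fst.add_const _))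
  exact (((hg.comp measurable_snd).indicator hset).const_mul _).add
    ((hg.comp measurable_snd).const_mul _)

lemma isUpperGradient_truncGradient {u : X → ℝ} {g : X → ℝ≥0∞} (hu : Measurable u)
    (hg : IsUpperGradient g u) (t : ℝ) (n : ℕ) :
    IsUpperGradient (truncGradient u g t n)
      fun x => max 0 (min 1 ((n + 1 : ℕ) * (u x - t))) := by
  have hn : (0 : ℝ) < (n + 1 : ℕ) := by positivity
  have h0 : IsUpperGradient (fun x => ((n + 1 : ℕ) : ℝ≥0∞) * g x)
      fun x => (n + 1 : ℕ) * (u x - t) := by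
    refine ⟨hg.1.const_mul _, fun ℓ hℓ γ hγ hγ' => ?_⟩
    rw [lintegral_const_mul' _ _ (by finiteness), ← mul_sub, sub_sub_sub_cancel_right, abs_mul,
      abs_of_pos hn, ENNReal.ofReal_mul hn.le, ENNReal.ofReal_natCast]
    exact mul_le_mul_right (hg.2 ℓ hℓ γ hγ hγ') _
  refine h0.clamp ((measurable_truncGradient hu hg.1 n).comp measurable_prodMk_left) 0 1
    (fun x hx0 hx1 => ?_) fun ℓ γ _ h => ?_
  · refine le_trans (le_of_eq ?_) le_self_add
    rw [indicator_of_mem]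
    have h1 : 0 ≤ u x - t := nonneg_of_mul_nonneg_right hx0 hn
    have h2 : u x - t ≤ 1 / (n + 1 : ℕ) := by
      rw [le_div_iff₀ hn, mul_comm]; exact hx1
    exact ⟨by simpa using h1, by simp only; linarith⟩
  · rw [lintegral_const_mul' _ _ (by finiteness)] at h
    have h1 : ∫⁻ s in Icc (0:ℝ) ℓ, g (γ s) = ⊤ := by
      by_contra hne
      exact ENNReal.mul_ne_top (by finiteness) hne h
    refine top_le_iff.1 ?_
    calc (⊤ : ℝ≥0∞) = ((n + 1 : ℕ) : ℝ≥0∞)⁻¹ * ∫⁻ s in Icc (0:ℝ) ℓ, g (γ s) := by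
          rw [h1, ENNReal.mul_top]
          simp only [ne_eq, ENNReal.inv_eq_zero]
          finiteness
      _ = ∫⁻ s in Icc (0:ℝ) ℓ, ((n + 1 : ℕ) : ℝ≥0∞)⁻¹ * g (γ s) :=
          (lintegral_const_mul' _ _ (by simp)).symm
      _ ≤ _ := lintegral_mono fun s => le_add_self

lemma lintegral_truncGradient_le {Y : Type*} (u : Y → ℝ) (g : Y → ℝ≥0∞) (n : ℕ) (x : Y) :
    ∫⁻ t in Ioo (1 / 2 : ℝ) 1, truncGradient u g t n x ≤ 2 * g x := by
  have hn : (0 : ℝ) < (n + 1 : ℕ) := by positivity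
  have hn1 : (1 : ℝ≥0∞) ≤ (n + 1 : ℕ) := by exact_mod_cast Nat.le_add_left 1 n
  have hsec : ∀ t : ℝ, {p : ℝ × Y | p.1 ≤ u p.2 ∧ u p.2 ≤ p.1 + 1 / (n + 1 : ℕ)}.indicator
      (fun p => g p.2) (t, x) =
      (Icc (u x - 1 / (n + 1 : ℕ)) (u x)).indicator (fun _ => g x) t := by
    intro t
    by_cases h : t ∈ Icc (u x - 1 / (n + 1 : ℕ)) (u x)
    · rw [indicator_of_mem h, indicator_of_mem]
      exact ⟨h.2, by simp only; linarith [h.1]⟩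
    · rw [indicator_of_notMem h, indicator_of_notMem]
      exact fun h' => h ⟨by have := h'.2; simp only at this; linarith, h'.1⟩
  simp only [truncGradient, hsec]
  rw [lintegral_add_right _ measurable_const, lintegral_const_mul' _ _ (by finiteness), two_mul]
  refine add_le_add ?_ ?_
  · calc _ ≤ ((n + 1 : ℕ) : ℝ≥0∞) *
          ∫⁻ t, (Icc (u x - 1 / (n + 1 : ℕ)) (u x)).indicator (fun _ => g x) t :=
          mul_le_mul_right (setLIntegral_le_lintegral _ _) _
      _ = g x := by
          rw [lintegral_indicator measurableSet_Icc, setLIntegral_const, Real.volume_Icc,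
            _root_.sub_sub_cancel, one_div, ENNReal.ofReal_inv_of_pos hn, ENNReal.ofReal_natCast,
            mul_left_comm, ENNReal.mul_inv_cancel (by positivity) (by finiteness), mul_one]
  · rw [setLIntegral_const, Real.volume_Ioo]
    calc _ ≤ 1 * g x * 1 := by
          refine mul_le_mul' (mul_le_mul_left (ENNReal.inv_le_one.2 hn1) _) ?_
          exact ENNReal.ofReal_le_one.2 (by norm_num)
      _ = g x := by simp

lemma exists_liminf_lintegral_truncGradient_le {Y : Type*} [MeasurableSpace Y] {μ : Measure Y}
    [SFinite μ] {u : Y → ℝ} {g : Y → ℝ≥0∞} (hu : Measurable u) (hg : Measurable g) :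
    ∃ t ∈ Ioo (1 / 2 : ℝ) 1,
      liminf (fun n => ∫⁻ x, truncGradient u g t n x ∂μ) atTop ≤ 4 * ∫⁻ x, g x ∂μ := by
  have hm : ∀ n, Measurable fun t => ∫⁻ x, truncGradient u g t n x ∂μ := fun n =>
    (measurable_truncGradient hu hg n).lintegral_prod_right'
  have hvol : volume (Ioo (1 / 2 : ℝ) 1) = 2⁻¹ := by
    rw [Real.volume_Ioo, show (1 : ℝ) - 1 / 2 = 2⁻¹ by norm_num,
      ENNReal.ofReal_inv_of_pos two_pos, ENNReal.ofReal_ofNat]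
  obtain ⟨t, ht, hle⟩ := exists_le_setLAverage (μ := volume) (s := Ioo (1 / 2 : ℝ) 1)
    (f := fun t => liminf (fun n => ∫⁻ x, truncGradient u g t n x ∂μ) atTop)
    (by rw [hvol]; simp) (by rw [hvol]; simp) (Measurable.liminf hm).aemeasurable
  refine ⟨t, ht, hle.trans ?_⟩
  have hI : ∫⁻ t in Ioo (1 / 2 : ℝ) 1,
      liminf (fun n => ∫⁻ x, truncGradient u g t n x ∂μ) atTop ≤ 2 * ∫⁻ x, g x ∂μ := by
    refine (lintegral_liminf_le hm).trans ?_
    refine (liminf_le_liminf (v := fun _ => 2 * ∫⁻ x, g x ∂μ)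
      (Eventually.of_forall fun n => ?_)).trans_eq (liminf_const _)
    rw [lintegral_lintegral_swap (measurable_truncGradient hu hg n).aemeasurable,
      ← lintegral_const_mul' _ _ (by simp)]
    exact lintegral_mono fun x => lintegral_truncGradient_le u g n x
  rw [setLAverage_eq, hvol]
  calc _ ≤ (2 * ∫⁻ x, g x ∂μ) / 2⁻¹ := ENNReal.div_le_div_right hI _
    _ = 4 * ∫⁻ x, g x ∂μ := by
      rw [div_eq_mul_inv, inv_inv, mul_right_comm]; norm_num

lemma integrable_max_zero_min_one {Y : Type*} [MeasurableSpace Y] {μ : Measure Y}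
    {u : Y → ℝ} (hum : Measurable u)
    (hu : Integrable u μ) {t : ℝ} (ht : 1 / 2 ≤ t) (n : ℕ) :
    Integrable (fun x => max 0 (min 1 ((n + 1 : ℕ) * (u x - t)))) μ := by
  refine (hu.norm.const_mul 2).mono'
    (measurable_const.max (measurable_const.min
      ((hum.sub_const t).const_mul _))).aestronglyMeasurable
    (Eventually.of_forall fun x => ?_)
  rw [Real.norm_eq_abs, Real.norm_eq_abs, abs_of_nonneg (le_max_left _ _)]
  refine max_le (by positivity) ?_
  rcases le_total (u x) t with h | h
  · exact (min_le_right _ _).trans ((mul_nonpos_of_nonneg_of_nonpos (by positivity)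
      (by linarith)).trans (by positivity))
  · exact (min_le_left _ _).trans (by linarith [le_abs_self (u x)])

lemma eventually_half_mul_le_measure_inter {Y : Type*} [MeasurableSpace Y] {μ : Measure Y}
    {u : Y → ℝ} {B : Set Y}
    (hB : μ B ≠ 0) (hB' : μ B ≠ ⊤) {t : ℝ} {α : ℝ≥0∞} (hα0 : α ≠ 0) (hα1 : α ≠ ⊤)
    (h : α * μ B ≤ μ (B ∩ {y | t < u y})) :
    ∀ᶠ n : ℕ in atTop, α / 2 * μ B ≤ μ (B ∩ {y | t + 1 / (n + 1 : ℕ) ≤ u y}) := by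
  have hmono : Monotone fun n : ℕ => B ∩ {y | t + 1 / (n + 1 : ℕ) ≤ u y} := by
    refine fun m n hmn => fun y hy => ⟨hy.1, ?_⟩
    have : (1 : ℝ) / (n + 1 : ℕ) ≤ 1 / (m + 1 : ℕ) := by gcongr
    exact (add_le_add_right this t).trans hy.2
  have hU : ⋃ n : ℕ, B ∩ {y | t + 1 / (n + 1 : ℕ) ≤ u y} = B ∩ {y | t < u y} := by
    ext y
    simp only [mem_iUnion, mem_inter_iff, mem_ofPred_eq, exists_and_left]
    refine and_congr_right fun _ => ⟨fun ⟨n, hn⟩ => ?_, fun hy => ?_⟩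
    · have : (0 : ℝ) < 1 / (n + 1 : ℕ) := by positivity
      linarith
    · obtain ⟨n, hn⟩ := exists_nat_one_div_lt (sub_pos.2 hy)
      exact ⟨n, by push_cast; linarith⟩
  have hlim := tendsto_measure_iUnion_atTop (μ := μ) hmono
  rw [hU] at hlim
  have hlt : α / 2 * μ B < μ (B ∩ {y | t < u y}) :=
    (ENNReal.mul_lt_mul_left hB hB' (ENNReal.half_lt_self hα0 hα1)).trans_le h
  exact (hlim.eventually_const_lt hlt).mono fun n hn => hn.le

lemma tsum_liminf_le {ι : Type*} [Countable ι] (f : ℕ → ι → ℝ≥0∞) :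
    ∑' i, liminf (fun n => f n i) atTop ≤ liminf (fun n => ∑' i, f n i) atTop := by
  let _ : MeasurableSpace ι := ⊤
  simp only [← lintegral_count]
  exact lintegral_liminf_le fun n => measurable_from_top

lemma capacity1_setOf_crossing_le [BorelSpace X] {μ : Measure X} {Cd : ℝ≥0} {CP lam : ℝ}
    (hμ : DoublingWith μ Cd) (hPI : PoincareIneq μ CP lam) (hCP : 0 < CP) (hlam : 1 ≤ lam)
    {u : X → ℝ} {g : X → ℝ≥0∞} (hum : Measurable u) (hu : Integrable u μ)
    (hg : IsUpperGradient g u) {t : ℝ} (ht : 1 / 2 ≤ t) {α : ℝ≥0∞} (hα0 : α ≠ 0) (hα1 : α ≠ ⊤)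
    {I : ℝ≥0∞} (hI : liminf (fun n => ∫⁻ x, truncGradient u g t n x ∂μ) atTop ≤ I) :
    capacity1 μ {x | ∃ r : ℝ, 0 < r ∧ r ≤ 1 ∧ α * μ (ball x r) ≤ μ (ball x r ∩ {y | t < u y}) ∧
      α * μ (ball x r) ≤ μ (ball x r ∩ {y | u y ≤ t})} ≤
      ENNReal.ofReal (8 * lam + 1) * Cd ^ 5 * (2 * α⁻¹ * ENNReal.ofReal CP * I) := by
  have hlam0 : 0 < lam := by linarith
  set S := {x | ∃ r : ℝ, 0 < r ∧ r ≤ 1 ∧ α * μ (ball x r) ≤ μ (ball x r ∩ {y | t < u y}) ∧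
      α * μ (ball x r) ≤ μ (ball x r ∩ {y | u y ≤ t})}
  set L := 2 * α⁻¹ * ENNReal.ofReal CP
  have hL : L ≠ ⊤ := by
    have := ENNReal.inv_ne_top.2 hα0
    finiteness
  have hex : ∀ x ∈ S, ∃ ρ : ℝ, (0 < ρ ∧ ρ ≤ lam) ∧ ∀ᶠ n in atTop,
      μ (ball x ρ) / ENNReal.ofReal ρ ≤ L * ∫⁻ y in ball x ρ, truncGradient u g t n y ∂μ := by
    rintro x ⟨r, hr0, hr1, hP, hQ⟩
    have hρ0 : 0 < lam * r := by positivity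
    refine ⟨lam * r, ⟨hρ0, by nlinarith⟩, ?_⟩
    filter_upwards [eventually_half_mul_le_measure_inter (hμ x r hr0).1.ne' (hμ x r hr0).2.2.ne
      hα0 hα1 hP] with n hn
    have hn0 : (0 : ℝ) < (n + 1 : ℕ) := by positivity
    have key := hPI.ofReal_sub_mul_le hμ (integrable_max_zero_min_one hum hu ht n)
      (isUpperGradient_truncGradient hum hg t n) hr0
      (measurableSet_ball.inter (measurableSet_le measurable_const hum))
      (measurableSet_ball.inter (measurableSet_le hum measurable_const))
      inter_subset_left inter_subset_left zero_lt_one (fun y hy => ?_) (fun y hy => ?_) hn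
      ((mul_le_mul_left ENNReal.half_le_self _).trans hQ)
    · obtain ⟨hμ0, -, hμ1⟩ := hμ x _ hρ0
      rw [sub_zero, ENNReal.ofReal_one, one_mul, ← mul_div_assoc,
        ENNReal.le_div_iff_mul_le (Or.inl hμ0.ne') (Or.inl hμ1.ne)] at key
      refine ENNReal.div_le_of_le_mul ?_
      calc μ (ball x (lam * r)) = 2 * α⁻¹ * (α / 2 * μ (ball x (lam * r))) := by
            rw [← mul_assoc, mul_comm 2, mul_assoc α⁻¹,
              ENNReal.mul_div_cancel two_ne_zero ofNat_ne_top, ENNReal.inv_mul_cancel hα0 hα1,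
              one_mul]
        _ ≤ 2 * α⁻¹ * (ENNReal.ofReal (CP * (lam * r)) *
            ∫⁻ y in ball x (lam * r), truncGradient u g t n y ∂μ) := by
            refine mul_le_mul_right (key.trans (mul_le_mul_left
              (ENNReal.ofReal_le_ofReal ?_) _)) _
            gcongr
            nlinarith
        _ = _ := by rw [ENNReal.ofReal_mul hCP.le]; ring
    · refine le_max_of_le_right (le_min le_rfl ?_)
      have h1 : t + 1 / (n + 1 : ℕ) ≤ u y := hy.2
      rw [mul_comm, ← div_le_iff₀ hn0]
      linarith
    · refine max_le le_rfl ((min_le_right _ _).trans ?_)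
      exact mul_nonpos_of_nonneg_of_nonpos hn0.le (sub_nonpos.2 hy.2)
  choose! ρ hρ hρL using hex
  refine capacity1_le_of_forall_disjoint hμ hρ fun T hTS hT hdisj => ?_
  have := hT.to_subtype
  calc ∑' x : T, μ (ball (x : X) (ρ x)) / ENNReal.ofReal (ρ x)
      ≤ ∑' x : T, liminf (fun n => L * ∫⁻ y in ball (x : X) (ρ x), truncGradient u g t n y ∂μ)
          atTop := ENNReal.tsum_le_tsum fun x => le_liminf_of_le (by isBoundedDefault)
            (hρL x (hTS x.2))
    _ ≤ liminf (fun n => ∑' x : T,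
          L * ∫⁻ y in ball (x : X) (ρ x), truncGradient u g t n y ∂μ) atTop := tsum_liminf_le _
    _ ≤ liminf (fun n => L * ∫⁻ y, truncGradient u g t n y ∂μ) atTop := by
        refine liminf_le_liminf (Eventually.of_forall fun n => ?_)
        rw [ENNReal.tsum_mul_left]
        exact mul_le_mul_right (tsum_setLIntegral_le hT (fun _ _ => measurableSet_ball) hdisj _) _
    _ = L * liminf (fun n => ∫⁻ y, truncGradient u g t n y ∂μ) atTop :=
        (Monotone.map_liminf_of_continuousAt (f := fun a => L * a)
          (fun _ _ h => mul_le_mul_right h L) _ (ENNReal.continuous_const_mul hL).continuousAt).symm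
    _ ≤ L * I := mul_le_mul_right hI L

lemma measure_le_two_mul_or {Y : Type*} [MeasurableSpace Y] {μ : Measure Y} (B : Set Y)
    {u : Y → ℝ} (hu : Measurable u) (t : ℝ) :
    μ B ≤ 2 * μ (B ∩ {y | t < u y}) ∨ μ B ≤ 2 * μ (B ∩ {y | u y ≤ t}) := by
  have h : μ B = μ (B ∩ {y | t < u y}) + μ (B ∩ {y | u y ≤ t}) := by
    rw [← measure_inter_add_sdiff B
      (measurableSet_lt measurable_const hu : MeasurableSet {y | t < u y})]
    congr 2
    ext y
    simp
  rw [h, two_mul, two_mul]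
  rcases le_total (μ (B ∩ {y | t < u y})) (μ (B ∩ {y | u y ≤ t})) with h1 | h1
  · exact Or.inr (add_le_add_left h1 _)
  · exact Or.inl (add_le_add_right h1 _)

/-- If `{t < u}` fills half of some small ball around `x`, then either it fills half of a ball of
radius about `1`, or at some intermediate radius both `{t < u}` and its complement are large. -/
lemma exists_crossing_or_large_density {μ : Measure X} {Cd : ℝ≥0} (hμ : DoublingWith μ Cd)
    (hCd : 1 ≤ Cd) {u : X → ℝ} (hu : Measurable u) {t : ℝ} {x : X} {r : ℝ} (hr0 : 0 < r)
    (hr1 : r ≤ 1) (h : μ (ball x r) ≤ 2 * μ (ball x r ∩ {y | t < u y})) :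
    (∃ r : ℝ, 0 < r ∧ r ≤ 1 ∧
      (2 * Cd : ℝ≥0∞)⁻¹ * μ (ball x r) ≤ μ (ball x r ∩ {y | t < u y}) ∧
      (2 * Cd : ℝ≥0∞)⁻¹ * μ (ball x r) ≤ μ (ball x r ∩ {y | u y ≤ t})) ∨
    ∃ r : ℝ, 1 / 2 ≤ r ∧ r ≤ 1 ∧ μ (ball x r) ≤ 2 * μ (ball x r ∩ {y | t < u y}) := by
  have hCd' : (1 : ℝ≥0∞) ≤ Cd := by exact_mod_cast hCd
  have h2Cd : (2 * Cd : ℝ≥0∞) ≠ 0 := by positivity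
  have h2Cd' : (2 * Cd : ℝ≥0∞) ≠ ⊤ := by finiteness
  obtain ⟨n, hn⟩ := exists_pow_lt_of_lt_one hr0 (one_half_lt_one (α := ℝ))
  induction n generalizing r with
  | zero => simp only [pow_zero] at hn; linarith
  | succ n ih =>
    rcases le_or_gt (1 / 2) r with hr | hr
    · exact Or.inr ⟨r, hr, hr1, h⟩
    by_cases h2 : μ (ball x (2 * r)) ≤ 2 * μ (ball x (2 * r) ∩ {y | t < u y})
    · exact ih (by positivity) (by linarith) h2 (by rw [pow_succ] at hn; linarith)
    refine Or.inl ⟨2 * r, by positivity, by linarith, ?_, ?_⟩ <;>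
      rw [ENNReal.inv_mul_le_iff h2Cd h2Cd']
    · calc μ (ball x (2 * r)) ≤ Cd * μ (ball x r) := (hμ x r hr0).2.1
        _ ≤ Cd * (2 * μ (ball x r ∩ {y | t < u y})) := mul_le_mul_right h _
        _ = 2 * Cd * μ (ball x r ∩ {y | t < u y}) := by ring
        _ ≤ _ := mul_le_mul_right (measure_mono (inter_subset_inter_left _
            (ball_subset_ball (by linarith)))) _
    · calc μ (ball x (2 * r)) ≤ 2 * μ (ball x (2 * r) ∩ {y | u y ≤ t}) :=
            (measure_le_two_mul_or _ hu t).resolve_left h2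
        _ ≤ _ := mul_le_mul_left (le_mul_of_one_le_right' hCd') _

lemma exists_frequently_mul_le_measure_inter {μ : Measure X} {Cd : ℝ≥0} (hμ : DoublingWith μ Cd)
    {G : Set X} {x : X} (hx : x ∈ measInterior μ G ∪ measBoundary μ G) :
    ∃ a : ℝ≥0∞, a ≠ 0 ∧ ∃ᶠ r : ℝ in 𝓝[>] 0, a * μ (ball x r) ≤ μ (ball x r ∩ G) := by
  have hpos : ∀ᶠ r : ℝ in 𝓝[>] 0, 0 < r := self_mem_nhdsWithin
  rcases hx with hx | hx
  · refine ⟨2⁻¹, by simp, Eventually.frequently ?_⟩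
    have hx' : Tendsto (fun r : ℝ => μ (ball x r \ G) / μ (ball x r)) (𝓝[>] 0) (𝓝 0) := hx
    filter_upwards [hx'.eventually_lt_const (u := 2⁻¹) (by simp), hpos] with r hr hr0
    obtain ⟨h0, -, h1⟩ := hμ x r hr0
    have h2 : μ (ball x r \ G) ≤ 2⁻¹ * μ (ball x r) :=
      (ENNReal.div_le_iff h0.ne' h1.ne).1 hr.le
    refine ENNReal.le_of_add_le_add_right (a := 2⁻¹ * μ (ball x r)) (by finiteness) ?_
    calc 2⁻¹ * μ (ball x r) + 2⁻¹ * μ (ball x r) = μ (ball x r) := by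
          rw [← add_mul, ENNReal.inv_two_add_inv_two, one_mul]
      _ ≤ μ (ball x r ∩ G) + μ (ball x r \ G) := measure_le_inter_add_sdiff _ _ _
      _ ≤ _ := add_le_add_right h2 _
  · obtain ⟨a, ha0, ha⟩ := exists_between hx.1
    refine ⟨a, ha0.ne', ((frequently_lt_of_lt_limsup (by isBoundedDefault) ha).and_eventually
      hpos).mono fun r hr => ?_⟩
    obtain ⟨h0, -, h1⟩ := hμ x r hr.2
    exact (ENNReal.le_div_iff_mul_le (Or.inl h0.ne') (Or.inl h1.ne)).1 hr.1.le

/-- The superlevel set of `u` fills half of some small ball around `x` if `{1 ≤ u}` has positive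
upper density at `x` and the averages of `g` over small balls around `x` are `o(1/r)`. -/
lemma exists_measure_ball_le_two_mul [BorelSpace X] {μ : Measure X} {Cd : ℝ≥0} {CP lam : ℝ}
    (hμ : DoublingWith μ Cd) (hPI : PoincareIneq μ CP lam) (hCP : 0 < CP) (hlam : 1 ≤ lam)
    {u : X → ℝ} {g : X → ℝ≥0∞} (hum : Measurable u) (hu : Integrable u μ)
    (hg : IsUpperGradient g u) {t : ℝ} (ht : t < 1) {G : Set X} (hG : ∀ x ∈ G, 1 ≤ u x) {x : X}
    {a : ℝ≥0∞} (ha : a ≠ 0) (hfreq : ∃ᶠ r : ℝ in 𝓝[>] 0, a * μ (ball x r) ≤ μ (ball x r ∩ G))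
    (hsmall : ∀ n : ℕ, ¬ ∃ᶠ r : ℝ in 𝓝[>] 0,
      μ (ball x r) ≤ (n : ℝ≥0) * (ENNReal.ofReal r * ∫⁻ y in ball x r, g y ∂μ)) :
    ∃ r : ℝ, 0 < r ∧ r ≤ 1 ∧ μ (ball x r) ≤ 2 * μ (ball x r ∩ {y | t < u y}) := by
  have hlam0 : 0 < lam := by linarith
  set α := min a 2⁻¹
  have hα : α ≠ 0 := by simp [α, ha, min_eq_iff]
  obtain ⟨n, hn⟩ := ENNReal.exists_nat_mul_gt (a := ENNReal.ofReal (1 - t) * α)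
    (b := ENNReal.ofReal CP)
    (mul_ne_zero (by simpa using ht) hα) ENNReal.ofReal_ne_top
  have hlim : Tendsto (fun r : ℝ => lam * r) (𝓝[>] 0) (𝓝[>] 0) := by
    refine tendsto_nhdsWithin_iff.2 ⟨?_, ?_⟩
    · have : Tendsto (fun r : ℝ => lam * r) (𝓝 0) (𝓝 (lam * 0)) :=
        (continuous_const_mul lam).tendsto 0
      rw [mul_zero] at this
      exact this.mono_left nhdsWithin_le_nhds
    · filter_upwards [self_mem_nhdsWithin] with r hr
      exact mul_pos hlam0 hr
  have h01 : ∀ᶠ r : ℝ in 𝓝[>] 0, r ∈ Ioo (0 : ℝ) 1 := Ioo_mem_nhdsGT one_pos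
  obtain ⟨r, hr, ⟨hr0, hr1⟩, hrs⟩ := (hfreq.and_eventually
    (h01.and (hlim.eventually (not_frequently.1 (hsmall n))))).exists
  refine ⟨r, hr0, hr1.le, (measure_le_two_mul_or _ hum t).resolve_right fun hQ => ?_⟩
  obtain ⟨hM0, -, hM1⟩ := hμ x (lam * r) (by positivity)
  set M := μ (ball x (lam * r))
  set J := ∫⁻ y in ball x (lam * r), g y ∂μ
  have key := hPI.ofReal_sub_mul_le hμ hu hg hr0 (P := ball x r ∩ {y | 1 ≤ u y})
    (Q := ball x r ∩ {y | u y ≤ t}) (α := α)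
    (measurableSet_ball.inter (measurableSet_le measurable_const hum))
    (measurableSet_ball.inter (measurableSet_le hum measurable_const))
    inter_subset_left inter_subset_left ht (fun y hy => hy.2) (fun y hy => hy.2)
    ((mul_le_mul_left (min_le_left _ _) _).trans (hr.trans (measure_mono
      (inter_subset_inter_right _ fun y hy => hG y hy))))
    ((mul_le_mul_left (min_le_right _ _) _).trans
      ((ENNReal.inv_mul_le_iff two_ne_zero ofNat_ne_top).2 hQ))
  rw [← mul_div_assoc, ENNReal.le_div_iff_mul_le (Or.inl hM0.ne') (Or.inl hM1.ne)] at key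
  refine hn.not_ge ?_
  rw [← ENNReal.mul_le_mul_iff_left hM0.ne' hM1.ne]
  calc n * (ENNReal.ofReal (1 - t) * α) * M = n * (ENNReal.ofReal (1 - t) * α * M) := by ring
    _ ≤ n * (ENNReal.ofReal (CP * (lam * r)) * J) := by
        refine mul_le_mul_right (key.trans (mul_le_mul_left (ENNReal.ofReal_le_ofReal ?_) _)) _
        gcongr
        nlinarith
    _ = ENNReal.ofReal CP * (n * (ENNReal.ofReal (lam * r) * J)) := by
        rw [ENNReal.ofReal_mul hCP.le]; ring
    _ ≤ ENNReal.ofReal CP * M := mul_le_mul_right (le_of_lt (by simpa using hrs)) _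

/-- **Proposition.** There is a constant `C ≥ 1`, depending only on `Cd`, `CP`,
`lam`, such that `cap₁(G ∪ I_G ∪ ∂*G) ≤ C cap₁(G)` for any `G ⊆ X`. -/
theorem capacity_union_measInterior_measBoundary
    (Cd : ℝ≥0) (CP lam : ℝ) (hCd : 1 ≤ Cd) (hCP : 0 < CP) (hlam : 1 ≤ lam) :
    ∃ C : ℝ≥0, 1 ≤ C ∧
      ∀ (X : Type) [MetricSpace X] [CompleteSpace X] [Nontrivial X]
        [MeasurableSpace X] [BorelSpace X] (μ : Measure X),
        DoublingWith μ Cd → PoincareIneq μ CP lam →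
        ∀ G : Set X,
          capacity1 μ (G ∪ measInterior μ G ∪ measBoundary μ G) ≤
            (C : ℝ≥0∞) * capacity1 μ G := by
  have h2Cd : (2 * Cd : ℝ≥0∞) ≠ 0 := by
    have : Cd ≠ 0 := (zero_lt_one.trans_le hCd).ne'
    simpa
  have h2Cd' : (2 * Cd : ℝ≥0∞) ≠ ⊤ := by finiteness
  set C₁ : ℝ≥0∞ := ENNReal.ofReal (8 * lam + 1) * Cd ^ 5 * (2 * (2 * Cd) * ENNReal.ofReal CP * 4)
  set C₂ : ℝ≥0∞ := ENNReal.ofReal (8 * 1 + 1) * Cd ^ 5 * 8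
  have hC₁ : C₁ ≠ ⊤ := by finiteness
  have hC₂ : C₂ ≠ ⊤ := by finiteness
  have hC : 1 + C₁ + C₂ ≠ ⊤ := by finiteness
  refine ⟨(1 + C₁ + C₂).toNNReal, ?_, ?_⟩
  · rw [← ENNReal.coe_le_coe, ENNReal.coe_toNNReal hC, add_assoc]
    exact le_self_add
  intro X _ _ _ _ _ μ hμ hPI G
  rw [ENNReal.coe_toNNReal hC]
  have := hμ.sigmaFinite
  suffices H : ∀ K, capacity1 μ G < K →
      capacity1 μ (G ∪ measInterior μ G ∪ measBoundary μ G) ≤ (1 + C₁ + C₂) * K by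
    have h0 : 1 + C₁ + C₂ ≠ 0 := by simp
    rw [← ENNReal.div_le_iff' h0 hC]
    exact le_of_forall_gt_imp_ge_of_dense fun K hK => (ENNReal.div_le_iff' h0 hC).2 (H K hK)
  intro K hK
  obtain ⟨u, g, hum, hg, hG, hlt⟩ := exists_of_capacity1_lt hK
  have hu : Integrable u μ := by
    refine ⟨hum.aestronglyMeasurable, ?_⟩
    rw [hasFiniteIntegral_iff_norm]
    exact (le_self_add.trans_lt hlt).trans_le le_top
  have hgtop : ∫⁻ x, g x ∂μ ≠ ⊤ := ((le_add_self.trans_lt hlt).trans_le le_top).ne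
  obtain ⟨t, ⟨ht0, ht1⟩, ht⟩ := exists_liminf_lintegral_truncGradient_le (μ := μ) hum hg.1
  have hS₁ := capacity1_setOf_crossing_le hμ hPI hCP hlam hum hu hg ht0.le
    (ENNReal.inv_ne_zero.2 h2Cd') (ENNReal.inv_ne_top.2 h2Cd) ht
  have hS₂ := capacity1_setOf_large_density_le hμ hum ht0.le
  rw [inv_inv] at hS₁
  set S₁ := {x | ∃ r : ℝ, 0 < r ∧ r ≤ 1 ∧
      (2 * Cd : ℝ≥0∞)⁻¹ * μ (ball x r) ≤ μ (ball x r ∩ {y | t < u y}) ∧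
      (2 * Cd : ℝ≥0∞)⁻¹ * μ (ball x r) ≤ μ (ball x r ∩ {y | u y ≤ t})}
  set S₂ := {x | ∃ r : ℝ, 1 / 2 ≤ r ∧ r ≤ 1 ∧
      μ (ball x r) ≤ 2 * μ (ball x r ∩ {y | t < u y})}
  set D : ℕ → Set X := fun n => {x | ∃ᶠ r : ℝ in 𝓝[>] 0,
      μ (ball x r) ≤ (n : ℝ≥0) * (ENNReal.ofReal r * ∫⁻ y in ball x r, g y ∂μ)}
  have hD : capacity1 μ (⋃ n, D n) = 0 := by
    refine nonpos_iff_eq_zero.1 ((capacity1_iUnion_le μ D).trans_eq ?_)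
    exact ENNReal.tsum_eq_zero.2 fun n => capacity1_setOf_frequently_le_eq_zero hμ hgtop n
  have hsub : G ∪ measInterior μ G ∪ measBoundary μ G ⊆ G ∪ (S₁ ∪ S₂ ∪ ⋃ n, D n) := by
    rw [union_assoc]
    refine union_subset_union_right G fun x hx => ?_
    by_cases hxD : x ∈ ⋃ n, D n
    · exact Or.inr hxD
    obtain ⟨a, ha, hfreq⟩ := exists_frequently_mul_le_measure_inter hμ hx
    obtain ⟨r, hr0, hr1, hr⟩ := exists_measure_ball_le_two_mul hμ hPI hCP hlam hum hu hg ht1 hG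
      ha hfreq fun n h => hxD (mem_iUnion.2 ⟨n, h⟩)
    exact Or.inl (exists_crossing_or_large_density hμ hCd hum hr0 hr1 hr)
  calc capacity1 μ (G ∪ measInterior μ G ∪ measBoundary μ G)
      ≤ capacity1 μ (G ∪ (S₁ ∪ S₂ ∪ ⋃ n, D n)) := capacity1_mono μ hsub
    _ ≤ capacity1 μ G + (capacity1 μ S₁ + capacity1 μ S₂ + capacity1 μ (⋃ n, D n)) := by
        refine (capacity1_union_le μ _ _).trans (add_le_add_right ?_ _)
        exact (capacity1_union_le μ _ _).trans (add_le_add_left (capacity1_union_le μ _ _) _)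
    _ ≤ K + (C₁ * ∫⁻ x, g x ∂μ + C₂ * eL1Norm μ u + 0) := by
        refine add_le_add hK.le (add_le_add (add_le_add (hS₁.trans_eq ?_) (hS₂.trans_eq ?_)) hD.le)
        · simp only [C₁]; ring
        · simp only [C₂]; ring
    _ ≤ K + (C₁ * K + C₂ * K + 0) := by
        gcongr
        · exact le_add_self.trans hlt.le
        · exact le_self_add.trans hlt.le
    _ = (1 + C₁ + C₂) * K := by ring

end FineBV
end
end

section
/- Let u ∈ BV(X). Then for H-almost every x ∈ X there exists a set A_x containing x with density 1 at x (i.e. lim_{r→0⁺} μ(B(x,r)∖A_x)/μ(B(x,r)) = 0) such that whenever y_k → x with y_k ∈ A_x, one has min_{l₂ ∈ {1,...,n}} |u^{l₁}(y_k) − u^{l₂}(x)| → 0 for each l₁ = 1,...,n. -/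
open MeasureTheory Metric Set Filter Topology ENNReal NNReal

noncomputable section

namespace FineBV

variable {X : Type*} [MetricSpace X] [MeasurableSpace X]

section Doubling

variable {μ : Measure X} {Cd : ℝ≥0}

lemma DoublingWith.measure_ball_pow_le (h : DoublingWith μ Cd) (x : X) {r : ℝ} (hr : 0 < r)
    (m : ℕ) : μ (ball x (2 ^ m * r)) ≤ (Cd : ℝ≥0∞) ^ m * μ (ball x r) := by
  induction m with
  | zero => simp
  | succ m ih =>
    calc μ (ball x (2 ^ (m + 1) * r)) = μ (ball x (2 * (2 ^ m * r))) := by ring_nf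
      _ ≤ Cd * μ (ball x (2 ^ m * r)) := (h x _ (by positivity)).2.1
      _ ≤ Cd * (Cd ^ m * μ (ball x r)) := by gcongr
      _ = (Cd : ℝ≥0∞) ^ (m + 1) * μ (ball x r) := by ring

lemma DoublingWith.exists_measure_ball_le (h : DoublingWith μ Cd) (a : ℝ) :
    ∃ C : ℝ≥0, ∀ (x : X) (r : ℝ), 0 < r → μ (ball x (a * r)) ≤ C * μ (ball x r) := by
  obtain ⟨m, hm⟩ := pow_unbounded_of_one_lt a (one_lt_two)
  refine ⟨Cd ^ m, fun x r hr => ?_⟩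
  calc μ (ball x (a * r)) ≤ μ (ball x (2 ^ m * r)) := by gcongr
    _ ≤ _ := by simpa using h.measure_ball_pow_le x hr m

lemma DoublingWith.measure_closedBall_le (h : DoublingWith μ Cd) (x : X) {r : ℝ} (hr : 0 < r) :
    μ (closedBall x r) ≤ Cd * μ (ball x r) :=
  (measure_mono (closedBall_subset_ball (by linarith))).trans (h x r hr).2.1

lemma DoublingWith.exists_pos_le_measure_ball (h : DoublingWith μ Cd) (x₀ : X) {R ρ : ℝ}
    (hR : 0 < R) (hρ : 0 < ρ) : ∃ c : ℝ≥0∞, 0 < c ∧ ∀ x ∈ ball x₀ R, c ≤ μ (ball x ρ) := by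
  obtain ⟨C, hC⟩ := h.exists_measure_ball_le (2 * R / ρ)
  refine ⟨μ (ball x₀ R) / C, ENNReal.div_pos (h x₀ R hR).1.ne' (by simp), fun x hx => ?_⟩
  refine ENNReal.div_le_of_le_mul' ?_
  refine le_trans (measure_mono ?_) (hC x ρ hρ)
  rw [div_mul_cancel₀ _ hρ.ne']
  apply ball_subset_ball'
  rw [mem_ball'] at hx
  linarith

lemma DoublingWith.properSpace [CompleteSpace X] [BorelSpace X] (h : DoublingWith μ Cd) :
    ProperSpace X := by
  refine ⟨fun x₀ R => ?_⟩
  refine TotallyBounded.isCompact_of_isClosed ?_ isClosed_closedBall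
  rw [Metric.totallyBounded_iff]
  intro ε hε
  obtain ⟨c, hc0, hc⟩ := h.exists_pos_le_measure_ball x₀ (R := |R| + 1) (ρ := ε / 10)
    (by positivity) (by positivity)
  obtain ⟨v, hv, hdisj, hcov⟩ := Vitali.exists_disjoint_subfamily_covering_enlargement_closedBall
    (closedBall x₀ R) (fun x : X => x) (fun _ => ε / 10) (ε / 10) (fun _ _ => le_rfl) 5
    (by norm_num)
  have hsub : ∀ x ∈ closedBall x₀ R, x ∈ ball x₀ (|R| + 1) := fun x hx =>
    closedBall_subset_ball (by linarith [le_abs_self R]) hx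
  refine ⟨v, ?_, fun x hx => ?_⟩
  · have hfin := Measure.finite_const_le_meas_of_disjoint_iUnion μ hc0
      (As := fun x : v => closedBall (x : X) (ε / 10)) (fun _ => measurableSet_closedBall)
      (fun a b hab => hdisj a.2 b.2 (fun e => hab (Subtype.ext e)))
      (ne_top_of_le_ne_top (h x₀ (|R| + 1 + ε) (by positivity)).2.2.ne
        (measure_mono (iUnion_subset fun x => ?_)))
    · have : {i : v | c ≤ μ (closedBall (i : X) (ε / 10))} = univ := by
        ext i
        simpa using (hc _ (hsub _ (hv i.2))).trans (measure_mono ball_subset_closedBall)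
      rw [this, finite_univ_iff] at hfin
      exact hfin
    · apply (closedBall_subset_ball' (y := x₀) (ε₂ := |R| + 1 + ε) ?_)
      have := hsub _ (hv x.2)
      rw [mem_ball] at this
      linarith
  · obtain ⟨b, hb, hxb⟩ := hcov x hx
    have := hxb (mem_closedBall_self (by positivity))
    rw [mem_closedBall] at this
    exact mem_iUnion₂.2 ⟨b, hb, by rw [mem_ball]; linarith⟩

lemma DoublingWith.isUnifLocDoublingMeasure (h : DoublingWith μ Cd) :
    IsUnifLocDoublingMeasure μ := by
  refine ⟨Cd ^ 2, ?_⟩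
  filter_upwards [self_mem_nhdsWithin] with ε hε x
  have hε : 0 < ε := hε
  calc μ (closedBall x (2 * ε)) ≤ Cd * μ (ball x (2 * ε)) :=
        h.measure_closedBall_le x (by positivity)
    _ ≤ Cd * (Cd * μ (ball x ε)) := by gcongr; exact (h x ε hε).2.1
    _ ≤ Cd * (Cd * μ (closedBall x ε)) := by gcongr; exact ball_subset_closedBall
    _ = _ := by push_cast; ring

lemma DoublingWith.isLocallyFiniteMeasure (h : DoublingWith μ Cd) :
    IsLocallyFiniteMeasure μ :=
  ⟨fun x => ⟨ball x 1, ball_mem_nhds x one_pos, (h x 1 one_pos).2.2⟩⟩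

end Doubling

section HausdorffContent

variable {μ : Measure X}

lemma codimHContent_mono {R : ℝ} {A B : Set X} (h : A ⊆ B) :
    codimHContent μ R A ≤ codimHContent μ R B := by
  unfold codimHContent
  refine le_iInf fun c => le_iInf fun r => le_iInf fun hr => le_iInf fun hB => ?_
  exact iInf_le_of_le c (iInf_le_of_le r (iInf_le_of_le hr (iInf_le_of_le (h.trans hB) le_rfl)))

lemma codimHContent_le_tsum_of_infinite {ι : Type*} [Countable ι] [Infinite ι] {R : ℝ}
    (c : ι → X) (r : ι → ℝ) (hr : ∀ i, 0 < r i ∧ r i ≤ R) {A : Set X}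
    (hA : A ⊆ ⋃ i, ball (c i) (r i)) :
    codimHContent μ R A ≤ ∑' i, μ (ball (c i) (r i)) / ENNReal.ofReal (r i) := by
  obtain ⟨e⟩ : Nonempty (ℕ ≃ ι) := by
    obtain ⟨_⟩ := nonempty_denumerable ι
    exact ⟨(Denumerable.eqv ι).symm⟩
  unfold codimHContent
  refine iInf_le_of_le (c ∘ e) (iInf_le_of_le (r ∘ e) (iInf_le_of_le (fun i => hr _)
    (iInf_le_of_le ?_ ?_)))
  · refine hA.trans (iUnion_subset fun i => ?_)
    exact subset_iUnion_of_subset (e.symm i) (by simp)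
  · exact (e.tsum_eq (fun i => μ (ball (c i) (r i)) / ENNReal.ofReal (r i))).le

lemma exists_cover_of_codimHContent_lt {R : ℝ} {A : Set X} {M : ℝ≥0∞}
    (h : codimHContent μ R A < M) : ∃ (c : ℕ → X) (r : ℕ → ℝ), (∀ i, 0 < r i ∧ r i ≤ R) ∧
      A ⊆ ⋃ i, ball (c i) (r i) ∧ ∑' i, μ (ball (c i) (r i)) / ENNReal.ofReal (r i) < M := by
  simpa only [codimHContent, iInf_lt_iff, exists_prop] using h

lemma codimH_eq_zero_iff {A : Set X} :
    codimH μ A = 0 ↔ ∀ R, 0 < R → codimHContent μ R A = 0 := by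
  simp [codimH]

lemma codimH_mono_null {A B : Set X} (h : A ⊆ B) (hB : codimH μ B = 0) : codimH μ A = 0 := by
  rw [codimH_eq_zero_iff] at hB ⊢
  exact fun R hR => le_antisymm ((codimHContent_mono h).trans (hB R hR).le) bot_le

lemma codimHContent_iUnion_null {R : ℝ} {A : ℕ → Set X} (h : ∀ n, codimHContent μ R (A n) = 0) :
    codimHContent μ R (⋃ n, A n) = 0 := by
  refine le_antisymm (le_of_forall_gt fun ε hε => ?_) bot_le
  obtain ⟨δ, hδ, hsum⟩ := ENNReal.exists_pos_sum_of_countable' hε.ne' ℕ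
  choose c r hr hc hs using fun n => exists_cover_of_codimHContent_lt (μ := μ) (R := R)
    (A := A n) (M := δ n) (by rw [h n]; exact hδ n)
  refine (codimHContent_le_tsum_of_infinite (ι := ℕ × ℕ) (fun p => c p.1 p.2)
    (fun p => r p.1 p.2) (fun p => hr _ _) ?_).trans_lt ?_
  · refine iUnion_subset fun n => (hc n).trans (iUnion_subset fun i => ?_)
    exact subset_iUnion_of_subset (n, i) le_rfl
  · rw [ENNReal.tsum_prod (f := fun a b => μ (ball (c a b) (r a b)) / ENNReal.ofReal (r a b))]
    exact (ENNReal.tsum_le_tsum fun n => (hs n).le).trans_lt hsum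

lemma codimH_iUnion_null {A : ℕ → Set X} (h : ∀ n, codimH μ (A n) = 0) :
    codimH μ (⋃ n, A n) = 0 := by
  rw [codimH_eq_zero_iff]
  exact fun R hR => codimHContent_iUnion_null fun n => codimH_eq_zero_iff.1 (h n) R hR

lemma codimH_iUnion_null_of_countable {ι : Type*} [Countable ι] {A : ι → Set X}
    (h0 : codimH μ (∅ : Set X) = 0) (h : ∀ n, codimH μ (A n) = 0) :
    codimH μ (⋃ n, A n) = 0 := by
  rcases isEmpty_or_nonempty ι with hι | hι
  · simpa using h0
  obtain ⟨f, hf⟩ := exists_surjective_nat ι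
  rw [← hf.iUnion_comp]
  exact codimH_iUnion_null fun n => h (f n)

lemma codimH_union_null {A B : Set X} (hA : codimH μ A = 0) (hB : codimH μ B = 0) :
    codimH μ (A ∪ B) = 0 := by
  refine codimH_mono_null (B := ⋃ n : ℕ, if n = 0 then A else B) ?_
    (codimH_iUnion_null fun n => by split_ifs <;> assumption)
  exact union_subset (subset_iUnion_of_subset 0 (by simp)) (subset_iUnion_of_subset 1 (by simp))

/-- Since the covers in `codimHContent` are infinite sequences, bounding the content by a
possibly finite sum requires the empty set to be negligible. -/
lemma codimHContent_le_tsum {ι : Type*} [Countable ι] {R : ℝ}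
    (h0 : codimHContent μ R (∅ : Set X) = 0)
    (c : ι → X) (r : ι → ℝ) (hr : ∀ i, 0 < r i ∧ r i ≤ R) {A : Set X}
    (hA : A ⊆ ⋃ i, ball (c i) (r i)) :
    codimHContent μ R A ≤ ∑' i, μ (ball (c i) (r i)) / ENNReal.ofReal (r i) := by
  refine _root_.le_of_forall_pos_le_add fun ε hε => ?_
  obtain ⟨c', r', hr', -, hs⟩ := exists_cover_of_codimHContent_lt (h0.trans_lt hε)
  refine (codimHContent_le_tsum_of_infinite (ι := ι ⊕ ℕ) (Sum.elim c c') (Sum.elim r r') ?_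
    ?_).trans ?_
  · rintro (i | i)
    · exact hr i
    · exact hr' i
  · exact hA.trans (iUnion_subset fun i => subset_iUnion_of_subset (Sum.inl i) le_rfl)
  · rw [Summable.tsum_sum ENNReal.summable ENNReal.summable]
    exact add_le_add le_rfl hs.le

end HausdorffContent

section Approximation

variable {μ : Measure X} {u : X → ℝ} {M : ℝ≥0∞}

/-- Locally Lipschitz functions `v i` converging to `u` in `L¹` on compact sets, with upper
gradients `g i` of integral at most `M`. -/
structure BVApprox (μ : Measure X) (u : X → ℝ) (M : ℝ≥0∞) (v : ℕ → X → ℝ)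
    (g : ℕ → X → ℝ≥0∞) : Prop where
  locLipschitz : ∀ i, LocLipschitzOn (v i) univ
  upperGradient : ∀ i, IsUpperGradient (g i) (v i)
  tendsto : ∀ K : Set X, IsCompact K →
    Tendsto (fun i => ∫⁻ x in K, ENNReal.ofReal |v i x - u x| ∂μ) atTop (𝓝 0)
  lintegral_le : ∀ i, ∫⁻ x, g i x ∂μ ≤ M

lemma exists_bvApprox_of_totalVariation_lt (h : totalVariation μ u univ < M) :
    ∃ v g, BVApprox μ u M v g := by
  simp only [totalVariation, iInf_lt_iff, exists_prop, Measure.restrict_univ] at h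
  obtain ⟨v, g, hv, hg, ht, hM⟩ := h
  obtain ⟨φ, hφ, hle⟩ := extraction_of_frequently_atTop
    (frequently_lt_of_liminf_lt (by isBoundedDefault) hM)
  exact ⟨fun i => v (φ i), fun i => g (φ i), fun i => hv _, fun i => hg _,
    fun K hK => (ht K (subset_univ _) hK).comp hφ.tendsto_atTop, fun i => (hle i).le⟩

lemma BVApprox.totalVariation_le {v : ℕ → X → ℝ} {g : ℕ → X → ℝ≥0∞} (h : BVApprox μ u M v g) :
    totalVariation μ u univ ≤ M := by
  unfold totalVariation
  refine iInf_le_of_le v (iInf_le_of_le g (iInf_le_of_le h.locLipschitz (iInf_le_of_le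
    h.upperGradient (iInf_le_of_le (fun K _ hK => h.tendsto K hK) ?_))))
  simp only [Measure.restrict_univ]
  exact liminf_le_of_le (by isBoundedDefault) fun b hb => by
    obtain ⟨i, hi⟩ := hb.exists
    exact hi.trans (h.lintegral_le i)

lemma BVApprox.neg {v : ℕ → X → ℝ} {g : ℕ → X → ℝ≥0∞} (h : BVApprox μ u M v g) :
    BVApprox μ (fun x => -u x) M (fun i x => -v i x) g where
  locLipschitz i K hK hKc := by
    obtain ⟨L, hL⟩ := h.locLipschitz i K hK hKc
    exact ⟨L, hL.neg⟩
  upperGradient i := ⟨(h.upperGradient i).1, fun ℓ hℓ γ hγ hΩ => by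
    convert (h.upperGradient i).2 ℓ hℓ γ hγ hΩ using 2
    rw [← abs_neg]; ring_nf⟩
  tendsto K hK := by
    convert h.tendsto K hK using 5 with i x
    rw [← abs_neg]; ring_nf
  lintegral_le := h.lintegral_le

lemma BVApprox.congr_ae {u' : X → ℝ} {v : ℕ → X → ℝ} {g : ℕ → X → ℝ≥0∞}
    (h : BVApprox μ u M v g) (hu : u =ᵐ[μ] u') : BVApprox μ u' M v g where
  locLipschitz := h.locLipschitz
  upperGradient := h.upperGradient
  tendsto K hK := by
    convert h.tendsto K hK using 2 with i
    refine lintegral_congr_ae ((ae_restrict_of_ae hu).mono fun x hx => ?_)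
    simp only [hx]
  lintegral_le := h.lintegral_le

lemma BVApprox.continuous [ProperSpace X] [BorelSpace X] {v : ℕ → X → ℝ} {g : ℕ → X → ℝ≥0∞}
    (h : BVApprox μ u M v g) (i : ℕ) : Continuous (v i) := by
  refine continuous_iff_continuousAt.2 fun x => ?_
  obtain ⟨L, hL⟩ := h.locLipschitz i (closedBall x 1) (subset_univ _) (isCompact_closedBall x 1)
  exact hL.continuousOn.continuousAt (closedBall_mem_nhds x one_pos)

lemma BVApprox.sub [BorelSpace X] [ProperSpace X] {u' : X → ℝ} {M' : ℝ≥0∞} {v v' : ℕ → X → ℝ}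
    {g g' : ℕ → X → ℝ≥0∞} (hu : Measurable u)
    (h : BVApprox μ u M v g) (h' : BVApprox μ u' M' v' g') :
    BVApprox μ (fun x => u x - u' x) (M + M') (fun i x => v i x - v' i x)
      (fun i x => g i x + g' i x) where
  locLipschitz i K hK hKc := by
    obtain ⟨L, hL⟩ := h.locLipschitz i K hK hKc
    obtain ⟨L', hL'⟩ := h'.locLipschitz i K hK hKc
    exact ⟨L + L', hL.sub hL'⟩
  upperGradient i := by
    refine ⟨(h.upperGradient i).1.add (h'.upperGradient i).1, fun ℓ hℓ γ hγ hΩ => ?_⟩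
    have h1 := (h.upperGradient i).2 ℓ hℓ γ hγ hΩ
    have h2 := (h'.upperGradient i).2 ℓ hℓ γ hγ hΩ
    refine le_trans ?_ (le_trans (add_le_add h1 h2) (le_lintegral_add _ _))
    rw [← ENNReal.ofReal_add (abs_nonneg _) (abs_nonneg _)]
    refine ENNReal.ofReal_le_ofReal ?_
    rw [show v i (γ ℓ) - v' i (γ ℓ) - (v i (γ 0) - v' i (γ 0)) =
      (v i (γ ℓ) - v i (γ 0)) - (v' i (γ ℓ) - v' i (γ 0)) by ring]
    exact abs_sub _ _
  tendsto K hK := by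
    have h0 := (h.tendsto K hK).add (h'.tendsto K hK)
    rw [add_zero] at h0
    refine tendsto_of_tendsto_of_tendsto_of_le_of_le tendsto_const_nhds h0 (fun _ => zero_le)
      fun i => ?_
    have hm : Measurable fun x => ENNReal.ofReal |v i x - u x| :=
      (continuous_abs.measurable.comp ((h.continuous i).measurable.sub hu)).ennreal_ofReal
    rw [← lintegral_add_left hm]
    refine lintegral_mono fun x => ?_
    rw [← ENNReal.ofReal_add (abs_nonneg _) (abs_nonneg _)]
    refine ENNReal.ofReal_le_ofReal ?_
    rw [show v i x - v' i x - (u x - u' x) = (v i x - u x) - (v' i x - u' x) by ring]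
    exact abs_sub _ _
  lintegral_le i := by
    rw [lintegral_add_left (h.upperGradient i).1]
    exact add_le_add (h.lintegral_le i) (h'.lintegral_le i)

end Approximation

section Ramp

/-- The piecewise linear function rising from `0` to `1` on `[t, t + ε]`. -/
def ramp (t ε y : ℝ) : ℝ := max 0 (min 1 ((y - t) / ε))

lemma ramp_of_le {t ε y : ℝ} (hε : 0 < ε) (h : y ≤ t) : ramp t ε y = 0 :=
  max_eq_left ((min_le_right _ _).trans (div_nonpos_of_nonpos_of_nonneg (by linarith) hε.le))

lemma ramp_of_ge {t ε y : ℝ} (hε : 0 < ε) (h : t + ε ≤ y) : ramp t ε y = 1 := by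
  unfold ramp
  rw [min_eq_left ((one_le_div hε).2 (by linarith))]
  norm_num

lemma ramp_nonneg (t ε y : ℝ) : 0 ≤ ramp t ε y := le_max_left _ _

lemma ramp_le_one (t ε y : ℝ) : ramp t ε y ≤ 1 := max_le zero_le_one (min_le_left _ _)

lemma ramp_mono {t ε : ℝ} (hε : 0 < ε) : Monotone (ramp t ε) := fun x y h => by
  unfold ramp
  gcongr

lemma lipschitzWith_ramp {t ε : ℝ} (hε : 0 < ε) :
    LipschitzWith (Real.toNNReal (1 / ε)) (ramp t ε) := by
  have h : LipschitzWith (Real.toNNReal (1 / ε)) (fun y : ℝ => (y - t) / ε) := by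
    refine LipschitzWith.of_dist_le_mul fun x y => ?_
    rw [Real.coe_toNNReal _ (by positivity), Real.dist_eq, Real.dist_eq, ← _root_.sub_div,
      sub_sub_sub_cancel_right, abs_div, abs_of_pos hε]
    exact le_of_eq (by ring)
  exact (h.const_min 1).const_max 0

lemma ramp_sub_le {t ε x y : ℝ} (hε : 0 < ε) (h : x ≤ y) :
    ramp t ε y - ramp t ε x ≤ (y - x) / ε := by
  have := (lipschitzWith_ramp (t := t) hε).dist_le_mul y x
  rw [Real.coe_toNNReal _ (by positivity), Real.dist_eq, Real.dist_eq,
    abs_of_nonneg (sub_nonneg.2 h)]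
    at this
  calc _ ≤ _ := le_abs_self _
    _ ≤ _ := this
    _ = _ := by ring

lemma exists_crossing {f : ℝ → ℝ} {ℓ p q : ℝ} (hℓ : 0 ≤ ℓ) (hf : ContinuousOn f (Icc 0 ℓ))
    (h0 : f 0 ≤ p) (hpq : p < q) (h1 : q ≤ f ℓ) :
    ∃ s₁ s₂, 0 ≤ s₁ ∧ s₁ < s₂ ∧ s₂ ≤ ℓ ∧ f s₁ ≤ p ∧ q ≤ f s₂ ∧
      ∀ s ∈ Ioo s₁ s₂, p < f s ∧ f s < q := by
  obtain ⟨s₂, ⟨hs₂, hq⟩, hmin⟩ := (isCompact_Icc.of_isClosed_subset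
    (hf.preimage_isClosed_of_isClosed isClosed_Icc isClosed_Ici) inter_subset_left).exists_isLeast
    (s := Icc 0 ℓ ∩ f ⁻¹' Ici q) ⟨ℓ, ⟨hℓ, le_rfl⟩, h1⟩
  have hf' : ContinuousOn f (Icc 0 s₂) := hf.mono (Icc_subset_Icc_right hs₂.2)
  obtain ⟨s₁, ⟨hs₁, hp⟩, hmax⟩ := (isCompact_Icc.of_isClosed_subset
    (hf'.preimage_isClosed_of_isClosed isClosed_Icc isClosed_Iic)
      inter_subset_left).exists_isGreatest
    (s := Icc 0 s₂ ∩ f ⁻¹' Iic p) ⟨0, ⟨le_rfl, hs₂.1⟩, h0⟩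
  have hp : f s₁ ≤ p := hp
  have hq : q ≤ f s₂ := hq
  refine ⟨s₁, s₂, hs₁.1, lt_of_le_of_ne hs₁.2 ?_, hs₂.2, hp, hq, fun s hs => ⟨?_, ?_⟩⟩
  · rintro rfl
    linarith
  · by_contra! hle
    exact absurd (hmax ⟨⟨hs₁.1.trans hs.1.le, hs.2.le⟩, hle⟩) (not_le.2 hs.1)
  · by_contra! hle
    exact absurd (hmin ⟨⟨hs₁.1.trans hs.1.le, hs.2.le.trans hs₂.2⟩, hle⟩) (not_le.2 hs.2)

variable {v : X → ℝ} {g : X → ℝ≥0∞}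

lemma IsUpperGradient.le_lintegral_Icc (h : IsUpperGradient g v) {ℓ : ℝ} {γ : ℝ → X}
    (hγ : LipschitzOnWith 1 γ (Icc 0 ℓ)) {s₁ s₂ : ℝ} (h1 : 0 ≤ s₁) (h12 : s₁ ≤ s₂) (h2 : s₂ ≤ ℓ) :
    ENNReal.ofReal |v (γ s₂) - v (γ s₁)| ≤ ∫⁻ s in Icc s₁ s₂, g (γ s) := by
  have := h.2 (s₂ - s₁) (by linarith) (fun s => γ (s₁ + s)) ?_ (fun _ _ => mem_univ _)
  · rw [add_zero, add_sub_cancel] at this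
    refine this.trans_eq ?_
    have := (measurePreserving_add_left volume s₁).setLIntegral_comp_preimage_emb
      (measurableEmbedding_addLeft s₁) (fun s => g (γ s)) (Icc s₁ s₂)
    rw [← this, preimage_const_add_Icc, sub_self]
  · intro x hx y hy
    have := hγ (x := s₁ + x) ⟨by linarith [hx.1], by linarith [hx.2]⟩
      (y := s₁ + y) ⟨by linarith [hy.1], by linarith [hy.2]⟩
    simpa using this

lemma IsUpperGradient.ramp_comp [BorelSpace X] (h : IsUpperGradient g v) (hv : Continuous v)
    {t ε : ℝ} (hε : 0 < ε) :
    IsUpperGradient ((v ⁻¹' Ioo t (t + ε)).indicator fun x => g x / ENNReal.ofReal ε)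
      (fun x => ramp t ε (v x)) := by
  set G := (v ⁻¹' Ioo t (t + ε)).indicator fun x => g x / ENNReal.ofReal ε with hG
  have key : ∀ (ℓ : ℝ), 0 ≤ ℓ → ∀ γ : ℝ → X, LipschitzOnWith 1 γ (Icc 0 ℓ) →
      ENNReal.ofReal (ramp t ε (v (γ ℓ)) - ramp t ε (v (γ 0))) ≤ ∫⁻ s in Icc (0:ℝ) ℓ, G (γ s) := by
    intro ℓ hℓ γ hγ
    set p := max t (v (γ 0)) with hp
    set q := min (t + ε) (v (γ ℓ)) with hq
    have hcl : ramp t ε (v (γ ℓ)) - ramp t ε (v (γ 0)) ≤ ramp t ε q - ramp t ε p := by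
      refine sub_le_sub ?_ ?_
      · rcases min_cases (t + ε) (v (γ ℓ)) with ⟨e, _⟩ | ⟨e, _⟩
        · rw [hq, e, ramp_of_ge hε le_rfl]
          exact ramp_le_one _ _ _
        · rw [hq, e]
      · rcases max_cases t (v (γ 0)) with ⟨e, _⟩ | ⟨e, _⟩
        · rw [hp, e, ramp_of_le hε le_rfl]
          exact ramp_nonneg _ _ _
        · rw [hp, e]
    rcases le_or_gt q p with hqp | hpq
    · rw [ENNReal.ofReal_of_nonpos (hcl.trans (sub_nonpos.2 (ramp_mono hε hqp)))]
      exact zero_le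
    obtain ⟨s₁, s₂, h1, h12, h2, hs1, hs2, hs⟩ := exists_crossing (f := fun s => v (γ s)) hℓ
      (hv.comp_continuousOn hγ.continuousOn) (le_max_right t _) hpq (min_le_right _ _)
    calc ENNReal.ofReal (ramp t ε (v (γ ℓ)) - ramp t ε (v (γ 0)))
        ≤ ENNReal.ofReal ((q - p) / ε) :=
          ENNReal.ofReal_le_ofReal (hcl.trans (ramp_sub_le hε hpq.le))
      _ ≤ ENNReal.ofReal (|v (γ s₂) - v (γ s₁)| / ε) := by
          gcongr
          exact le_trans (by linarith) (le_abs_self _)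
      _ = ENNReal.ofReal (|v (γ s₂) - v (γ s₁)|) / ENNReal.ofReal ε := ENNReal.ofReal_div_of_pos hε
      _ ≤ (∫⁻ s in Icc s₁ s₂, g (γ s)) / ENNReal.ofReal ε := by
          gcongr
          exact h.le_lintegral_Icc hγ h1 h12.le h2
      _ = ∫⁻ s in Ioo s₁ s₂, g (γ s) / ENNReal.ofReal ε := by
          rw [← setLIntegral_congr Ioo_ae_eq_Icc]
          simp only [div_eq_mul_inv]
          rw [lintegral_mul_const']
          simpa using hε
      _ = ∫⁻ s in Ioo s₁ s₂, G (γ s) := by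
          refine setLIntegral_congr_fun measurableSet_Ioo fun s hs' => ?_
          rw [hG, indicator_of_mem]
          exact ⟨(le_max_left _ _).trans_lt (hs s hs').1, (hs s hs').2.trans_le (min_le_left _ _)⟩
      _ ≤ ∫⁻ s in Icc 0 ℓ, G (γ s) :=
          lintegral_mono_set (Ioo_subset_Icc_self.trans (Icc_subset_Icc h1 h2))
  refine ⟨(h.1.div_const _).indicator (hv.measurable measurableSet_Ioo), fun ℓ hℓ γ hγ _ => ?_⟩
  rcases abs_cases (ramp t ε (v (γ ℓ)) - ramp t ε (v (γ 0))) with ⟨e, _⟩ | ⟨e, _⟩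
  · rw [e]
    exact key ℓ hℓ γ hγ
  · rw [e, neg_sub]
    have := key ℓ hℓ (fun s => γ (ℓ - s)) ?_
    · rw [sub_zero, sub_self] at this
      refine this.trans_eq ?_
      have := (Measure.measurePreserving_sub_left volume ℓ).setLIntegral_comp_preimage_emb
        (MeasurableEquiv.subLeft ℓ).measurableEmbedding (fun s => G (γ s)) (Icc 0 ℓ)
      rw [← this]
      simp
    · intro x hx y hy
      have := hγ (x := ℓ - x) ⟨by linarith [hx.2], by linarith [hx.1]⟩
        (y := ℓ - y) ⟨by linarith [hy.2], by linarith [hy.1]⟩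
      rwa [edist_sub_left] at this

end Ramp

section Coarea

variable {μ : Measure X} {u : X → ℝ} {M : ℝ≥0∞} {v : ℕ → X → ℝ} {g : ℕ → X → ℝ≥0∞}

lemma BVApprox.comp_strictMono (h : BVApprox μ u M v g) {φ : ℕ → ℕ} (hφ : StrictMono φ) :
    BVApprox μ u M (fun i => v (φ i)) (fun i => g (φ i)) where
  locLipschitz _ := h.locLipschitz _
  upperGradient _ := h.upperGradient _
  tendsto K hK := (h.tendsto K hK).comp hφ.tendsto_atTop
  lintegral_le _ := h.lintegral_le _

lemma BVApprox.exists_seq_tendsto_ae [BorelSpace X] [ProperSpace X] [Nonempty X]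
    (h : BVApprox μ u M v g) (hu : Measurable u) :
    ∃ φ : ℕ → ℕ, StrictMono φ ∧ ∀ᵐ x ∂μ, Tendsto (fun i => v (φ i) x) atTop (𝓝 (u x)) := by
  obtain ⟨x₀⟩ := ‹Nonempty X›
  obtain ⟨δ, hδ, hsum⟩ := ENNReal.exists_pos_sum_of_countable' one_ne_zero ℕ
  obtain ⟨φ, hφ, hle⟩ := extraction_forall_of_eventually'
    (P := fun k i => ∫⁻ x in closedBall x₀ k, ENNReal.ofReal |v i x - u x| ∂μ < δ k)
    (fun k => eventually_atTop.1 ((h.tendsto _ (isCompact_closedBall x₀ k)).eventually_lt_const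
      (hδ k)))
  refine ⟨φ, hφ, ?_⟩
  set f : ℕ → X → ℝ≥0∞ := fun k => (closedBall x₀ k).indicator
    fun x => ENNReal.ofReal |v (φ k) x - u x| with hf
  have hfm : ∀ k, Measurable (f k) := fun k => Measurable.indicator
    (continuous_abs.measurable.comp ((h.continuous _).measurable.sub hu)).ennreal_ofReal
    measurableSet_closedBall
  have hfin : ∫⁻ x, ∑' k, f k x ∂μ ≠ ⊤ := by
    rw [lintegral_tsum fun k => (hfm k).aemeasurable]
    refine ((ENNReal.tsum_le_tsum fun k => ?_).trans_lt (hsum.trans one_lt_top)).ne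
    rw [hf, lintegral_indicator measurableSet_closedBall]
    exact (hle k).le
  filter_upwards [ae_lt_top (Measurable.tsum hfm) hfin] with x hx
  have h0 := ENNReal.tendsto_atTop_zero_of_tsum_ne_top hx.ne
  have h1 : Tendsto (fun k => ENNReal.ofReal |v (φ k) x - u x|) atTop (𝓝 0) := by
    refine h0.congr' ?_
    obtain ⟨m, hm⟩ := exists_nat_ge (dist x x₀)
    filter_upwards [eventually_ge_atTop m] with k hk
    simp only [hf]
    rw [indicator_of_mem]
    exact hm.trans (by exact_mod_cast hk)
  rw [tendsto_iff_dist_tendsto_zero]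
  simpa [Function.comp_def, Real.dist_eq] using (ENNReal.tendsto_toReal zero_ne_top).comp h1

lemma tendsto_ramp {a : ℕ → ℝ} {b t : ℝ} (ha : Tendsto a atTop (𝓝 b)) (hbt : b ≠ t) :
    Tendsto (fun k : ℕ => ramp t (1 / ((k : ℝ) + 1)) (a k)) atTop (𝓝 (if t < b then 1 else 0)) := by
  rcases lt_or_gt_of_ne hbt with hlt | hlt
  · rw [if_neg (not_lt.2 hlt.le)]
    refine tendsto_const_nhds.congr' ?_
    filter_upwards [ha.eventually_lt_const hlt] with k hk
    exact (ramp_of_le (by positivity) hk.le).symm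
  · rw [if_pos hlt]
    refine tendsto_const_nhds.congr' ?_
    filter_upwards [ha.eventually_const_lt (show (t + b) / 2 < b by linarith),
      tendsto_one_div_add_atTop_nhds_zero_nat.eventually_lt_const
      (show 0 < (b - t) / 2 by linarith)] with k hk hk'
    exact (ramp_of_ge (by positivity) (by linarith)).symm

/-- A form of the inequality `∫ P({u > t}) dt ≤ ‖Du‖` of the coarea formula. -/
lemma BVApprox.exists_superlevel [BorelSpace X] [ProperSpace X] [Nonempty X]
    [IsLocallyFiniteMeasure μ] (h : BVApprox μ u M v g) (hu : Measurable u) {a b : ℝ} (hab : a < b)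
    {M' : ℝ≥0∞} (hM : M / ENNReal.ofReal (b - a) < M') :
    ∃ t ∈ Ioo a b, ∃ v' g', BVApprox μ ({x | t < u x}.indicator fun _ => (1 : ℝ)) M' v' g' := by
  obtain ⟨φ, hφ, hae⟩ := h.exists_seq_tendsto_ae hu
  replace h := h.comp_strictMono hφ
  set w : ℕ → X → ℝ := fun i => v (φ i)
  set G : ℕ → X → ℝ≥0∞ := fun i => g (φ i)
  set ε : ℕ → ℝ := fun k => 1 / ((k : ℝ) + 1) with hε
  have hε0 : ∀ k, 0 < ε k := fun k => by positivity
  have hwm : ∀ k, Measurable (w k) := fun k => (h.continuous k).measurable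
  set H : ℕ → ℝ → X → ℝ≥0∞ := fun k t =>
    (w k ⁻¹' Ioo t (t + ε k)).indicator fun x => G k x / ENNReal.ofReal (ε k) with hH
  have hHm : ∀ k, Measurable (Function.uncurry (H k)) := by
    intro k
    have : Function.uncurry (H k) = {p : ℝ × X | p.1 < w k p.2 ∧ w k p.2 < p.1 + ε k}.indicator
        fun p => G k p.2 / ENNReal.ofReal (ε k) := by
      ext ⟨t, x⟩
      rfl
    rw [this]
    refine Measurable.indicator (((h.upperGradient k).1.comp measurable_snd).div_const _) ?_
    exact (measurableSet_lt measurable_fst ((hwm k).comp measurable_snd)).inter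
      (measurableSet_lt ((hwm k).comp measurable_snd) (measurable_fst.add_const _))
  set F : ℕ → ℝ → ℝ≥0∞ := fun k t => ∫⁻ x, H k t x ∂μ with hF
  have hFm : ∀ k, Measurable (F k) := fun k => (hHm k).lintegral_prod_right'
  have hFint : ∀ k, ∫⁻ t, F k t ≤ M := by
    intro k
    rw [hF, lintegral_lintegral_swap (hHm k).aemeasurable]
    refine le_trans (lintegral_mono fun x => le_of_eq ?_) (h.lintegral_le k)
    have : ∀ t, H k t x = (Ioo (w k x - ε k) (w k x)).indicator
        (fun _ => G k x / ENNReal.ofReal (ε k)) t := by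
      intro t
      have hiff : x ∈ w k ⁻¹' Ioo t (t + ε k) ↔ t ∈ Ioo (w k x - ε k) (w k x) := by
        rw [mem_preimage, mem_Ioo, mem_Ioo, sub_lt_iff_lt_add, and_comm]
      simp only [hH]
      by_cases ht : t ∈ Ioo (w k x - ε k) (w k x)
      · rw [indicator_of_mem (hiff.2 ht), indicator_of_mem ht]
      · rw [indicator_of_notMem (mt hiff.1 ht), indicator_of_notMem ht]
    simp_rw [this]
    rw [lintegral_indicator measurableSet_Ioo, setLIntegral_const, Real.volume_Ioo,
      _root_.sub_sub_cancel]
    exact ENNReal.div_mul_cancel (by simpa using hε0 k) ofReal_ne_top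
  have hvol : volume.restrict (Ioo a b) ≠ 0 := by
    simp [Measure.restrict_eq_zero, hab]
  have hnull : (volume.restrict (Ioo a b)) ({t | 0 < μ {x | u x = t}} ∪ (Ioo a b)ᶜ) = 0 := by
    refine measure_union_null ?_ ?_
    · exact ((Measure.countable_meas_level_set_pos (μ := μ) hu).measure_zero _)
    · rw [Measure.restrict_apply measurableSet_Ioo.compl]
      simp
  obtain ⟨t, ht, hle⟩ := exists_notMem_null_le_laverage hvol
    (f := fun t => liminf (fun k => F k t) atTop) (Measurable.liminf hFm).aemeasurable hnull
  have hlt : liminf (fun k => F k t) atTop < M' := by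
    refine (hle.trans ?_).trans_lt hM
    rw [setLAverage_eq, Real.volume_Ioo]
    gcongr
    calc ∫⁻ t in Ioo a b, liminf (fun k => F k t) atTop
        ≤ ∫⁻ t, liminf (fun k => F k t) atTop := setLIntegral_le_lintegral _ _
      _ ≤ liminf (fun k => ∫⁻ t, F k t) atTop := lintegral_liminf_le hFm
      _ ≤ M := liminf_le_of_le (by isBoundedDefault) fun b hb => by
          obtain ⟨i, hi⟩ := hb.exists
          exact hi.trans (hFint i)
  simp only [mem_union, mem_ofPred_eq, not_or, not_lt, nonpos_iff_eq_zero, notMem_compl_iff] at ht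
  obtain ⟨ψ, hψ, hψle⟩ := extraction_of_frequently_atTop
    (frequently_lt_of_liminf_lt (by isBoundedDefault) hlt)
  refine ⟨t, ht.2, fun i x => ramp t (ε (ψ i)) (w (ψ i) x), fun i => H (ψ i) t, ?_, ?_, ?_, ?_⟩
  · intro i K hK hKc
    obtain ⟨L, hL⟩ := h.locLipschitz (ψ i) K hK hKc
    exact ⟨_, (lipschitzWith_ramp (hε0 _)).comp_lipschitzOnWith hL⟩
  · exact fun i => (h.upperGradient _).ramp_comp (h.continuous _) (hε0 _)
  · intro K hK
    refine Tendsto.comp (g := fun i => ∫⁻ x in K, ENNReal.ofReal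
      |ramp t (ε i) (w i x) - {x | t < u x}.indicator (fun _ => (1 : ℝ)) x| ∂μ) ?_ hψ.tendsto_atTop
    have hind : Measurable ({x | t < u x}.indicator fun _ => (1 : ℝ)) :=
      measurable_const.indicator (measurableSet_lt measurable_const hu)
    have := tendsto_lintegral_of_dominated_convergence (μ := μ.restrict K) (F := fun i x =>
      ENNReal.ofReal |ramp t (ε i) (w i x) - {x | t < u x}.indicator (fun _ => (1 : ℝ)) x|)
      (f := fun _ => 0) (fun _ => 1) (fun i => ?_) (fun i => ?_) ?_ ?_
    · simpa using this
    · exact (continuous_abs.measurable.comp (((lipschitzWith_ramp (hε0 i)).continuous.measurable.comp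
        (hwm i)).sub hind)).ennreal_ofReal
    · refine Eventually.of_forall fun x => ?_
      rw [← ENNReal.ofReal_one]
      refine ENNReal.ofReal_le_ofReal ?_
      have h0 := ramp_nonneg t (ε i) (w i x)
      have h1 := ramp_le_one t (ε i) (w i x)
      by_cases hx : t < u x <;> simp only [indicator_apply, mem_ofPred_eq, hx, if_true, if_false] <;>
        rw [abs_le] <;> constructor <;> linarith
    · simpa using hK.measure_lt_top.ne
    · have hne : ∀ᵐ x ∂μ, u x ≠ t := by
        rw [ae_iff]
        simpa using ht.1
      filter_upwards [ae_restrict_of_ae hae, ae_restrict_of_ae hne] with x hx hxt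
      have := (tendsto_ramp hx hxt).sub_const (if t < u x then 1 else 0)
      rw [sub_self] at this
      have := ENNReal.tendsto_ofReal this.abs
      simpa only [indicator_apply, mem_ofPred_eq, abs_zero, ENNReal.ofReal_zero] using this
  · exact fun i => (hψle i).le

end Coarea

section Boxing

variable {μ : Measure X} {Cd : ℝ≥0} {CP lam : ℝ}

lemma PoincareIneq.lintegral_le (hdbl : DoublingWith μ Cd) (hlam : 1 ≤ lam)
    (hPI : PoincareIneq μ CP lam) (x : X) {r : ℝ} (hr : 0 < r) {v : X → ℝ} {g : X → ℝ≥0∞}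
    (hv : LocallyIntegrable v μ) (hg : IsUpperGradient g v) :
    ∫⁻ y in ball x r, ENNReal.ofReal |v y - ⨍ z in ball x r, v z ∂μ| ∂μ ≤
      ENNReal.ofReal (CP * r) * ∫⁻ y in ball x (lam * r), g y ∂μ := by
  have h := hPI x r hr v g hv hg
  have hB := hdbl x r hr
  rw [ENNReal.div_le_iff hB.1.ne' hB.2.2.ne, mul_assoc] at h
  refine h.trans ?_
  gcongr
  rw [ENNReal.div_eq_inv_mul, mul_comm, ← mul_assoc]
  refine mul_le_of_le_one_left bot_le ?_
  rw [← div_eq_mul_inv]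
  refine ENNReal.div_le_of_le_mul ?_
  rw [one_mul]
  exact measure_mono (ball_subset_ball (by nlinarith))

lemma half_le_lintegral_indicator_sub {E : Set X} (hE : MeasurableSet E) {x : X} {r : ℝ}
    {m : ℝ≥0∞} (h1 : m ≤ μ (ball x r ∩ E)) (h2 : m ≤ μ (ball x r \ E)) (a : ℝ) :
    m / 2 ≤ ∫⁻ y in ball x r, ENNReal.ofReal |E.indicator (fun _ => (1 : ℝ)) y - a| ∂μ := by
  have key : ∀ F : Set X, MeasurableSet F → m ≤ μ (ball x r ∩ F) →
      (∀ y ∈ F, 1 / 2 ≤ |E.indicator (fun _ => (1 : ℝ)) y - a|) →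
      m / 2 ≤ ∫⁻ y in ball x r, ENNReal.ofReal |E.indicator (fun _ => (1 : ℝ)) y - a| ∂μ := by
    intro F hF hm hy
    calc m / 2 ≤ μ (ball x r ∩ F) * 2⁻¹ := by rw [ENNReal.div_eq_inv_mul, mul_comm]; gcongr
      _ = ∫⁻ _ in F, 2⁻¹ ∂(μ.restrict (ball x r)) := by
          rw [setLIntegral_const, Measure.restrict_apply hF, inter_comm, mul_comm]
      _ ≤ ∫⁻ y in F, ENNReal.ofReal |E.indicator (fun _ => (1 : ℝ)) y - a|
            ∂(μ.restrict (ball x r)) := by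
          refine setLIntegral_mono' hF fun y hyF => ?_
          refine le_trans (le_of_eq ?_) (ENNReal.ofReal_le_ofReal (hy y hyF))
          rw [one_div, ENNReal.ofReal_inv_of_pos two_pos, ENNReal.ofReal_ofNat]
      _ ≤ _ := setLIntegral_le_lintegral _ _
  rcases le_total (1 / 2) a with ha | ha
  · refine key Eᶜ hE.compl h2 fun y hy => ?_
    rw [indicator_of_notMem hy, zero_sub, abs_neg]
    exact ha.trans (le_abs_self a)
  · refine key E hE h1 fun y hy => ?_
    rw [indicator_of_mem hy]
    exact le_trans (by linarith) (le_abs_self _)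

/-- A relative isoperimetric inequality at the level of approximating sequences. -/
lemma BVApprox.eventually_le_lintegral [BorelSpace X] [ProperSpace X] (hdbl : DoublingWith μ Cd)
    (hlam : 1 ≤ lam) (hPI : PoincareIneq μ CP lam) {E : Set X} {M : ℝ≥0∞} {v : ℕ → X → ℝ}
    {g : ℕ → X → ℝ≥0∞} (h : BVApprox μ (E.indicator fun _ => (1 : ℝ)) M v g)
    (hE : MeasurableSet E) {x : X} {r : ℝ} (hr : 0 < r) {m : ℝ≥0∞} (hm0 : 0 < m)
    (h1 : m ≤ μ (ball x r ∩ E)) (h2 : m ≤ μ (ball x r \ E)) :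
    ∀ᶠ i in atTop, m / 4 ≤ ENNReal.ofReal (CP * r) * ∫⁻ y in ball x (lam * r), g i y ∂μ := by
  have := hdbl.isLocallyFiniteMeasure
  have hmtop : m ≠ ⊤ :=
    ((h1.trans (measure_mono inter_subset_left)).trans_lt (hdbl x r hr).2.2).ne
  have h4 : 0 < m / 4 := ENNReal.div_pos hm0.ne' (by simp)
  have h4top : m / 4 ≠ ⊤ := (ENNReal.div_lt_top hmtop (by simp)).ne
  have hsum : m / 2 = m / 4 + m / 4 := by
    rw [← ENNReal.add_halves (m / 2), ENNReal.div_eq_inv_mul, ENNReal.div_eq_inv_mul,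
      ENNReal.div_eq_inv_mul, ← mul_assoc, ← ENNReal.mul_inv (by simp) (by simp)]
    norm_num
  filter_upwards [(h.tendsto _ (isCompact_closedBall x r)).eventually_lt_const h4] with i hi
  refine le_trans ?_ (hPI.lintegral_le hdbl hlam x hr
    (h.continuous i).locallyIntegrable (h.upperGradient i))
  set a := ⨍ z in ball x r, v i z ∂μ
  have hle := half_le_lintegral_indicator_sub hE h1 h2 a
  rw [hsum] at hle
  have hmeas : Measurable fun y => ENNReal.ofReal |v i y - E.indicator (fun _ => (1 : ℝ)) y| :=
    (continuous_abs.measurable.comp ((h.continuous i).measurable.sub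
      (measurable_const.indicator hE))).ennreal_ofReal
  have htri : ∫⁻ y in ball x r, ENNReal.ofReal |E.indicator (fun _ => (1 : ℝ)) y - a| ∂μ ≤
      m / 4 + ∫⁻ y in ball x r, ENNReal.ofReal |v i y - a| ∂μ := by
    calc _ ≤ ∫⁻ y in ball x r, (ENNReal.ofReal |v i y - E.indicator (fun _ => (1 : ℝ)) y| +
            ENNReal.ofReal |v i y - a|) ∂μ := by
          refine lintegral_mono fun y => ?_
          rw [← ENNReal.ofReal_add (abs_nonneg _) (abs_nonneg _)]
          refine ENNReal.ofReal_le_ofReal ?_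
          rw [abs_sub_comm (v i y)]
          exact abs_sub_le _ _ _
      _ = _ := lintegral_add_left hmeas _
      _ ≤ _ := by
          gcongr
          exact (lintegral_mono_set ball_subset_closedBall).trans hi.le
  exact (ENNReal.add_le_add_iff_left h4top).1 (hle.trans htri)

lemma exists_radius_of_density (hdbl : DoublingWith μ Cd) {E : Set X} (hE : MeasurableSet E)
    {x : X} {ρ : ℝ} (hρ : 0 < ρ) {κ : ℝ≥0∞} (hκ : κ ≤ 2⁻¹)
    (hx : ∀ᶠ r in 𝓝[>] (0 : ℝ), κ * μ (ball x r) ≤ μ (ball x r ∩ E))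
    (hEρ : μ E < κ * μ (ball x ρ)) :
    ∃ r, 0 < r ∧ r ≤ ρ ∧ κ * μ (ball x r) ≤ Cd * μ (ball x r ∩ E) ∧
      κ * μ (ball x r) ≤ μ (ball x r \ E) := by
  have ht : Tendsto (fun j : ℕ => (1 / 2 : ℝ) ^ j * ρ) atTop (𝓝[>] 0) := by
    refine tendsto_nhdsWithin_iff.2 ⟨?_, Eventually.of_forall fun j => by simpa using hρ⟩
    simpa using (tendsto_pow_atTop_nhds_zero_of_lt_one (r := (1 / 2 : ℝ)) (by norm_num)
      (by norm_num)).mul_const ρ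
  have hex := (ht.eventually hx).exists
  classical
  obtain ⟨j, hj⟩ : ∃ j, Nat.find hex = j + 1 := by
    refine Nat.exists_eq_succ_of_ne_zero fun h0 => ?_
    have := Nat.find_spec hex
    rw [h0, pow_zero, one_mul] at this
    exact absurd (this.trans (measure_mono inter_subset_right)) (not_le.2 hEρ)
  have hj1 := Nat.find_spec hex
  have hj2 := Nat.find_min hex (m := j) (by omega)
  rw [hj] at hj1
  rw [not_le] at hj2
  set r : ℝ := (1 / 2 : ℝ) ^ j * ρ with hr
  have hr0 : 0 < r := by positivity
  have hr2 : (1 / 2 : ℝ) ^ (j + 1) * ρ = r / 2 := by rw [hr, pow_succ]; ring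
  rw [hr2] at hj1
  refine ⟨r, hr0, mul_le_of_le_one_left hρ.le (pow_le_one₀ (by norm_num) (by norm_num)), ?_, ?_⟩
  · calc κ * μ (ball x r) ≤ κ * (Cd * μ (ball x (r / 2))) := by
          gcongr
          simpa [mul_div_cancel₀] using (hdbl x (r / 2) (by positivity)).2.1
      _ = Cd * (κ * μ (ball x (r / 2))) := by ring
      _ ≤ Cd * μ (ball x r ∩ E) := by
          gcongr
          exact hj1.trans (measure_mono (inter_subset_inter_left _
            (ball_subset_ball (by linarith))))
  · have hfin : μ (ball x r) ≠ ⊤ := (hdbl x r hr0).2.2.ne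
    have h1 : 2⁻¹ * μ (ball x r) + 2⁻¹ * μ (ball x r) ≤
        2⁻¹ * μ (ball x r) + μ (ball x r \ E) := by
      rw [← add_mul, ENNReal.inv_two_add_inv_two, one_mul, ← measure_inter_add_sdiff (ball x r) hE]
      conv_rhs => rw [measure_inter_add_sdiff (ball x r) hE]
      gcongr
      exact hj2.le.trans (by gcongr)
    have h2 := (ENNReal.add_le_add_iff_left (ENNReal.mul_ne_top (by simp) hfin)).1 h1
    exact le_trans (by gcongr) h2

/-- A local boxing inequality. -/
lemma exists_codimHContent_le [BorelSpace X] [ProperSpace X] (hdbl : DoublingWith μ Cd)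
    (hCP : 0 < CP) (hlam : 1 ≤ lam) (hPI : PoincareIneq μ CP lam)
    {R : ℝ} (hR : 0 < R) (h0 : codimHContent μ R (∅ : Set X) = 0)
    {K : ℝ} (hK : 0 < K) (x₀ : X) {κ : ℝ≥0∞} (hκ0 : 0 < κ) (hκ : κ ≤ 2⁻¹) :
    ∃ C : ℝ≥0∞, C ≠ ⊤ ∧ ∃ c : ℝ≥0∞, 0 < c ∧ ∀ (E : Set X) (M : ℝ≥0∞) (v : ℕ → X → ℝ)
      (g : ℕ → X → ℝ≥0∞), MeasurableSet E → BVApprox μ (E.indicator fun _ => (1 : ℝ)) M v g →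
      μ E < c → codimHContent μ R {x ∈ ball x₀ K |
        ∀ᶠ r in 𝓝[>] (0 : ℝ), κ * μ (ball x r) ≤ μ (ball x r ∩ E)} ≤ C * M := by
  obtain ⟨C₁, hC₁⟩ := hdbl.exists_measure_ball_le (6 * lam)
  set ρ : ℝ := R / (6 * lam) with hρ
  have hρ0 : 0 < ρ := by positivity
  obtain ⟨c₀, hc₀, hc⟩ := hdbl.exists_pos_le_measure_ball x₀ hK hρ0
  have hκtop : κ ≠ ⊤ := (hκ.trans_lt (by simp)).ne
  set C : ℝ≥0∞ := C₁ * (4 * (Cd + 1) * ENNReal.ofReal CP / κ) with hC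
  refine ⟨C, ?_, κ * c₀, ENNReal.mul_pos hκ0.ne' hc₀.ne', ?_⟩
  · refine ENNReal.mul_ne_top (by simp) (ENNReal.div_lt_top ?_ hκ0.ne').ne
    exact ENNReal.mul_ne_top (ENNReal.mul_ne_top (by simp) (by simp)) ofReal_ne_top
  intro E M v g hE h hEc
  set A : Set X := {x ∈ ball x₀ K |
        ∀ᶠ r in 𝓝[>] (0 : ℝ), κ * μ (ball x r) ≤ μ (ball x r ∩ E)} with hA
  have hrad : ∀ x ∈ A, ∃ r, 0 < r ∧ r ≤ ρ ∧ ∀ᶠ i in atTop,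
      μ (ball x (6 * lam * r)) / ENNReal.ofReal (6 * lam * r) ≤
        C * ∫⁻ y in closedBall x (lam * r), g i y ∂μ := by
    intro x hx
    obtain ⟨r, hr0, hrρ, h1, h2⟩ := exists_radius_of_density hdbl hE hρ0 hκ hx.2
      (hEc.trans_le (by gcongr; exact hc x hx.1))
    refine ⟨r, hr0, hrρ, ?_⟩
    have hB := hdbl x r hr0
    have hd0 : (Cd : ℝ≥0∞) + 1 ≠ 0 := by simp
    have hdt : (Cd : ℝ≥0∞) + 1 ≠ ⊤ := by simp
    have hm0 : 0 < κ * μ (ball x r) / (Cd + 1) :=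
      ENNReal.div_pos (ENNReal.mul_pos hκ0.ne' hB.1.ne').ne' hdt
    filter_upwards [h.eventually_le_lintegral hdbl hlam hPI hE hr0 hm0
      (ENNReal.div_le_of_le_mul' (h1.trans (by gcongr; exact le_self_add)))
      (ENNReal.div_le_of_le_mul' (h2.trans (le_mul_of_one_le_left bot_le le_add_self)))] with i hi
    have hir : ENNReal.ofReal r ≠ 0 := by simpa using hr0
    have hi' : μ (ball x r) ≤ ENNReal.ofReal r * ((4 * (Cd + 1) * ENNReal.ofReal CP / κ) *
        ∫⁻ y in closedBall x (lam * r), g i y ∂μ) := by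
      have h3 : κ * μ (ball x r) ≤ 4 * (Cd + 1) * (ENNReal.ofReal (CP * r) *
          ∫⁻ y in closedBall x (lam * r), g i y ∂μ) := by
        rw [ENNReal.div_le_iff (by simp) (by simp), ENNReal.div_le_iff hd0 hdt] at hi
        refine hi.trans (le_of_eq_of_le (by ring) (mul_le_mul_right
          (mul_le_mul_right (lintegral_mono_set ball_subset_closedBall) _) (4 * ((Cd : ℝ≥0∞) + 1))))
      rw [mul_comm, ← ENNReal.le_div_iff_mul_le (Or.inl hκ0.ne') (Or.inl hκtop)] at h3
      refine h3.trans (le_of_eq ?_)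
      rw [ENNReal.ofReal_mul hCP.le]
      simp only [ENNReal.div_eq_inv_mul]
      ring
    have h6 : (1 : ℝ) ≤ 6 * lam := by linarith
    calc μ (ball x (6 * lam * r)) / ENNReal.ofReal (6 * lam * r)
        ≤ C₁ * μ (ball x r) / ENNReal.ofReal r := by
          gcongr
          · exact hC₁ x r hr0
          · nlinarith
      _ ≤ C₁ * (ENNReal.ofReal r * ((4 * (Cd + 1) * ENNReal.ofReal CP / κ) *
            ∫⁻ y in closedBall x (lam * r), g i y ∂μ)) / ENNReal.ofReal r := by gcongr
      _ = C * ∫⁻ y in closedBall x (lam * r), g i y ∂μ := by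
          rw [mul_left_comm, ENNReal.mul_div_right_comm, ENNReal.div_self hir ofReal_ne_top,
            one_mul, hC, mul_assoc (C₁ : ℝ≥0∞)]
  choose! rad hrad0 hradρ hradle using hrad
  obtain ⟨w, hwA, hdisj, hcov⟩ := Vitali.exists_disjoint_subfamily_covering_enlargement_closedBall
    A id (fun x => lam * rad x) (lam * ρ)
    (fun x hx => mul_le_mul_of_nonneg_left (hradρ x hx) (by linarith)) 5 (by norm_num)
  have hwc : w.Countable := by
    refine hdisj.countable_of_nonempty_interior fun x hx => ?_
    have := hrad0 x (hwA hx)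
    exact ⟨x, ball_subset_interior_closedBall (mem_ball_self (by positivity))⟩
  have := hwc.to_subtype
  refine (codimHContent_le_tsum (ι := w) h0 (fun x => (x : X)) (fun x => 6 * lam * rad x)
    (fun x => ⟨?_, ?_⟩) ?_).trans ?_
  · have := hrad0 x (hwA x.2)
    positivity
  · have := hradρ x (hwA x.2)
    rw [hρ, le_div_iff₀ (by positivity)] at this
    linarith
  · intro a ha
    obtain ⟨b, hb, hsub⟩ := hcov a ha
    refine mem_iUnion.2 ⟨⟨b, hb⟩, ?_⟩
    have ha0 := hrad0 a ha
    have hb0 := hrad0 b (hwA hb)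
    refine closedBall_subset_ball ?_ (hsub (mem_closedBall_self (by positivity)))
    have : 0 < lam * rad b := by positivity
    linarith
  · rw [ENNReal.tsum_eq_iSup_sum]
    refine iSup_le fun s => ?_
    obtain ⟨i, hi⟩ := ((Finset.eventually_all s).2 fun x (_ : x ∈ s) =>
      hradle x (hwA x.2)).exists
    calc _ ≤ ∑ x ∈ s, C * ∫⁻ y in closedBall (x : X) (lam * rad x), g i y ∂μ :=
          Finset.sum_le_sum hi
      _ = C * ∫⁻ y in ⋃ x ∈ s, closedBall (x : X) (lam * rad x), g i y ∂μ := by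
          rw [← Finset.mul_sum, lintegral_biUnion_finset]
          · exact fun x _ y _ hxy => hdisj x.2 y.2 (fun h => hxy (Subtype.ext h))
          · exact fun x _ => measurableSet_closedBall
      _ ≤ C * M := by
          gcongr
          exact (setLIntegral_le_lintegral _ _).trans (h.lintegral_le i)

end Boxing

section Density

variable {μ : Measure X} {Cd : ℝ≥0} {A B : Set X} {x : X}

/-- `A` has density zero at `x`. -/
def DensityZeroAt (μ : Measure X) (A : Set X) (x : X) : Prop :=
  Tendsto (fun r : ℝ => μ (ball x r ∩ A) / μ (ball x r)) (𝓝[>] 0) (𝓝 0)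

lemma DensityZeroAt.mono (hB : DensityZeroAt μ B x) (h : A ⊆ B) : DensityZeroAt μ A x :=
  tendsto_of_tendsto_of_tendsto_of_le_of_le tendsto_const_nhds hB (fun _ => bot_le)
    fun r => by gcongr

lemma DensityZeroAt.union (hA : DensityZeroAt μ A x) (hB : DensityZeroAt μ B x) :
    DensityZeroAt μ (A ∪ B) x := by
  have h : Tendsto (fun r : ℝ => μ (ball x r ∩ A) / μ (ball x r) +
      μ (ball x r ∩ B) / μ (ball x r)) (𝓝[>] 0) (𝓝 0) := by simpa using Tendsto.add hA hB
  refine tendsto_of_tendsto_of_tendsto_of_le_of_le tendsto_const_nhds h (fun _ => bot_le)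
    fun r => ?_
  rw [← ENNReal.add_div, inter_union_distrib_left]
  gcongr
  exact measure_union_le _ _

lemma densityZeroAt_empty : DensityZeroAt μ ∅ x := by simp [DensityZeroAt]

lemma DoublingWith.not_densityZeroAt_univ (hdbl : DoublingWith μ Cd) :
    ¬ DensityZeroAt μ univ x := by
  intro h
  refine one_ne_zero (tendsto_nhds_unique (h.congr' (f₂ := fun _ => (1 : ℝ≥0∞)) ?_)
    tendsto_const_nhds).symm
  filter_upwards [self_mem_nhdsWithin] with r hr
  have hB := hdbl x r hr
  rw [inter_univ, ENNReal.div_self hB.1.ne' hB.2.2.ne]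

lemma densityZeroAt_of_limsup_eq_zero
    (h : limsup (fun r : ℝ => μ (ball x r ∩ A) / μ (ball x r)) (𝓝[>] 0) = 0) :
    DensityZeroAt μ A x :=
  tendsto_of_le_liminf_of_limsup_le bot_le h.le

/-- `A` has lower density at least `c` at `x`. -/
def LowerDensityGe (μ : Measure X) (c : ℝ≥0∞) (A : Set X) (x : X) : Prop :=
  c ≤ liminf (fun r : ℝ => μ (ball x r ∩ A) / μ (ball x r)) (𝓝[>] 0)

lemma LowerDensityGe.eventually_le (hdbl : DoublingWith μ Cd) {c κ : ℝ≥0∞} (hκ : κ < c)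
    (h : LowerDensityGe μ c A x) :
    ∀ᶠ r in 𝓝[>] (0 : ℝ), κ * μ (ball x r) ≤ μ (ball x r ∩ A) := by
  filter_upwards [eventually_lt_of_lt_liminf (hκ.trans_le h) (by isBoundedDefault),
    self_mem_nhdsWithin] with r hr hr0
  have hB := hdbl x r hr0
  exact ((ENNReal.le_div_iff_mul_le (Or.inl hB.1.ne') (Or.inl hB.2.2.ne)).1 hr.le)

lemma lowerDensityGe_of_densityZeroAt_compl (hdbl : DoublingWith μ Cd) {c : ℝ≥0∞} (hc : c ≤ 2⁻¹)
    (h : DensityZeroAt μ Aᶜ x) : LowerDensityGe μ c A x := by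
  refine le_liminf_of_le (by isBoundedDefault) ?_
  filter_upwards [Tendsto.eventually_lt_const (show (0 : ℝ≥0∞) < 2⁻¹ by simp) h,
    self_mem_nhdsWithin] with r hr hr0
  have hB := hdbl x r hr0
  refine hc.trans ?_
  have h1 : (2⁻¹ : ℝ≥0∞) + 2⁻¹ ≤ μ (ball x r ∩ A) / μ (ball x r) + 2⁻¹ := by
    rw [ENNReal.inv_two_add_inv_two, ← ENNReal.div_self hB.1.ne' hB.2.2.ne]
    calc μ (ball x r) / μ (ball x r)
        ≤ (μ (ball x r ∩ A) + μ (ball x r ∩ Aᶜ)) / μ (ball x r) := by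
          gcongr
          refine le_trans (measure_mono ?_) (measure_union_le _ _)
          rw [← inter_union_distrib_left, union_compl_self, inter_univ]
      _ ≤ _ := by
          rw [ENNReal.add_div]
          gcongr
  exact (ENNReal.add_le_add_iff_right (by simp)).1 h1

lemma GammaDensityProperty.codimH_empty {γ : ℝ} (hγ : GammaDensityProperty μ γ) :
    codimH μ (∅ : Set X) = 0 := by
  refine codimH_mono_null (empty_subset _) (hγ ∅ MeasurableSet.empty ?_)
  have : BVApprox μ ((∅ : Set X).indicator fun _ => (1 : ℝ)) 0 (fun _ _ => 0) (fun _ _ => 0) :=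
    ⟨fun _ _ _ _ => ⟨0, (LipschitzWith.const 0).lipschitzOnWith⟩,
      fun _ => ⟨measurable_const, fun _ _ _ _ _ => by simp⟩, fun _ _ => by simp, fun _ => by simp⟩
  exact this.totalVariation_le.trans_lt (by simp)

/-- At `H`-almost every point a set of finite perimeter has either density zero or lower density
at least `γ`. -/
lemma GammaDensityProperty.codimH_dichotomy (hdbl : DoublingWith μ Cd) {γ : ℝ}
    (hγhalf : γ ≤ 1 / 2) (hγ : GammaDensityProperty μ γ) {E : Set X} (hE : MeasurableSet E)
    (hP : perimeter μ E univ < ⊤) :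
    codimH μ {x | ¬ (DensityZeroAt μ E x ∨ LowerDensityGe μ (ENNReal.ofReal γ) E x)} = 0 := by
  refine codimH_mono_null (fun x hx => ?_) (hγ E hE hP)
  rw [mem_ofPred_eq, not_or] at hx
  refine ⟨⟨pos_iff_ne_zero.2 fun h => hx.1 (densityZeroAt_of_limsup_eq_zero h),
    pos_iff_ne_zero.2 fun h => hx.2 ?_⟩, fun h => hx.2 h.1⟩
  refine lowerDensityGe_of_densityZeroAt_compl hdbl ?_
    (densityZeroAt_of_limsup_eq_zero (by simpa only [sdiff_eq] using h))
  refine (ENNReal.ofReal_le_ofReal hγhalf).trans_eq ?_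
  rw [one_div, ENNReal.ofReal_inv_of_pos two_pos, ENNReal.ofReal_ofNat]

end Density

section Finiteness

variable {μ : Measure X} {Cd : ℝ≥0} {CP lam γ : ℝ}

lemma eventually_measure_superlevel_lt {α : Type*} [MeasurableSpace α] {μ : Measure α} {u : α → ℝ}
    (hu : Measurable u) (hI : eL1Norm μ u ≠ ⊤) {c : ℝ≥0∞} (hc : 0 < c) :
    ∀ᶠ m : ℕ in atTop, μ {x | (m : ℝ) < u x} < c := by
  have h : Tendsto (fun m : ℕ => eL1Norm μ u / (m : ℝ≥0∞)) atTop (𝓝 0) := by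
    simpa using ENNReal.Tendsto.div tendsto_const_nhds (by simp) ENNReal.tendsto_nat_nhds_top
      (Or.inr hI)
  filter_upwards [h.eventually_lt_const hc, eventually_gt_atTop 0] with m hm hm0
  refine lt_of_le_of_lt ?_ hm
  rw [ENNReal.le_div_iff_mul_le (by simp [hm0.ne']) (by simp), mul_comm]
  refine le_trans (mul_le_mul_right (measure_mono fun x hx => ?_) _)
    (mul_meas_ge_le_lintegral (continuous_abs.measurable.comp hu).ennreal_ofReal (m : ℝ≥0∞))
  rw [mem_ofPred_eq] at hx ⊢
  rw [← ENNReal.ofReal_natCast]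
  exact ENNReal.ofReal_le_ofReal (hx.le.trans (le_abs_self _))

lemma codimH_not_densityZeroAt_superlevel [BorelSpace X] [ProperSpace X]
    (hdbl : DoublingWith μ Cd) (hCP : 0 < CP) (hlam : 1 ≤ lam) (hPI : PoincareIneq μ CP lam)
    (hγ0 : 0 < γ) (hγhalf : γ ≤ 1 / 2) (hγ : GammaDensityProperty μ γ)
    {u : X → ℝ} (hu : Measurable u) (hI : eL1Norm μ u ≠ ⊤)
    {M : ℝ≥0∞} (hM : M ≠ ⊤) {v : ℕ → X → ℝ} {g : ℕ → X → ℝ≥0∞} (h : BVApprox μ u M v g) :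
    codimH μ {x | ∀ t : ℝ, ¬ DensityZeroAt μ {y | t < u y} x} = 0 := by
  rcases isEmpty_or_nonempty X with hX | ⟨⟨x₀⟩⟩
  · rw [eq_empty_of_isEmpty {x | ∀ t : ℝ, ¬ DensityZeroAt μ {y | t < u y} x}]
    exact hγ.codimH_empty
  have : Nonempty X := ⟨x₀⟩
  have := hdbl.isLocallyFiniteMeasure
  have hlevel : ∀ m : ℕ, ∃ t : ℝ, (m : ℝ) < t ∧ ∃ v' g', BVApprox μ
      ({x | t < u x}.indicator fun _ => (1 : ℝ)) ((M + 1) / ((m + 1 : ℕ) : ℝ≥0∞)) v' g' := by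
    intro m
    obtain ⟨t, ht, v', g', h'⟩ := h.exists_superlevel hu (a := m) (b := m + (m + 1 : ℕ))
      (M' := (M + 1) / ((m + 1 : ℕ) : ℝ≥0∞)) (by simp; positivity) (by
        rw [add_sub_cancel_left, ENNReal.ofReal_natCast]
        exact ENNReal.div_lt_div_right (by simp) (by simp) (ENNReal.lt_add_right hM one_ne_zero))
    exact ⟨t, ht.1, v', g', h'⟩
  choose t htm v' g' h' using hlevel
  set E : ℕ → Set X := fun m => {y | t m < u y} with hE
  have hEm : ∀ m, MeasurableSet (E m) := fun m => measurableSet_lt measurable_const hu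
  set N : Set X := ⋃ m, {x | ¬ (DensityZeroAt μ (E m) x ∨
    LowerDensityGe μ (ENNReal.ofReal γ) (E m) x)} with hN
  have hN0 : codimH μ N = 0 := codimH_iUnion_null fun m =>
    hγ.codimH_dichotomy hdbl hγhalf (hEm m) ((h' m).totalVariation_le.trans_lt
      (ENNReal.div_lt_top (by simp [hM]) (by simp)))
  set Z : Set X := {x | ∀ t : ℝ, ¬ DensityZeroAt μ {y | t < u y} x} with hZ
  suffices hZN : codimH μ (Z \ N) = 0 from
    codimH_mono_null (subset_sdiff_union Z N) (codimH_union_null hZN hN0)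
  rw [codimH_eq_zero_iff]
  intro R hR
  have h0 := codimH_eq_zero_iff.1 hγ.codimH_empty R hR
  refine le_antisymm (le_trans (codimHContent_mono (B := ⋃ k : ℕ, (Z \ N) ∩ ball x₀ (k + 1)) ?_)
    (codimHContent_iUnion_null fun k => ?_).le) bot_le
  · intro x hx
    obtain ⟨k, hk⟩ := exists_nat_gt (dist x x₀)
    exact mem_iUnion.2 ⟨k, hx, mem_ball.2 (by linarith)⟩
  have hκ : ENNReal.ofReal (γ / 2) ≤ 2⁻¹ := by
    rw [← ENNReal.ofReal_ofNat, ← ENNReal.ofReal_inv_of_pos two_pos]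
    exact ENNReal.ofReal_le_ofReal (by linarith)
  obtain ⟨C, hC, c, hc, hbox⟩ := exists_codimHContent_le hdbl hCP hlam hPI hR h0
    (K := k + 1) (by positivity) x₀ (κ := ENNReal.ofReal (γ / 2)) (by simpa using hγ0) hκ
  have hlim : Tendsto (fun m : ℕ => C * ((M + 1) / ((m + 1 : ℕ) : ℝ≥0∞))) atTop (𝓝 0) := by
    have h1 := ENNReal.Tendsto.div (tendsto_const_nhds (x := M + 1)) (by simp)
      (ENNReal.tendsto_nat_nhds_top.comp (tendsto_add_atTop_nat 1)) (Or.inr (by simp [hM]))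
    simpa using ENNReal.Tendsto.const_mul h1 (Or.inr hC)
  refine le_antisymm (ge_of_tendsto hlim ?_) bot_le
  filter_upwards [eventually_measure_superlevel_lt hu hI hc] with m hm
  refine (codimHContent_mono fun x hx => ?_).trans (hbox (E m) _ _ _ (hEm m) (h' m)
    ((measure_mono fun y (hy : t m < u y) => (htm m).trans hy).trans_lt hm))
  refine ⟨hx.2, ?_⟩
  have hxN : DensityZeroAt μ (E m) x ∨ LowerDensityGe μ (ENNReal.ofReal γ) (E m) x := by
    by_contra hcon
    exact hx.1.2 (mem_iUnion.2 ⟨m, hcon⟩)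
  refine (hxN.resolve_left (hx.1.1 (t m))).eventually_le hdbl ?_
  exact (ENNReal.ofReal_lt_ofReal_iff hγ0).2 (by linarith)

lemma codimH_not_densityZeroAt_abs [BorelSpace X] [ProperSpace X]
    (hdbl : DoublingWith μ Cd) (hCP : 0 < CP) (hlam : 1 ≤ lam) (hPI : PoincareIneq μ CP lam)
    (hγ0 : 0 < γ) (hγhalf : γ ≤ 1 / 2) (hγ : GammaDensityProperty μ γ)
    {u : X → ℝ} (hu : Measurable u) (hI : eL1Norm μ u ≠ ⊤)
    {M : ℝ≥0∞} (hM : M ≠ ⊤) {v : ℕ → X → ℝ} {g : ℕ → X → ℝ≥0∞} (h : BVApprox μ u M v g) :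
    codimH μ {x | ∀ t : ℝ, ¬ DensityZeroAt μ {y | t < |u y|} x} = 0 := by
  refine codimH_mono_null (fun x hx => ?_) (codimH_union_null
    (codimH_not_densityZeroAt_superlevel hdbl hCP hlam hPI hγ0 hγhalf hγ hu hI hM h)
    (codimH_not_densityZeroAt_superlevel hdbl hCP hlam hPI hγ0 hγhalf hγ hu.neg
      (by simpa [eL1Norm] using hI) hM h.neg))
  by_contra hcon
  simp only [mem_union, mem_ofPred_eq, not_or, not_forall, not_not] at hcon
  obtain ⟨⟨s, hs⟩, t, ht⟩ := hcon
  refine hx (max s t) ((hs.union ht).mono fun y (hy : max s t < |u y|) => ?_)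
  rcases lt_abs.1 hy with h | h
  · exact Or.inl ((le_max_left _ _).trans_lt h)
  · exact Or.inr ((le_max_right _ _).trans_lt h)

end Finiteness

section Cluster

variable {μ : Measure X} {Cd : ℝ≥0} {CP lam γ : ℝ} {u : X → ℝ} {x : X}

/-- `S` consists of cluster values of `u` at `x`, and `u` is close to `S` up to sets of density
zero at `x`. -/
structure IsClusterSet (μ : Measure X) (u : X → ℝ) (x : X) (S : Finset ℝ) : Prop where
  nonempty : S.Nonempty
  densityZeroAt : ∀ ε > 0, DensityZeroAt μ {y | ∀ s ∈ S, ε ≤ |u y - s|} x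
  not_densityZeroAt : ∀ s ∈ S, ∀ ε > 0, ¬ DensityZeroAt μ {y | |u y - s| < ε} x

lemma BVApprox.exists_countable_levels [BorelSpace X] [ProperSpace X] [Nonempty X]
    [IsLocallyFiniteMeasure μ] {M : ℝ≥0∞} (hM : M ≠ ⊤) {v : ℕ → X → ℝ} {g : ℕ → X → ℝ≥0∞}
    (h : BVApprox μ u M v g) (hu : Measurable u) :
    ∃ T : Set ℝ, T.Countable ∧ (∀ p q : ℝ, p < q → ∃ t ∈ T, p < t ∧ t < q) ∧
      ∀ s ∈ T, ∀ t ∈ T, s < t → perimeter μ {y | s < u y ∧ u y ≤ t} univ < ⊤ := by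
  have hlevel : ∀ p : {p : ℚ × ℚ // p.1 < p.2}, ∃ t ∈ Ioo (p.1.1 : ℝ) p.1.2, ∃ M' ≠ ⊤, ∃ v' g',
      BVApprox μ ({x | t < u x}.indicator fun _ => (1 : ℝ)) M' v' g' := by
    rintro ⟨⟨p, q⟩, hpq⟩
    have hpq' : (p : ℝ) < q := by exact_mod_cast hpq
    have hlt : M / ENNReal.ofReal ((q : ℝ) - p) < ⊤ := ENNReal.div_lt_top hM (by simpa using hpq')
    obtain ⟨M', hM', hM'top⟩ := exists_between hlt
    obtain ⟨t, ht, h'⟩ := h.exists_superlevel hu hpq' hM'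
    exact ⟨t, ht, M', hM'top.ne, h'⟩
  choose t ht M' hM' v' g' h' using hlevel
  refine ⟨range t, countable_range t, fun p q hpq => ?_, ?_⟩
  · obtain ⟨p', hp', hq'⟩ := exists_rat_btwn hpq
    obtain ⟨q', hp'', hq''⟩ := exists_rat_btwn hq'
    have hlt : p' < q' := by exact_mod_cast hp''
    have := ht ⟨(p', q'), hlt⟩
    exact ⟨_, mem_range_self ⟨(p', q'), hlt⟩, hp'.trans this.1, this.2.trans hq''⟩
  · rintro _ ⟨i, rfl⟩ _ ⟨j, rfl⟩ hij
    have hsub := (h' i).sub (measurable_const.indicator (measurableSet_lt measurable_const hu))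
      (h' j)
    have heq : (fun x => {x | t i < u x}.indicator (fun _ => (1 : ℝ)) x -
        {x | t j < u x}.indicator (fun _ => (1 : ℝ)) x) =
        {y | t i < u y ∧ u y ≤ t j}.indicator fun _ => (1 : ℝ) := by
      ext y
      simp only [indicator_apply, mem_ofPred_eq]
      by_cases h1 : t i < u y <;> by_cases h2 : t j < u y
      · simp [h1, h2, not_le.2 h2]
      · simp [h1, h2, not_lt.1 h2]
      · exact absurd (hij.trans h2) h1
      · simp [h1, h2]
    rw [heq] at hsub
    exact hsub.totalVariation_le.trans_lt
      (ENNReal.add_lt_top.2 ⟨(hM' i).lt_top, (hM' j).lt_top⟩)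

lemma card_mul_le_one_of_lowerDensityGe (hdbl : DoublingWith μ Cd) {ι : Type*} {S : Finset ι}
    {E : ι → Set X} (hE : ∀ i ∈ S, MeasurableSet (E i))
    (hdisj : (S : Set ι).PairwiseDisjoint E) {c κ : ℝ≥0∞} (hκ : κ < c)
    (h : ∀ i ∈ S, LowerDensityGe μ c (E i) x) : S.card * κ ≤ 1 := by
  obtain ⟨r, hr, hr0⟩ := (((Finset.eventually_all S).2 fun i hi =>
    (h i hi).eventually_le hdbl hκ).and self_mem_nhdsWithin).exists
  have hB := hdbl x r hr0
  have hle : S.card * κ * μ (ball x r) ≤ 1 * μ (ball x r) := by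
    calc S.card * κ * μ (ball x r) = ∑ i ∈ S, κ * μ (ball x r) := by
          rw [Finset.sum_const, nsmul_eq_mul, mul_assoc]
      _ ≤ ∑ i ∈ S, μ.restrict (ball x r) (E i) := by
          refine Finset.sum_le_sum fun i hi => ?_
          rw [Measure.restrict_apply (hE i hi), inter_comm]
          exact hr i hi
      _ = μ.restrict (ball x r) (⋃ i ∈ S, E i) := (measure_biUnion_finset hdisj hE).symm
      _ ≤ μ.restrict (ball x r) univ := measure_mono (subset_univ _)
      _ = 1 * μ (ball x r) := by simp
  exact (ENNReal.mul_le_mul_iff_left hB.1.ne' hB.2.2.ne).1 hle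

lemma card_le_of_lowerDensityGe (hdbl : DoublingWith μ Cd) (hγ0 : 0 < γ) {ι : Type*}
    {S : Finset ι} {E : ι → Set X} (hE : ∀ i ∈ S, MeasurableSet (E i))
    (hdisj : (S : Set ι).PairwiseDisjoint E)
    (h : ∀ i ∈ S, LowerDensityGe μ (ENNReal.ofReal γ) (E i) x) : S.card ≤ ⌊1 / γ⌋₊ := by
  by_contra hcon
  rw [not_le, Nat.floor_lt (by positivity), div_lt_iff₀ hγ0] at hcon
  have hS : (0 : ℝ) < S.card := by
    by_contra h0
    nlinarith
  obtain ⟨κ, hκ1, hκ2⟩ := exists_between ((div_lt_iff₀' hS).2 hcon)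
  have hle := card_mul_le_one_of_lowerDensityGe hdbl hE hdisj
    ((ENNReal.ofReal_lt_ofReal_iff hγ0).2 hκ2) h
  rw [← ENNReal.ofReal_natCast, ← ENNReal.ofReal_mul (by positivity), ENNReal.ofReal_le_one] at hle
  rw [div_lt_iff₀' hS] at hκ1
  linarith

lemma exists_isClusterSet (hdbl : DoublingWith μ Cd) (hγ0 : 0 < γ) (hu : Measurable u) {T : Set ℝ}
    (hT : ∀ p q : ℝ, p < q → ∃ t ∈ T, p < t ∧ t < q)
    (hdich : ∀ s ∈ T, ∀ t ∈ T, s < t → DensityZeroAt μ {y | s < u y ∧ u y ≤ t} x ∨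
      LowerDensityGe μ (ENNReal.ofReal γ) {y | s < u y ∧ u y ≤ t} x)
    (hfin : ∃ t : ℝ, DensityZeroAt μ {y | t < |u y|} x) :
    ∃ S : Finset ℝ, S.card ≤ ⌊1 / γ⌋₊ ∧ IsClusterSet μ u x S := by
  set F : Set ℝ := {a | ∀ ε > 0, ¬ DensityZeroAt μ {y | |u y - a| < ε} x} with hF
  have hcard : ∀ S : Finset ℝ, (S : Set ℝ) ⊆ F → S.card ≤ ⌊1 / γ⌋₊ := by
    intro S hS
    obtain ⟨δ, hδ, hsep⟩ : ∃ δ > 0, ∀ a ∈ S, ∀ b ∈ S, a ≠ b → δ ≤ |a - b| := by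
      by_cases hne : S.offDiag.Nonempty
      · refine ⟨S.offDiag.inf' hne fun p => |p.1 - p.2|, ?_, fun a ha b hb hab => ?_⟩
        · rw [gt_iff_lt, Finset.lt_inf'_iff]
          rintro ⟨a, b⟩ hp
          exact abs_pos.2 (sub_ne_zero.2 (Finset.mem_offDiag.1 hp).2.2)
        · exact Finset.inf'_le (fun p : ℝ × ℝ => |p.1 - p.2|)
            (Finset.mem_offDiag.2 ⟨ha, hb, hab⟩ : (a, b) ∈ S.offDiag)
      · refine ⟨1, one_pos, fun a ha b hb hab => (hne ⟨(a, b), ?_⟩).elim⟩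
        exact Finset.mem_offDiag.2 ⟨ha, hb, hab⟩
    choose p hpT hp1 hp2 using fun a : ℝ => hT (a - δ / 2) a (by linarith)
    choose q hqT hq1 hq2 using fun a : ℝ => hT a (a + δ / 2) (by linarith)
    refine card_le_of_lowerDensityGe (x := x) (E := fun a => {y | p a < u y ∧ u y ≤ q a})
      hdbl hγ0 (fun a _ => ?_) (fun a ha b hb hab => ?_) (fun a ha => ?_)
    · exact (measurableSet_lt measurable_const hu).inter (measurableSet_le hu measurable_const)
    · refine Set.disjoint_left.2 fun y (hya : _ ∧ _) (hyb : _ ∧ _) => ?_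
      refine absurd (hsep a ha b hb hab) (not_le.2 (abs_lt.2 ⟨?_, ?_⟩))
      · linarith [hp1 a, hp2 a, hq1 a, hq2 a, hp1 b, hp2 b, hq1 b, hq2 b]
      · linarith [hp1 a, hp2 a, hq1 a, hq2 a, hp1 b, hp2 b, hq1 b, hq2 b]
    · refine (hdich _ (hpT a) _ (hqT a) ((hp2 a).trans (hq1 a))).resolve_left fun h0 => ?_
      refine hS ha (min (a - p a) (q a - a)) (lt_min (sub_pos.2 (hp2 a)) (sub_pos.2 (hq1 a)))
        (h0.mono fun y (hy : |u y - a| < min (a - p a) (q a - a)) => ?_)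
      obtain ⟨h1, h2⟩ := lt_min_iff.1 hy
      rw [abs_lt] at h1 h2
      exact ⟨by linarith, by linarith⟩
  have hFfin : F.Finite := by
    by_contra hinf
    obtain ⟨S, hS, hSc⟩ := (show F.Infinite from hinf).exists_subset_card_eq (⌊1 / γ⌋₊ + 1)
    have := hcard S hS
    omega
  have hzero : ∀ ε > 0, DensityZeroAt μ {y | ∀ s ∈ hFfin.toFinset, ε ≤ |u y - s|} x := by
    intro ε hε
    obtain ⟨t, ht⟩ := hfin
    set K : Set ℝ := closedBall 0 t ∩ {a | ∀ s ∈ hFfin.toFinset, ε ≤ |a - s|} with hK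
    have hKc : IsCompact K := by
      refine (isCompact_closedBall 0 t).inter_right ?_
      simp only [ofPred_forall]
      exact isClosed_biInter fun s _ => isClosed_le continuous_const (by fun_prop)
    have hK0 : DensityZeroAt μ (u ⁻¹' K) x := by
      refine hKc.induction_on (p := fun V => DensityZeroAt μ (u ⁻¹' V) x) densityZeroAt_empty
        (fun _ _ hst ht => ht.mono (preimage_mono hst)) (fun _ _ hs ht => hs.union ht) ?_
      intro a ha
      have haF : a ∉ F := fun h => by
        have := ha.2 a (hFfin.mem_toFinset.2 h)
        rw [_root_.sub_self, abs_zero] at this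
        linarith
      simp only [hF, mem_ofPred_eq, not_forall, not_not] at haF
      obtain ⟨η, hη, h0⟩ := haF
      exact ⟨ball a η, mem_nhdsWithin_of_mem_nhds (ball_mem_nhds a hη), h0⟩
    refine (hK0.union ht).mono fun y hy => ?_
    rcases le_or_gt |u y| t with h | h
    · exact Or.inl ⟨by simpa using h, hy⟩
    · exact Or.inr h
  refine ⟨hFfin.toFinset, hcard _ (by simp), ?_, hzero, fun s hs => hFfin.mem_toFinset.1 hs⟩
  rw [Finset.nonempty_iff_ne_empty]
  intro hemp
  refine hdbl.not_densityZeroAt_univ ((hzero 1 one_pos).mono fun y _ => ?_)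
  rw [hemp]
  simp

lemma BVApprox.codimH_not_exists_isClusterSet [BorelSpace X] [ProperSpace X] [Nonempty X]
    (hdbl : DoublingWith μ Cd) (hCP : 0 < CP) (hlam : 1 ≤ lam) (hPI : PoincareIneq μ CP lam)
    (hγ0 : 0 < γ) (hγhalf : γ ≤ 1 / 2) (hγ : GammaDensityProperty μ γ)
    (hu : Measurable u) (hI : eL1Norm μ u ≠ ⊤)
    {M : ℝ≥0∞} (hM : M ≠ ⊤) {v : ℕ → X → ℝ} {g : ℕ → X → ℝ≥0∞} (h : BVApprox μ u M v g) :
    codimH μ {x | ¬ ∃ S : Finset ℝ, S.card ≤ ⌊1 / γ⌋₊ ∧ IsClusterSet μ u x S} = 0 := by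
  have := hdbl.isLocallyFiniteMeasure
  obtain ⟨T, hTc, hT, hP⟩ := h.exists_countable_levels hM hu
  have := hTc.to_subtype
  set N : T × T → Set X := fun p => {x | p.1.1 < p.2.1 ∧
    ¬ (DensityZeroAt μ {y | p.1.1 < u y ∧ u y ≤ p.2.1} x ∨
      LowerDensityGe μ (ENNReal.ofReal γ) {y | p.1.1 < u y ∧ u y ≤ p.2.1} x)} with hN
  have hN0 : ∀ p, codimH μ (N p) = 0 := by
    intro p
    by_cases hp : p.1.1 < p.2.1
    · refine codimH_mono_null (fun x hx => hx.2) (hγ.codimH_dichotomy hdbl hγhalf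
        ((measurableSet_lt measurable_const hu).inter (measurableSet_le hu measurable_const))
        (hP _ p.1.2 _ p.2.2 hp))
    · refine codimH_mono_null (fun x hx => (hp hx.1).elim) hγ.codimH_empty
  refine codimH_mono_null (fun x hx => ?_) (codimH_union_null
    (codimH_iUnion_null_of_countable hγ.codimH_empty hN0)
    (codimH_not_densityZeroAt_abs hdbl hCP hlam hPI hγ0 hγhalf hγ hu hI hM h))
  by_contra hcon
  simp only [mem_union, mem_iUnion, not_or, not_exists, hN, mem_ofPred_eq, not_and, not_not,
    not_forall] at hcon
  exact hx (exists_isClusterSet hdbl hγ0 hu hT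
    (fun s hs t ht hst => by
      by_contra hc
      rw [not_or] at hc
      exact hc.2 (hcon.1 (⟨s, hs⟩, ⟨t, ht⟩) hst hc.1)) hcon.2)

end Cluster

section JumpValues

variable {μ : Measure X} {Cd : ℝ≥0} {u : X → ℝ} {x : X} {S : Finset ℝ}

lemma sSup_eq_coe {D : Set EReal} {b : ℝ} (h1 : ∀ r : ℝ, r < b → (r : EReal) ∈ D)
    (h2 : ∀ t ∈ D, ∀ r : ℝ, b < r → ¬ (r : EReal) < t) : sSup D = b := by
  refine le_antisymm (sSup_le fun t ht => ?_) ?_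
  · by_contra hcon
    obtain ⟨r, hr1, hr2⟩ := EReal.lt_iff_exists_real_btwn.1 (not_le.1 hcon)
    exact h2 t ht r (by exact_mod_cast hr1) hr2
  · by_contra hcon
    obtain ⟨r, hr1, hr2⟩ := EReal.lt_iff_exists_real_btwn.1 (not_le.1 hcon)
    exact absurd (le_sSup (h1 r (by exact_mod_cast hr2))) (not_le.2 hr1)

lemma sInf_eq_coe {D : Set EReal} {b : ℝ} (h1 : ∀ r : ℝ, b < r → (r : EReal) ∈ D)
    (h2 : ∀ t ∈ D, ∀ r : ℝ, r < b → ¬ t < r) : sInf D = b := by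
  refine le_antisymm ?_ (le_sInf fun t ht => ?_)
  · by_contra hcon
    obtain ⟨r, hr1, hr2⟩ := EReal.lt_iff_exists_real_btwn.1 (not_le.1 hcon)
    exact absurd (sInf_le (h1 r (by exact_mod_cast hr1))) (not_le.2 hr2)
  · by_contra hcon
    obtain ⟨r, hr1, hr2⟩ := EReal.lt_iff_exists_real_btwn.1 (not_le.1 hcon)
    exact h2 t ht r (by exact_mod_cast hr2) hr1

lemma IsClusterSet.lowerApprox_eq (h : IsClusterSet μ u x S) :
    lowerApprox μ u x = S.min' h.nonempty := by
  refine sSup_eq_coe (fun r hr => ?_) fun t ht r hr hrt => ?_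
  · refine (h.densityZeroAt (S.min' h.nonempty - r) (by linarith)).mono fun y hy s hs => ?_
    have hy : u y < r := by exact_mod_cast (show (u y : EReal) < r from hy)
    have := S.min'_le s hs
    rw [abs_sub_comm]
    exact le_trans (by linarith) (le_abs_self _)
  · refine h.not_densityZeroAt _ (S.min'_mem h.nonempty) (r - S.min' h.nonempty) (by linarith)
      (DensityZeroAt.mono ht fun y (hy : |u y - S.min' h.nonempty| < _) => lt_trans ?_ hrt)
    have := (abs_lt.1 hy).2
    exact_mod_cast (by linarith : u y < r)

lemma IsClusterSet.upperApprox_eq (h : IsClusterSet μ u x S) :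
    upperApprox μ u x = S.max' h.nonempty := by
  refine sInf_eq_coe (fun r hr => ?_) fun t ht r hr hrt => ?_
  · refine (h.densityZeroAt (r - S.max' h.nonempty) (by linarith)).mono fun y hy s hs => ?_
    have hy : r < u y := by exact_mod_cast (show (r : EReal) < u y from hy)
    have := S.le_max' s hs
    exact le_trans (by linarith) (le_abs_self _)
  · refine h.not_densityZeroAt _ (S.max'_mem h.nonempty) (S.max' h.nonempty - r) (by linarith)
      (DensityZeroAt.mono ht fun y (hy : |u y - S.max' h.nonempty| < _) => lt_trans hrt ?_)
    have := (abs_lt.1 hy).1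
    exact_mod_cast (by linarith : r < u y)

lemma IsClusterSet.jumpNext_eq (h : IsClusterSet μ u x S) {a b : ℝ} (hb : b ∈ S)
    (hab : a < b) (hgap : ∀ s ∈ S, s ≤ a ∨ b ≤ s) : jumpNext μ u a x = b := by
  refine sSup_eq_coe (fun r hr δ hδ => ?_) fun t ht r hr hrt => ?_
  · refine (h.densityZeroAt (min δ (b - r)) (lt_min hδ (by linarith))).mono
      fun y (hy : _ ∧ _) s hs => ?_
    have hy1 : a + δ < u y := by exact_mod_cast hy.1
    have hy2 : u y < r := by exact_mod_cast hy.2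
    rcases hgap s hs with hsa | hsb
    · exact (min_le_left _ _).trans (le_trans (by linarith) (le_abs_self _))
    · rw [abs_sub_comm]
      exact (min_le_right _ _).trans (le_trans (by linarith) (le_abs_self _))
  · refine h.not_densityZeroAt b hb (min ((b - a) / 2) (r - b))
      (lt_min (by linarith) (by linarith)) (DensityZeroAt.mono (ht ((b - a) / 2) (by linarith))
      fun y (hy : |u y - b| < min ((b - a) / 2) (r - b)) => ?_)
    obtain ⟨h1, h2⟩ := lt_min_iff.1 hy
    have h1 := (abs_lt.1 h1).1
    have h2 := (abs_lt.1 h2).2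
    refine ⟨?_, lt_trans ?_ hrt⟩
    · exact_mod_cast (by linarith : a + (b - a) / 2 < u y)
    · exact_mod_cast (by linarith : u y < r)

lemma IsClusterSet.jumpAux_spec (h : IsClusterSet μ u x S) (l : ℕ) :
    ∃ b ∈ S, jumpAux μ u l x = b ∧ (∀ s ∈ S, s ≤ b → ∃ j ≤ l, jumpAux μ u j x = s) ∧
      (S.filter (b < ·)).card ≤ S.card - (l + 1) := by
  induction l with
  | zero =>
    have hmem := S.min'_mem h.nonempty
    refine ⟨_, hmem, h.lowerApprox_eq, fun s hs hsb => ⟨0, le_rfl, ?_⟩, ?_⟩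
    · rw [le_antisymm hsb (S.min'_le s hs)]
      exact h.lowerApprox_eq
    · rw [zero_add, ← Finset.card_erase_of_mem hmem]
      refine Finset.card_le_card fun s hs => ?_
      rw [Finset.mem_filter] at hs
      exact Finset.mem_erase.2 ⟨hs.2.ne', hs.1⟩
  | succ l ih =>
    obtain ⟨b, hb, hbl, hle, hcard⟩ := ih
    by_cases hbm : b < S.max' h.nonempty
    · have hne : (S.filter (b < ·)).Nonempty :=
        ⟨_, Finset.mem_filter.2 ⟨S.max'_mem h.nonempty, hbm⟩⟩
      set c := (S.filter (b < ·)).min' hne with hc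
      have hcm : c ∈ S.filter (b < ·) := Finset.min'_mem _ hne
      obtain ⟨hcS, hbc⟩ := Finset.mem_filter.1 hcm
      have hgap : ∀ s ∈ S, s ≤ b ∨ c ≤ s := fun s hs => (le_or_gt s b).imp_right fun hbs =>
        Finset.min'_le _ _ (Finset.mem_filter.2 ⟨hs, hbs⟩)
      have hval : jumpAux μ u (l + 1) x = c := by
        rw [jumpAux]
        beta_reduce
        rw [if_pos, hbl, h.jumpNext_eq hcS hbc hgap]
        rw [hbl, h.upperApprox_eq]
        exact_mod_cast hbm
      refine ⟨c, hcS, hval, fun s hs hsc => ?_, ?_⟩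
      · rcases hgap s hs with hsb | hcs
        · obtain ⟨j, hj, hjs⟩ := hle s hs hsb
          exact ⟨j, by omega, hjs⟩
        · exact ⟨l + 1, le_rfl, by rw [hval, le_antisymm hcs hsc]⟩
      · have hsub : S.filter (c < ·) ⊆ (S.filter (b < ·)).erase c := fun s hs => by
          rw [Finset.mem_filter] at hs
          exact Finset.mem_erase.2 ⟨hs.2.ne', Finset.mem_filter.2 ⟨hs.1, hbc.trans hs.2⟩⟩
        have := Finset.card_le_card hsub
        rw [Finset.card_erase_of_mem hcm] at this
        omega
    · have hbeq : b = S.max' h.nonempty := le_antisymm (S.le_max' b hb) (not_lt.1 hbm)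
      refine ⟨b, hb, ?_, fun s hs hsb => ?_, ?_⟩
      · rw [jumpAux]
        beta_reduce
        rw [if_neg, h.upperApprox_eq, hbeq]
        rw [hbl, h.upperApprox_eq, not_lt]
        exact_mod_cast not_lt.1 hbm
      · obtain ⟨j, hj, hjs⟩ := hle s hs hsb
        exact ⟨j, by omega, hjs⟩
      · rw [Finset.filter_eq_empty_iff.2 fun s hs => not_lt.2 (hbeq ▸ S.le_max' s hs)]
        simp

lemma IsClusterSet.exists_jumpVal_eq (h : IsClusterSet μ u x S) (n l : ℕ) :
    ∃ s ∈ S, jumpVal μ u n l x = s := by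
  unfold jumpVal
  split_ifs
  · exact ⟨_, S.max'_mem h.nonempty, h.upperApprox_eq⟩
  · obtain ⟨b, hb, hbl, -⟩ := h.jumpAux_spec (l - 1)
    exact ⟨b, hb, hbl⟩

lemma IsClusterSet.exists_eq_jumpVal (h : IsClusterSet μ u x S) {n : ℕ} (hn : 2 ≤ n)
    (hS : S.card ≤ n) {s : ℝ} (hs : s ∈ S) : ∃ l ∈ Finset.Icc 1 n, jumpVal μ u n l x = s := by
  rcases (S.le_max' s hs).eq_or_lt with hmax | hmax
  · refine ⟨n, Finset.mem_Icc.2 ⟨by omega, le_rfl⟩, ?_⟩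
    rw [jumpVal, if_pos rfl, h.upperApprox_eq, hmax]
  obtain ⟨b, hb, hbl, hle, hcard⟩ := h.jumpAux_spec (n - 2)
  have hsb : s ≤ b := by
    by_contra hcon
    rw [not_le] at hcon
    exact hmax.ne (Finset.card_le_one.1 (hcard.trans (by omega)) _
      (Finset.mem_filter.2 ⟨hs, hcon⟩) _
      (Finset.mem_filter.2 ⟨S.max'_mem h.nonempty, hcon.trans hmax⟩))
  obtain ⟨j, hj, hjs⟩ := hle s hs hsb
  refine ⟨j + 1, Finset.mem_Icc.2 ⟨by omega, by omega⟩, ?_⟩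
  rw [jumpVal, if_neg (by omega), add_tsub_cancel_right, hjs]

lemma densityZeroAt_congr_ae {A B : Set X} (h : A =ᵐ[μ] B) :
    DensityZeroAt μ A x ↔ DensityZeroAt μ B x := by
  have : ∀ r : ℝ, μ (ball x r ∩ A) = μ (ball x r ∩ B) := fun r =>
    measure_congr ((ae_eq_refl _).inter h)
  simp only [DensityZeroAt, this]

lemma jumpVal_congr_ae {u' : X → ℝ} (h : u =ᵐ[μ] u') (n l : ℕ) :
    jumpVal μ u n l = jumpVal μ u' n l := by
  have hpre : ∀ (P : EReal → Prop) (x : X),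
      DensityZeroAt μ {y | P (u y)} x ↔ DensityZeroAt μ {y | P (u' y)} x := fun P x =>
    densityZeroAt_congr_ae (h.mono fun y hy => by
      change P (u y) = P (u' y)
      rw [hy])
  have hlow : lowerApprox μ u = lowerApprox μ u' := funext fun x =>
    congrArg sSup (Set.ext fun t => hpre (· < t) x)
  have hupp : upperApprox μ u = upperApprox μ u' := funext fun x =>
    congrArg sInf (Set.ext fun t => hpre (t < ·) x)
  have hnext : jumpNext μ u = jumpNext μ u' := funext fun p => funext fun x =>
    congrArg sSup (Set.ext fun t => forall₂_congr fun δ _ =>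
      hpre (fun z => p + (δ : EReal) < z ∧ z < t) x)
  have haux : ∀ l, jumpAux μ u l = jumpAux μ u' l := by
    intro l
    induction l with
    | zero => exact hlow
    | succ l ih => simp only [jumpAux, ih, hupp, hnext]
  simp only [jumpVal, hupp, haux]

end JumpValues

section Conclusion

variable {μ : Measure X} {Cd : ℝ≥0} {u : X → ℝ} {x : X}

lemma DoublingWith.ae_densityZeroAt_compl [BorelSpace X] [ProperSpace X]
    (hdbl : DoublingWith μ Cd) {A : Set X} (hA : MeasurableSet A) :
    ∀ᵐ x ∂μ, x ∈ A → DensityZeroAt μ Aᶜ x := by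
  have := hdbl.isUnifLocDoublingMeasure
  have := hdbl.isLocallyFiniteMeasure
  filter_upwards [(IsUnifLocDoublingMeasure.vitaliFamily μ
    1).ae_tendsto_measure_inter_div_of_measurableSet hA.compl] with x hx hxA
  have hball : Tendsto (fun r : ℝ => closedBall x r) (𝓝[>] 0)
      ((IsUnifLocDoublingMeasure.vitaliFamily μ 1).filterAt x) := by
    refine IsUnifLocDoublingMeasure.tendsto_closedBall_filterAt μ (fun _ => x) (fun r => r)
      tendsto_id ?_
    filter_upwards [self_mem_nhdsWithin] with r hr
    exact mem_closedBall_self (by rw [one_mul]; exact (mem_Ioi.1 hr).le)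
  have hlim := hx.comp hball
  rw [indicator_of_notMem (by simpa using hxA)] at hlim
  have hlim' := ENNReal.Tendsto.const_mul (a := (Cd : ℝ≥0∞)) hlim (Or.inr (by simp))
  rw [mul_zero] at hlim'
  refine tendsto_of_tendsto_of_tendsto_of_le_of_le' tendsto_const_nhds hlim'
    (Eventually.of_forall fun _ => bot_le) ?_
  filter_upwards [self_mem_nhdsWithin] with r hr
  have hB := hdbl x r hr
  have hcl := hdbl.measure_closedBall_le x hr
  have hcl0 : μ (closedBall x r) ≠ 0 := (hB.1.trans_le (measure_mono ball_subset_closedBall)).ne'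
  have hcltop : μ (closedBall x r) ≠ ⊤ :=
    (hcl.trans_lt (ENNReal.mul_lt_top (by simp) hB.2.2)).ne
  refine ENNReal.div_le_of_le_mul ?_
  calc μ (ball x r ∩ Aᶜ) ≤ μ (Aᶜ ∩ closedBall x r) := by
        rw [inter_comm]
        exact measure_mono (inter_subset_inter_right _ ball_subset_closedBall)
    _ = μ (Aᶜ ∩ closedBall x r) / μ (closedBall x r) * μ (closedBall x r) :=
        (ENNReal.div_mul_cancel hcl0 hcltop).symm
    _ ≤ μ (Aᶜ ∩ closedBall x r) / μ (closedBall x r) * (Cd * μ (ball x r)) := by gcongr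
    _ = _ := by simp only [Function.comp_apply]; ring

lemma DoublingWith.ae_isClusterSet_singleton [BorelSpace X] [ProperSpace X]
    (hdbl : DoublingWith μ Cd) (hu : Measurable u) : ∀ᵐ x ∂μ, IsClusterSet μ u x {u x} := by
  have hall : ∀ᵐ x ∂μ, ∀ p q : ℚ, x ∈ u ⁻¹' Ioo (p : ℝ) q →
      DensityZeroAt μ (u ⁻¹' Ioo (p : ℝ) q)ᶜ x :=
    ae_all_iff.2 fun p => ae_all_iff.2 fun q =>
      hdbl.ae_densityZeroAt_compl (hu measurableSet_Ioo)
  filter_upwards [hall] with x hx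
  have hfar : ∀ ε : ℝ, 0 < ε → DensityZeroAt μ {y | ε ≤ |u y - u x|} x := by
    intro ε hε
    obtain ⟨p, hp1, hp2⟩ := exists_rat_btwn (show u x - ε < u x by linarith)
    obtain ⟨q, hq1, hq2⟩ := exists_rat_btwn (show u x < u x + ε by linarith)
    refine (hx p q ⟨hp2, hq1⟩).mono fun y hy hyA => ?_
    have hy : ε ≤ |u y - u x| := hy
    have hyA : (p : ℝ) < u y ∧ u y < q := hyA
    exact absurd (abs_lt.2 ⟨by linarith [hyA.1], by linarith [hyA.2]⟩) (not_lt.2 hy)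
  refine ⟨Finset.singleton_nonempty _, fun ε hε => ?_, fun s hs ε hε hzero => ?_⟩
  · simpa using hfar ε hε
  · rw [Finset.mem_singleton.1 hs] at hzero
    refine hdbl.not_densityZeroAt_univ ((hzero.union (hfar ε hε)).mono fun y _ => ?_)
    exact lt_or_ge |u y - u x| ε

/-- Countably many sets of density one at `x` have a common diagonal set of density one. -/
lemma exists_diagonal_of_densityZeroAt_compl (hdbl : DoublingWith μ Cd) {V : ℕ → Set X}
    (hV : Antitone V) (h : ∀ k, DensityZeroAt μ (V k)ᶜ x) :
    ∃ A : Set X, x ∈ A ∧ DensityZeroAt μ Aᶜ x ∧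
      ∀ k, ∃ ρ > 0, ∀ y ∈ A, y ≠ x → dist y x < ρ → y ∈ V k := by
  have hρ : ∀ k, ∃ ρ : ℝ, 0 < ρ ∧ ∀ r, 0 < r → r ≤ ρ →
      μ (ball x r ∩ (V k)ᶜ) ≤ 2⁻¹ ^ k * μ (ball x r) := by
    intro k
    have hev := Tendsto.eventually_lt_const
      (show (0 : ℝ≥0∞) < 2⁻¹ ^ k from ENNReal.pow_pos (by simp) k) (h k)
    obtain ⟨ρ, hρ, hsub⟩ := mem_nhdsGT_iff_exists_Ioc_subset.1 hev
    refine ⟨ρ, hρ, fun r hr hrρ => ?_⟩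
    have hB := hdbl x r hr
    exact (ENNReal.div_le_iff hB.1.ne' hB.2.2.ne).1 (le_of_lt (hsub ⟨hr, hrρ⟩))
  choose ρ hρ0 hρ using hρ
  set A : Set X := {y | y = x ∨ ∀ k, dist y x < ρ k → y ∈ V k} with hA
  refine ⟨A, Or.inl rfl, ?_, fun k => ⟨ρ k, hρ0 k, fun y hy hyx hd => (hy.resolve_left hyx) k hd⟩⟩
  have hbound : ∀ m r, 0 < r → r ≤ ρ m →
      μ (ball x r ∩ Aᶜ) / μ (ball x r) ≤ 2⁻¹ ^ m * 2 := by
    intro m r hr hrm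
    refine ENNReal.div_le_of_le_mul ?_
    have hsub : ball x r ∩ Aᶜ ⊆ ⋃ k, ball x (min r (ρ (m + k))) ∩ (V (m + k))ᶜ := by
      rintro y ⟨hyr, hyA⟩
      have hyr : dist y x < r := hyr
      have hex : ∃ k, dist y x < ρ k ∧ y ∉ V k := by
        by_contra! hcon
        exact hyA (Or.inr hcon)
      obtain ⟨k, hk, hyk⟩ := hex
      rcases le_total k m with hkm | hkm
      · exact mem_iUnion.2 ⟨0, lt_min hyr (hyr.trans_le hrm), fun hy => hyk (hV hkm hy)⟩
      · obtain ⟨j, rfl⟩ := Nat.exists_eq_add_of_le hkm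
        exact mem_iUnion.2 ⟨j, lt_min hyr hk, hyk⟩
    calc μ (ball x r ∩ Aᶜ) ≤ ∑' k, μ (ball x (min r (ρ (m + k))) ∩ (V (m + k))ᶜ) :=
          (measure_mono hsub).trans (measure_iUnion_le _)
      _ ≤ ∑' k, 2⁻¹ ^ (m + k) * μ (ball x r) := by
          refine ENNReal.tsum_le_tsum fun k => ?_
          refine (hρ _ _ (lt_min hr (hρ0 _)) (min_le_right _ _)).trans ?_
          gcongr
          exact min_le_left _ _
      _ = 2⁻¹ ^ m * 2 * μ (ball x r) := by
          simp only [pow_add]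
          rw [ENNReal.tsum_mul_right, ENNReal.tsum_mul_left, ENNReal.tsum_geometric,
            ENNReal.one_sub_inv_two, inv_inv]
  refine ENNReal.tendsto_nhds_zero.2 fun ε hε => ?_
  have hlim : Tendsto (fun m : ℕ => (2⁻¹ : ℝ≥0∞) ^ m * 2) atTop (𝓝 0) := by
    simpa using ENNReal.Tendsto.mul_const (b := (2 : ℝ≥0∞))
      (ENNReal.tendsto_pow_atTop_nhds_zero_of_lt_one (r := 2⁻¹) (by simp)) (Or.inr (by simp))
  obtain ⟨m, hm⟩ := (ENNReal.tendsto_nhds_zero.1 hlim ε hε).exists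
  filter_upwards [Ioc_mem_nhdsGT (hρ0 m)] with r hr
  exact (hbound m r hr.1 hr.2).trans hm

lemma eAbsDiff_coe (a b : ℝ) : eAbsDiff a b = ENNReal.ofReal |a - b| := by
  unfold eAbsDiff
  split_ifs with h1 h2
  · rw [EReal.coe_eq_coe_iff.1 h1]
    simp
  · simp at h2
  · simp

/-- At a point with a finite cluster set, the jump values converge along a set of density one. -/
lemma IsClusterSet.exists_tendsto_jumpVal [BorelSpace X] [ProperSpace X]
    (hdbl : DoublingWith μ Cd) (hu : Measurable u) {n : ℕ} (hn : 2 ≤ n) {S : Finset ℝ}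
    (hS : S.card ≤ n) (h : IsClusterSet μ u x S) :
    ∃ A : Set X, x ∈ A ∧ DensityZeroAt μ Aᶜ x ∧
      ∀ y : ℕ → X, (∀ k, y k ∈ A) → Tendsto y atTop (𝓝 x) → ∀ l₁ ∈ Finset.Icc 1 n,
        Tendsto (fun k => (Finset.Icc 1 n).inf fun l₂ =>
          eAbsDiff (jumpVal μ u n l₁ (y k)) (jumpVal μ u n l₂ x)) atTop (𝓝 0) := by
  set V : ℕ → Set X := fun k =>
    {y | IsClusterSet μ u y {u y} ∧ ∃ s ∈ S, |u y - s| < 1 / ((k : ℝ) + 1)} with hVdef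
  have hV : Antitone V := by
    rintro i j hij y ⟨hy, s, hs, hys⟩
    exact ⟨hy, s, hs, hys.trans_le (one_div_le_one_div_of_le (by positivity) (by simpa using hij))⟩
  have hVd : ∀ k, DensityZeroAt μ (V k)ᶜ x := by
    intro k
    have hnull : μ {y | ¬ IsClusterSet μ u y {u y}} = 0 := hdbl.ae_isClusterSet_singleton hu
    have h0 : DensityZeroAt μ {y | ¬ IsClusterSet μ u y {u y}} x :=
      (densityZeroAt_congr_ae (ae_eq_empty.2 hnull)).2 densityZeroAt_empty
    refine (h0.union (h.densityZeroAt (1 / ((k : ℝ) + 1)) (by positivity))).mono fun y hy => ?_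
    by_cases hyc : IsClusterSet μ u y {u y}
    · refine Or.inr fun s hs => ?_
      by_contra hcon
      exact hy ⟨hyc, s, hs, not_le.1 hcon⟩
    · exact Or.inl hyc
  obtain ⟨A, hxA, hAd, hAV⟩ := exists_diagonal_of_densityZeroAt_compl hdbl hV hVd
  refine ⟨A, hxA, hAd, fun y hy hyx l₁ hl₁ => ENNReal.tendsto_nhds_zero.2 fun ε hε => ?_⟩
  obtain ⟨m, hm⟩ : ∃ m : ℕ, ENNReal.ofReal (1 / ((m : ℝ) + 1)) ≤ ε := by
    have hlim := ENNReal.tendsto_ofReal tendsto_one_div_add_atTop_nhds_zero_nat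
    rw [ENNReal.ofReal_zero] at hlim
    exact (ENNReal.tendsto_nhds_zero.1 hlim ε hε).exists
  obtain ⟨ρ, hρ, hAρ⟩ := hAV m
  filter_upwards [hyx (ball_mem_nhds x hρ)] with k hk
  by_cases hyk : y k = x
  · refine (Finset.inf_le hl₁).trans ?_
    rw [hyk, eAbsDiff, if_pos rfl]
    exact zero_le
  · obtain ⟨hyc, s, hs, hys⟩ := hAρ _ (hy k) hyk hk
    obtain ⟨t, ht, hjt⟩ := hyc.exists_jumpVal_eq n l₁
    rw [Finset.mem_singleton] at ht
    obtain ⟨l₂, hl₂, hjs⟩ := h.exists_eq_jumpVal hn hS hs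
    refine (Finset.inf_le hl₂).trans ?_
    rw [hjt, hjs, eAbsDiff_coe, ht]
    exact (ENNReal.ofReal_le_ofReal hys.le).trans hm

end Conclusion

/-- **Proposition.** For `u ∈ BV(X)` and `H`-a.e. `x ∈ X` there is a set
`A_x ∋ x` of density `1` at `x` such that `min_{l₂} |u^{l₁}(y_k) − u^{l₂}(x)| → 0`
along every sequence `y_k → x` with `y_k ∈ A_x`. -/
theorem bv_convergence_along_density_one_sets
    {X : Type*} [MetricSpace X] [CompleteSpace X] [Nontrivial X]
    [MeasurableSpace X] [BorelSpace X] (μ : Measure X)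
    (Cd : ℝ≥0) (hCd : 1 ≤ Cd) (hdbl : DoublingWith μ Cd)
    (CP lam : ℝ) (hCP : 0 < CP) (hlam : 1 ≤ lam) (hPI : PoincareIneq μ CP lam)
    (γ : ℝ) (hγ0 : 0 < γ) (hγhalf : γ ≤ 1 / 2) (hγ : GammaDensityProperty μ γ)
    (u : X → ℝ) (hu : MemBV μ u) :
    codimH μ {x : X | ¬ ∃ A : Set X, x ∈ A ∧
      Tendsto (fun r : ℝ => μ (ball x r \ A) / μ (ball x r)) (𝓝[>] 0) (𝓝 0) ∧
      ∀ y : ℕ → X, (∀ k, y k ∈ A) → Tendsto y atTop (𝓝 x) →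
        ∀ l₁ ∈ Finset.Icc 1 ⌊1 / γ⌋₊,
          Tendsto (fun k =>
              (Finset.Icc 1 ⌊1 / γ⌋₊).inf fun l₂ =>
                eAbsDiff (jumpVal μ u ⌊1 / γ⌋₊ l₁ (y k)) (jumpVal μ u ⌊1 / γ⌋₊ l₂ x))
            atTop (𝓝 0)} = 0 := by
  have := hdbl.properSpace
  have hn : 2 ≤ ⌊1 / γ⌋₊ := Nat.le_floor (by
    rw [le_div_iff₀ hγ0]
    push_cast
    linarith)
  have hum : AEMeasurable u μ := hu.1.1.aemeasurable
  obtain ⟨v, g, hvg⟩ := exists_bvApprox_of_totalVariation_lt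
    (ENNReal.lt_add_right hu.2.ne one_ne_zero)
  have hI : eL1Norm μ (hum.mk u) ≠ ⊤ := by
    have hint : Integrable (hum.mk u) μ := hu.1.congr hum.ae_eq_mk
    have := hint.2
    simp only [HasFiniteIntegral, ← ofReal_norm, Real.norm_eq_abs] at this
    exact this.ne
  refine codimH_mono_null (fun x hx => ?_)
    (BVApprox.codimH_not_exists_isClusterSet hdbl hCP hlam hPI hγ0 hγhalf hγ
      hum.measurable_mk hI (by simp [hu.2.ne]) (hvg.congr_ae hum.ae_eq_mk))
  rintro ⟨S, hS, hcl⟩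
  obtain ⟨A, hxA, hAd, hA⟩ := hcl.exists_tendsto_jumpVal hdbl hum.measurable_mk hn hS
  refine hx ⟨A, hxA, by simpa only [DensityZeroAt, sdiff_eq] using hAd, ?_⟩
  simpa only [jumpVal_congr_ae hum.ae_eq_mk] using hA

end FineBV
end
end
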